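/- arXiv:2602.01145 — 2 statements merged into one kernel-verified Lean document; each statement's English description precedes it below -/
import Mathlib

section
/- Under the setting of the context (θ-scheme configurations with parameters N_n, M_n → ∞ satisfying the CFL condition θ N_n T [v]_Lip R² < L M_n, initial positions at the ℓ_n-quantile points of ρ̄, 0 < R_i^{(n),m} ≤ R, and discrete densities ρ_n), assume that ρ_n → ρ strongly in L¹(ℝ × [0,T]) for some ρ ∈ L∞(ℝ × [0,T]) with compact support satisfying, for every t ∈ [0,T], ‖ρ(·,t)‖_{L∞(ℝ)} ≤ R and TV(ρ(·,t)) ≤ TV(ρ̄). Then ρ is a weak solution of the Cauchy problem ∂_t ρ + ∂_x(ρ v(ρ)) = 0, ρ(·,0) = ρ̄, on ℝ × [0,T]: for every continuously differentiable test function φ with compact support contained in ℝ × [0,T), ∫_0^T ∫_ℝ ( ρ(x,t) ∂_t φ(x,t) + ρ(x,t) v(ρ(x,t)) ∂_x φ(x,t) ) dx dt + ∫_ℝ ρ̄(x) φ(x,0) dx = 0. -/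
open MeasureTheory Filter

/-- Discrete density `R_i^m = ℓ/(x_{i+1}^m - x_i^m)` for `i < N`, with the
convention `R_N^m = 0`. -/
noncomputable def Rd (N : ℕ) (l : ℝ) (x : ℕ → ℕ → ℝ) (i m : ℕ) : ℝ :=
  if i < N then l / (x (i + 1) m - x i m) else 0

/-- A particle configuration for the θ-scheme with parameters `N, M, ℓ, τ`. -/
def IsScheme (N M : ℕ) (l τ θ : ℝ) (v : ℝ → ℝ) (x : ℕ → ℕ → ℝ) : Prop :=
  (∀ m ≤ M, ∀ i < N, x i m < x (i + 1) m) ∧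
  (∀ m < M, x N (m + 1) = x N m + τ * v 0) ∧
  (∀ m < M, ∀ i < N,
    x i (m + 1) = x i m + τ * (θ * v (Rd N l x i m) + (1 - θ) * v (Rd N l x i (m + 1))))

/-- The fully discrete density
`ρ_N^M(y,t) = Σ_m Σ_i R_i^m 1_{[x_i^m, x_{i+1}^m)}(y) 1_{[t^m, t^{m+1})}(t)`. -/
noncomputable def discDens (N M : ℕ) (l τ : ℝ) (x : ℕ → ℕ → ℝ) (y t : ℝ) : ℝ :=
  ∑ m ∈ Finset.range M, ∑ i ∈ Finset.range N,
    Rd N l x i m * Set.indicator (Set.Ico (x i m) (x (i + 1) m)) (fun _ => (1 : ℝ)) y *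
      Set.indicator (Set.Ico ((m : ℝ) * τ) (((m : ℝ) + 1) * τ)) (fun _ => (1 : ℝ)) t


lemma aux_modulus (F : ℝ → ℝ → ℝ) (hc : Continuous (Function.uncurry F))
    (hs : HasCompactSupport (Function.uncurry F)) :
    (∃ C : ℝ, 0 ≤ C ∧ ∀ y t, |F y t| ≤ C) ∧
    ∀ ε > 0, ∃ K : ℝ, 0 ≤ K ∧ ∀ y t y' t',
      |F y t - F y' t'| ≤ ε + K * (|y - y'| + |t - t'|) := by
  obtain ⟨C, hC⟩ := hs.exists_bound_of_continuous hc
  have hC' : ∀ y t, |F y t| ≤ C := fun y t => hC (y, t)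
  have hC0 : 0 ≤ C := (abs_nonneg _).trans (hC' 0 0)
  refine ⟨⟨C, hC0, hC'⟩, fun ε hε => ?_⟩
  have hu := hs.uniformContinuous_of_continuous hc
  obtain ⟨δ, hδ, h⟩ := Metric.uniformContinuous_iff.1 hu ε hε
  refine ⟨2 * C / δ, by positivity, fun y t y' t' => ?_⟩
  have hp : 0 ≤ 2 * C / δ * (|y - y'| + |t - t'|) := by positivity
  by_cases hd : |y - y'| + |t - t'| < δ
  · have : dist (y, t) (y', t') < δ := by
      rw [Prod.dist_eq]
      simp only [Real.dist_eq]
      refine max_lt ?_ ?_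
      · linarith [abs_nonneg (t - t')]
      · linarith [abs_nonneg (y - y')]
    have := h this
    rw [Real.dist_eq] at this
    simp only [Function.uncurry_apply_pair] at this
    linarith
  · push Not at hd
    have h1 : |F y t - F y' t'| ≤ 2 * C := by
      have := abs_sub (F y t) (F y' t')
      linarith [hC' y t, hC' y' t']
    have h2 : 2 * C ≤ 2 * C / δ * (|y - y'| + |t - t'|) := by
      calc 2 * C = 2 * C / δ * δ := by field_simp
        _ ≤ _ := by gcongr
    linarith

lemma aux_lin (g g' : ℝ → ℝ) (hg : ∀ s, HasDerivAt g (g' s) s) (a b c B : ℝ)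
    (hB : ∀ s, |s - a| ≤ |b - a| → |g' s - c| ≤ B) :
    |g b - g a - c * (b - a)| ≤ B * |b - a| := by
  have := (convex_uIcc a b).norm_image_sub_le_of_norm_hasDerivWithin_le
    (f := fun s => g s - c * s) (f' := fun s => g' s - c) (C := B) (x := a) (y := b)
    (fun s _ => by
      have h1 := (hg s).sub ((hasDerivAt_id s).const_mul c)
      simp only [mul_one] at h1
      exact h1.hasDerivWithinAt)
    (fun s hs => by
      rw [Real.norm_eq_abs]
      exact hB s (Set.abs_sub_left_of_mem_uIcc hs))
    Set.left_mem_uIcc Set.right_mem_uIcc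
  rw [Real.norm_eq_abs, Real.norm_eq_abs] at this
  convert this using 2
  ring

lemma aux_taylor (φ Ft Fx : ℝ → ℝ → ℝ)
    (ht : ∀ y t, HasDerivAt (fun s => φ y s) (Ft y t) t)
    (hx : ∀ y t, HasDerivAt (fun z => φ z t) (Fx y t) y)
    (ε K : ℝ) (hK0 : 0 ≤ K)
    (hKt : ∀ y t y' t', |Ft y t - Ft y' t'| ≤ ε + K * (|y - y'| + |t - t'|))
    (hKx : ∀ y t y' t', |Fx y t - Fx y' t'| ≤ ε + K * (|y - y'| + |t - t'|))
    (y t y' t' : ℝ) :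
    |φ y' t' - φ y t - (Ft y t * (t' - t) + Fx y t * (y' - y))| ≤
      (ε + K * (|y' - y| + |t' - t|)) * (|y' - y| + |t' - t|) := by
  have h1 := aux_lin (fun s => φ y' s) (Ft y') (ht y') t t' (Ft y t)
    (ε + K * (|y' - y| + |t' - t|)) (fun s hs => (hKt _ _ _ _).trans (by gcongr))
  have h2 := aux_lin (fun z => φ z t) (fun z => Fx z t) (fun z => hx z t) y y' (Fx y t)
    (ε + K * (|y' - y| + |t' - t|)) (fun s hs => (hKx _ _ _ _).trans (by
      rw [sub_self, abs_zero, add_zero]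
      have := abs_nonneg (t' - t)
      gcongr
      linarith))
  have h3 := abs_add_le (φ y' t' - φ y' t - Ft y t * (t' - t)) (φ y' t - φ y t - Fx y t * (y' - y))
  rw [show φ y' t' - φ y t - (Ft y t * (t' - t) + Fx y t * (y' - y)) =
    (φ y' t' - φ y' t - Ft y t * (t' - t)) + (φ y' t - φ y t - Fx y t * (y' - y)) by ring]
  linarith

lemma aux_partial (φ : ℝ → ℝ → ℝ) (h : ContDiff ℝ 1 (Function.uncurry φ))
    (hs : HasCompactSupport (Function.uncurry φ)) :
    (∀ y t, HasDerivAt (fun s => φ y s) (deriv (fun s => φ y s) t) t) ∧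
    (∀ y t, HasDerivAt (fun z => φ z t) (deriv (fun z => φ z t) y) y) ∧
    Continuous (Function.uncurry (fun y t => deriv (fun s => φ y s) t)) ∧
    Continuous (Function.uncurry (fun y t => deriv (fun z => φ z t) y)) ∧
    HasCompactSupport (Function.uncurry (fun y t => deriv (fun s => φ y s) t)) ∧
    HasCompactSupport (Function.uncurry (fun y t => deriv (fun z => φ z t) y)) := by
  have hd : ∀ p, HasFDerivAt (Function.uncurry φ) (fderiv ℝ (Function.uncurry φ) p) p :=
    fun p => (h.differentiable (by norm_num) p).hasFDerivAt
  have h1 : ∀ y t, HasDerivAt (fun s => φ y s) (fderiv ℝ (Function.uncurry φ) (y, t) (0, 1)) t := by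
    intro y t
    exact (hd (y, t)).comp_hasDerivAt t ((hasDerivAt_const t y).prodMk (hasDerivAt_id t))
  have h2 : ∀ y t, HasDerivAt (fun z => φ z t) (fderiv ℝ (Function.uncurry φ) (y, t) (1, 0)) y := by
    intro y t
    exact (hd (y, t)).comp_hasDerivAt y ((hasDerivAt_id y).prodMk (hasDerivAt_const y t))
  have e1 : Function.uncurry (fun y t => deriv (fun s => φ y s) t) =
      fun p => fderiv ℝ (Function.uncurry φ) p (0, 1) := by
    ext ⟨y, t⟩; exact (h1 y t).deriv
  have e2 : Function.uncurry (fun y t => deriv (fun z => φ z t) y) =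
      fun p => fderiv ℝ (Function.uncurry φ) p (1, 0) := by
    ext ⟨y, t⟩; exact (h2 y t).deriv
  have hcf := h.continuous_fderiv (by norm_num)
  rw [e1, e2]
  exact ⟨fun y t => (h1 y t).differentiableAt.hasDerivAt,
    fun y t => (h2 y t).differentiableAt.hasDerivAt, by fun_prop, by fun_prop,
    hs.fderiv_apply (𝕜 := ℝ) (0, 1), hs.fderiv_apply (𝕜 := ℝ) (1, 0)⟩

lemma aux_parts (a b : ℕ → ℝ) (M : ℕ) :
    ∑ m ∈ Finset.range M, a m * (b (m + 1) - b m) =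
      a M * b M - a 0 * b 0 - ∑ m ∈ Finset.range M, (a (m + 1) - a m) * b (m + 1) := by
  induction M with
  | zero => simp
  | succ k ih => rw [Finset.sum_range_succ, Finset.sum_range_succ, ih]; ring

lemma aux_cell (F : ℝ → ℝ) (hF : Continuous F) (a b r l B F0 : ℝ) (hab : a < b)
    (hr : 0 < r) (hrl : r * (b - a) = l) (hB : ∀ y ∈ Set.Icc a b, |F y - F0| ≤ B) :
    |(∫ y in a..b, r * F y) - l * F0| ≤ l * B := by
  have e : (∫ y in a..b, r * F y) - l * F0 = ∫ y in a..b, r * (F y - F0) := by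
    have hi : IntervalIntegrable F volume a b := hF.intervalIntegrable _ _
    rw [intervalIntegral.integral_const_mul, intervalIntegral.integral_const_mul,
      intervalIntegral.integral_sub hi (by simp), intervalIntegral.integral_const, ← hrl,
      smul_eq_mul]
    ring
  rw [e]
  have := intervalIntegral.norm_integral_le_of_norm_le_const (a := a) (b := b) (C := r * B)
    (f := fun y => r * (F y - F0)) (fun y hy => by
      rw [Set.uIoc_of_le hab.le] at hy
      rw [Real.norm_eq_abs, abs_mul, abs_of_pos hr]
      have := hB y ⟨hy.1.le, hy.2⟩
      gcongr)
  rw [Real.norm_eq_abs, abs_of_pos (sub_pos.2 hab)] at this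
  rw [← hrl]
  linarith

lemma aux_mono (N : ℕ) (x : ℕ → ℝ) (h : ∀ i < N, x i < x (i + 1)) :
    ∀ i j, i ≤ j → j ≤ N → x i ≤ x j := by
  intro i j hij
  induction j, hij using Nat.le_induction with
  | base => intro _; exact le_rfl
  | succ k hk ih => intro hkN; exact (ih (by omega)).trans (h k (by omega)).le

lemma aux_cells (N : ℕ) (x : ℕ → ℝ) (h : ∀ i < N, x i < x (i + 1)) (r : ℕ → ℝ) (g : ℝ → ℝ)
    (hg : g 0 = 0) (y : ℝ) :
    g (∑ i ∈ Finset.range N, r i * Set.indicator (Set.Ico (x i) (x (i + 1))) (fun _ => (1 : ℝ)) y) =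
      ∑ i ∈ Finset.range N,
        g (r i) * Set.indicator (Set.Ico (x i) (x (i + 1))) (fun _ => (1 : ℝ)) y := by
  have hmono := aux_mono N x h
  by_cases hy : ∃ i < N, y ∈ Set.Ico (x i) (x (i + 1))
  · obtain ⟨i, hi, hyi⟩ := hy
    have hz : ∀ j ∈ Finset.range N, j ≠ i →
        Set.indicator (Set.Ico (x j) (x (j + 1))) (fun _ => (1 : ℝ)) y = 0 := by
      intro j hj hji
      apply Set.indicator_of_notMem
      intro hyj
      have hj := Finset.mem_range.1 hj
      rcases lt_or_gt_of_ne hji with hlt | hlt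
      · have := hmono (j + 1) i (by omega) (by omega)
        linarith [hyj.2, hyi.1]
      · have := hmono (i + 1) j (by omega) (by omega)
        linarith [hyj.1, hyi.2]
    rw [Finset.sum_eq_single_of_mem i (Finset.mem_range.2 hi)
        (fun j hj hji => by rw [hz j hj hji, mul_zero]),
      Finset.sum_eq_single_of_mem i (Finset.mem_range.2 hi)
        (fun j hj hji => by rw [hz j hj hji, mul_zero])]
    rw [Set.indicator_of_mem hyi]
    simp
  · push Not at hy
    have hz : ∀ j ∈ Finset.range N,
        Set.indicator (Set.Ico (x j) (x (j + 1))) (fun _ => (1 : ℝ)) y = 0 :=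
      fun j hj => Set.indicator_of_notMem (hy j (Finset.mem_range.1 hj)) _
    rw [Finset.sum_eq_zero (fun j hj => by rw [hz j hj, mul_zero]),
      Finset.sum_eq_zero (fun j hj => by rw [hz j hj, mul_zero]), hg]

lemma aux_slice (N M : ℕ) (l τ : ℝ) (hτ : 0 < τ) (x : ℕ → ℕ → ℝ) (m : ℕ) (hm : m < M) (y t : ℝ)
    (ht : t ∈ Set.Ico ((m : ℝ) * τ) (((m : ℝ) + 1) * τ)) :
    discDens N M l τ x y t = ∑ i ∈ Finset.range N, Rd N l x i m *
      Set.indicator (Set.Ico (x i m) (x (i + 1) m)) (fun _ => (1 : ℝ)) y := by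
  unfold discDens
  rw [Finset.sum_eq_single_of_mem m (Finset.mem_range.2 hm)]
  · rw [Set.indicator_of_mem ht]; simp
  · intro k _ hk
    apply Finset.sum_eq_zero
    intro i _
    rw [Set.indicator_of_notMem (s := Set.Ico ((k : ℝ) * τ) (((k : ℝ) + 1) * τ)), mul_zero]
    intro hk'
    rcases lt_or_gt_of_ne hk with h | h
    · have h' : ((k : ℝ) + 1) ≤ m := by exact_mod_cast h
      have := mul_le_mul_of_nonneg_right h' hτ.le
      linarith [hk'.2, ht.1]
    · have h' : ((m : ℝ) + 1) ≤ k := by exact_mod_cast h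
      have := mul_le_mul_of_nonneg_right h' hτ.le
      linarith [hk'.1, ht.2]

lemma aux_inner (N M : ℕ) (l τ : ℝ) (hτ : 0 < τ) (x : ℕ → ℕ → ℝ) (m : ℕ) (hm : m < M) (t : ℝ)
    (hx : ∀ i < N, x i m < x (i + 1) m) (v : ℝ → ℝ) (Ft Fx : ℝ → ℝ)
    (hFt : Continuous Ft) (hFx : Continuous Fx)
    (ht : t ∈ Set.Ico ((m : ℝ) * τ) (((m : ℝ) + 1) * τ)) :
    ∫ y, (discDens N M l τ x y t * Ft y +
      discDens N M l τ x y t * v (discDens N M l τ x y t) * Fx y) =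
    ∑ i ∈ Finset.range N, ∫ y in (x i m)..(x (i + 1) m),
      Rd N l x i m * (Ft y + v (Rd N l x i m) * Fx y) := by
  have e : ∀ y, (discDens N M l τ x y t * Ft y +
      discDens N M l τ x y t * v (discDens N M l τ x y t) * Fx y) =
      ∑ i ∈ Finset.range N, Set.indicator (Set.Ico (x i m) (x (i + 1) m))
        (fun y => Rd N l x i m * (Ft y + v (Rd N l x i m) * Fx y)) y := by
    intro y
    rw [aux_slice N M l τ hτ x m hm y t ht]
    have h2 := aux_cells N (fun i => x i m) hx (fun i => Rd N l x i m) (fun r => r * v r) (by simp) y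
    simp only at h2
    rw [h2, Finset.sum_mul, Finset.sum_mul, ← Finset.sum_add_distrib]
    apply Finset.sum_congr rfl
    intro i _
    by_cases hy : y ∈ Set.Ico (x i m) (x (i + 1) m)
    · rw [Set.indicator_of_mem hy, Set.indicator_of_mem hy]; ring
    · rw [Set.indicator_of_notMem hy, Set.indicator_of_notMem hy]; ring
  have hc : ∀ i, Continuous (fun y => Rd N l x i m * (Ft y + v (Rd N l x i m) * Fx y)) := by
    intro i; fun_prop
  simp_rw [e]
  rw [integral_finsetSum]
  · apply Finset.sum_congr rfl
    intro i hi
    rw [integral_indicator measurableSet_Ico, integral_Ico_eq_integral_Ioc,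
      intervalIntegral.integral_of_le (hx i (Finset.mem_range.1 hi)).le]
  · intro i _
    rw [integrable_indicator_iff measurableSet_Ico]
    exact ((hc i).integrableOn_Icc).mono_set Set.Ico_subset_Icc_self

lemma aux_time (N M : ℕ) (l τ : ℝ) (hτ : 0 < τ) (x : ℕ → ℕ → ℝ)
    (hx : ∀ m ≤ M, ∀ i < N, x i m < x (i + 1) m) (v : ℝ → ℝ) (Ft Fx : ℝ → ℝ → ℝ)
    (hFt : Continuous (Function.uncurry Ft)) (hFx : Continuous (Function.uncurry Fx)) :
    ∫ t in (0 : ℝ)..(M * τ), ∫ y, (discDens N M l τ x y t * Ft y t +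
      discDens N M l τ x y t * v (discDens N M l τ x y t) * Fx y t) =
    ∑ m ∈ Finset.range M, ∫ t in ((m : ℝ) * τ)..(((m : ℝ) + 1) * τ),
      ∑ i ∈ Finset.range N, ∫ y in (x i m)..(x (i + 1) m),
        Rd N l x i m * (Ft y t + v (Rd N l x i m) * Fx y t) := by
  have hle : ∀ m : ℕ, (m : ℝ) * τ ≤ ((m : ℝ) + 1) * τ := fun m => by nlinarith
  have hEq : ∀ m < M, Set.EqOn
      (fun t => ∑ i ∈ Finset.range N, ∫ y in (x i m)..(x (i + 1) m),
        Rd N l x i m * (Ft y t + v (Rd N l x i m) * Fx y t))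
      (fun t => ∫ y, (discDens N M l τ x y t * Ft y t +
        discDens N M l τ x y t * v (discDens N M l τ x y t) * Fx y t))
      (Set.uIoo ((m : ℝ) * τ) (((m : ℝ) + 1) * τ)) := by
    intro m hm t ht
    rw [Set.uIoo_of_le (hle m)] at ht
    exact (aux_inner N M l τ hτ x m hm t (hx m hm.le) v (fun y => Ft y t) (fun y => Fx y t)
      (by fun_prop) (by fun_prop) ⟨ht.1.le, ht.2⟩).symm
  have hcont : ∀ m, Continuous (fun t => ∑ i ∈ Finset.range N, ∫ y in (x i m)..(x (i + 1) m),
        Rd N l x i m * (Ft y t + v (Rd N l x i m) * Fx y t)) := by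
    intro m
    apply continuous_finsetSum
    intro i _
    apply intervalIntegral.continuous_parametric_intervalIntegral_of_continuous'
    fun_prop
  have := intervalIntegral.sum_integral_adjacent_intervals (a := fun m : ℕ => (m : ℝ) * τ) (n := M)
    (μ := volume)
    (f := fun t => ∫ y, (discDens N M l τ x y t * Ft y t +
        discDens N M l τ x y t * v (discDens N M l τ x y t) * Fx y t)) (by
      intro m hm
      have := hEq m hm
      push_cast
      exact ((hcont m).intervalIntegrable _ _).congr_uIoo this)
  simp only [Nat.cast_zero, zero_mul] at this
  rw [← this]
  apply Finset.sum_congr rfl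
  intro m hm
  push_cast
  exact (intervalIntegral.integral_congr_uIoo (hEq m (Finset.mem_range.1 hm))).symm

lemma aux_sum_bound (n : ℕ) (f : ℕ → ℝ) (B : ℝ) (h : ∀ i < n, |f i| ≤ B) :
    |∑ i ∈ Finset.range n, f i| ≤ n * B := by
  refine (Finset.abs_sum_le_sum_abs _ _).trans ?_
  refine (Finset.sum_le_sum (fun i hi => h i (Finset.mem_range.1 hi))).trans ?_
  simp

lemma aux_G (N M : ℕ) (l τ V D ε K : ℝ) (hl : 0 < l) (hτ : 0 < τ) (x : ℕ → ℕ → ℝ)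
    (hx : ∀ m ≤ M, ∀ i < N, x i m < x (i + 1) m) (v : ℝ → ℝ) (hV : ∀ r, |v r| ≤ V)
    (hD : ∀ m < M, x N m - x 0 m ≤ D) (hK0 : 0 ≤ K)
    (Ft Fx : ℝ → ℝ → ℝ)
    (hFt : Continuous (Function.uncurry Ft)) (hFx : Continuous (Function.uncurry Fx))
    (hKt : ∀ y t y' t', |Ft y t - Ft y' t'| ≤ ε + K * (|y - y'| + |t - t'|))
    (hKx : ∀ y t y' t', |Fx y t - Fx y' t'| ≤ ε + K * (|y - y'| + |t - t'|)) :
    |(∫ t in (0 : ℝ)..(M * τ), ∫ y, (discDens N M l τ x y t * Ft y t +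
      discDens N M l τ x y t * v (discDens N M l τ x y t) * Fx y t)) -
      ∑ m ∈ Finset.range M, ∑ i ∈ Finset.range N,
        l * τ * (Ft (x i m) (m * τ) + v (Rd N l x i m) * Fx (x i m) (m * τ))| ≤
    M * (τ * ((1 + V) * (N * l * ε + N * l * K * τ + l * K * D))) := by
  have hV0 : 0 ≤ V := (abs_nonneg _).trans (hV 0)
  rw [aux_time N M l τ hτ x hx v Ft Fx hFt hFx, ← Finset.sum_sub_distrib]
  apply aux_sum_bound
  intro m hm
  set H : ℝ → ℝ := fun t => ∑ i ∈ Finset.range N, ∫ y in (x i m)..(x (i + 1) m),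
        Rd N l x i m * (Ft y t + v (Rd N l x i m) * Fx y t) with hH
  set c : ℝ := ∑ i ∈ Finset.range N,
    l * (Ft (x i m) (m * τ) + v (Rd N l x i m) * Fx (x i m) (m * τ)) with hc
  have hcont : Continuous H := by
    apply continuous_finsetSum
    intro i _
    apply intervalIntegral.continuous_parametric_intervalIntegral_of_continuous'
    fun_prop
  have hb : ∀ t ∈ Set.Icc ((m : ℝ) * τ) (((m : ℝ) + 1) * τ), |H t - c| ≤
      (1 + V) * (N * l * ε + N * l * K * τ + l * K * D) := by
    intro t ht
    rw [hH, hc]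
    simp only
    rw [← Finset.sum_sub_distrib]
    refine (Finset.abs_sum_le_sum_abs _ _).trans ?_
    have h1 : ∀ i ∈ Finset.range N,
        |(∫ y in (x i m)..(x (i + 1) m), Rd N l x i m * (Ft y t + v (Rd N l x i m) * Fx y t)) -
          l * (Ft (x i m) (m * τ) + v (Rd N l x i m) * Fx (x i m) (m * τ))| ≤
        (1 + V) * (l * ε + l * K * τ + l * K * (x (i + 1) m - x i m)) := by
      intro i hi
      have hiN := Finset.mem_range.1 hi
      have hxi := hx m hm.le i hiN
      have hxi' : 0 < x (i + 1) m - x i m := sub_pos.2 hxi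
      have hRd : Rd N l x i m = l / (x (i + 1) m - x i m) := by rw [Rd, if_pos hiN]
      have := aux_cell (fun y => Ft y t + v (Rd N l x i m) * Fx y t) (by fun_prop)
        (x i m) (x (i + 1) m) (Rd N l x i m) l
        ((1 + V) * (ε + K * ((x (i + 1) m - x i m) + τ)))
        (Ft (x i m) (m * τ) + v (Rd N l x i m) * Fx (x i m) (m * τ)) hxi
        (by rw [hRd]; positivity) (by rw [hRd]; field_simp) (by
          intro y hy
          have e1 : |y - x i m| ≤ x (i + 1) m - x i m := by
            rw [abs_of_nonneg (by linarith [hy.1])]; linarith [hy.2]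
          have e2 : |t - m * τ| ≤ τ := by
            rw [abs_of_nonneg (by linarith [ht.1])]; linarith [ht.2]
          have e3 : ε + K * (|y - x i m| + |t - m * τ|) ≤
              ε + K * ((x (i + 1) m - x i m) + τ) := by gcongr
          have a1 := (hKt y t (x i m) (m * τ)).trans e3
          have a2 := (hKx y t (x i m) (m * τ)).trans e3
          have a3 : |v (Rd N l x i m) * (Fx y t - Fx (x i m) (m * τ))| ≤
              V * (ε + K * ((x (i + 1) m - x i m) + τ)) := by
            rw [abs_mul]
            exact mul_le_mul (hV _) a2 (abs_nonneg _) hV0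
          have a4 := abs_add_le (Ft y t - Ft (x i m) (m * τ))
            (v (Rd N l x i m) * (Fx y t - Fx (x i m) (m * τ)))
          rw [show Ft y t + v (Rd N l x i m) * Fx y t -
            (Ft (x i m) (m * τ) + v (Rd N l x i m) * Fx (x i m) (m * τ)) =
            (Ft y t - Ft (x i m) (m * τ)) +
            (v (Rd N l x i m) * (Fx y t - Fx (x i m) (m * τ))) by ring]
          linarith)
      refine this.trans (le_of_eq ?_)
      ring
    refine (Finset.sum_le_sum h1).trans ?_
    rw [← Finset.mul_sum]
    gcongr
    rw [Finset.sum_add_distrib, Finset.sum_const, ← Finset.mul_sum,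
      Finset.sum_range_sub (fun i => x i m), Finset.card_range, nsmul_eq_mul]
    have : l * K * (x N m - x 0 m) ≤ l * K * D := by
      have := hD m hm
      gcongr
    linarith
  have e : (∫ t in ((m : ℝ) * τ)..(((m : ℝ) + 1) * τ), H t) -
      ∑ i ∈ Finset.range N,
        l * τ * (Ft (x i m) (m * τ) + v (Rd N l x i m) * Fx (x i m) (m * τ)) =
      ∫ t in ((m : ℝ) * τ)..(((m : ℝ) + 1) * τ), (H t - c) := by
    rw [intervalIntegral.integral_sub (hcont.intervalIntegrable _ _) (by simp),
      intervalIntegral.integral_const, smul_eq_mul, hc, Finset.mul_sum]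
    congr 1
    apply Finset.sum_congr rfl
    intro i _
    ring
  rw [e]
  have hle : (m : ℝ) * τ ≤ ((m : ℝ) + 1) * τ := by nlinarith
  have := intervalIntegral.norm_integral_le_of_norm_le_const (f := fun t => H t - c)
    (a := (m : ℝ) * τ) (b := ((m : ℝ) + 1) * τ)
    (C := (1 + V) * (N * l * ε + N * l * K * τ + l * K * D)) (fun t ht => by
      rw [Set.uIoc_of_le hle] at ht
      exact hb t ⟨ht.1.le, ht.2⟩)
  rw [Real.norm_eq_abs, show ((m : ℝ) + 1) * τ - m * τ = τ by ring, abs_of_pos hτ] at this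
  linarith

lemma aux_main (N M : ℕ) (l τ θ V C D ε K : ℝ) (hl : 0 < l) (hτ : 0 < τ)
    (hθ : θ ∈ Set.Icc (0 : ℝ) 1) (x : ℕ → ℕ → ℝ) (v : ℝ → ℝ)
    (hs : IsScheme N M l τ θ v x) (hV : ∀ r, |v r| ≤ V)
    (hD : ∀ m < M, x N m - x 0 m ≤ D) (hε : 0 ≤ ε) (hK0 : 0 ≤ K) (hC0 : 0 ≤ C)
    (φ Ft Fx : ℝ → ℝ → ℝ)
    (ht : ∀ y t, HasDerivAt (fun s => φ y s) (Ft y t) t)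
    (hx : ∀ y t, HasDerivAt (fun z => φ z t) (Fx y t) y)
    (hFt : Continuous (Function.uncurry Ft)) (hFx : Continuous (Function.uncurry Fx))
    (hCx : ∀ y t, |Fx y t| ≤ C)
    (hKt : ∀ y t y' t', |Ft y t - Ft y' t'| ≤ ε + K * (|y - y'| + |t - t'|))
    (hKx : ∀ y t y' t', |Fx y t - Fx y' t'| ≤ ε + K * (|y - y'| + |t - t'|))
    (hT : ∀ y, φ y (M * τ) = 0) :
    |(∫ t in (0 : ℝ)..(M * τ), ∫ y, (discDens N M l τ x y t * Ft y t +
      discDens N M l τ x y t * v (discDens N M l τ x y t) * Fx y t)) +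
      ∑ i ∈ Finset.range N, l * φ (x i 0) 0| ≤
    M * (τ * ((1 + V) * (N * l * ε + N * l * K * τ + l * K * D))) +
    M * (N * (l * τ * ((1 + V) * (ε + K * (τ * (1 + V)))))) +
    N * (l * τ * (2 * C * V + M * ((ε + K * (τ * (1 + V))) * V))) := by
  obtain ⟨hmono, hlead, hstep⟩ := hs
  have hV0 : 0 ≤ V := (abs_nonneg _).trans (hV 0)
  have hG := aux_G N M l τ V D ε K hl hτ x hmono v hV hD hK0 Ft Fx hFt hFx hKt hKx
  set A := (∫ t in (0 : ℝ)..(M * τ), ∫ y, (discDens N M l τ x y t * Ft y t +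
      discDens N M l τ x y t * v (discDens N M l τ x y t) * Fx y t))
  set w : ℕ → ℕ → ℝ := fun i m => θ * v (Rd N l x i m) + (1 - θ) * v (Rd N l x i (m + 1)) with hw
  have hwV : ∀ i m, |w i m| ≤ V := by
    intro i m
    have h1 := abs_le.1 (hV (Rd N l x i m))
    have h2 := abs_le.1 (hV (Rd N l x i (m + 1)))
    rw [hw]
    simp only
    have := hθ.1
    have : 0 ≤ 1 - θ := by linarith [hθ.2]
    rw [abs_le]
    constructor <;> nlinarith
  have hdx : ∀ m < M, ∀ i < N, |x i (m + 1) - x i m| ≤ τ * V := by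
    intro m hm i hi
    rw [hstep m hm i hi]
    rw [add_sub_cancel_left, abs_mul, abs_of_pos hτ]
    exact mul_le_mul_of_nonneg_left (hwV i m) hτ.le
  have hdt : ∀ m : ℕ, ((m + 1 : ℕ) : ℝ) * τ - m * τ = τ := by
    intro m; push_cast; ring
  -- Taylor
  have hE : |(∑ m ∈ Finset.range M, ∑ i ∈ Finset.range N,
        (l * φ (x i (m + 1)) ((m + 1 : ℕ) * τ) - l * φ (x i m) (m * τ))) -
      ∑ m ∈ Finset.range M, ∑ i ∈ Finset.range N,
        l * τ * (Ft (x i m) (m * τ) + w i m * Fx (x i m) (m * τ))| ≤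
      M * (N * (l * τ * ((1 + V) * (ε + K * (τ * (1 + V)))))) := by
    rw [← Finset.sum_sub_distrib]
    apply aux_sum_bound
    intro m hm
    rw [← Finset.sum_sub_distrib]
    apply aux_sum_bound
    intro i hi
    have h1 := aux_taylor φ Ft Fx ht hx ε K hK0 hKt hKx (x i m) (m * τ) (x i (m + 1))
      ((m + 1 : ℕ) * τ)
    have h2 := hdx m hm i hi
    have h3 : x i (m + 1) - x i m = τ * w i m := by rw [hstep m hm i hi]; ring
    rw [hdt, abs_of_pos hτ] at h1
    have h4 : (ε + K * (|x i (m + 1) - x i m| + τ)) * (|x i (m + 1) - x i m| + τ) ≤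
        (ε + K * (τ * (1 + V))) * (τ * (1 + V)) := by
      have : |x i (m + 1) - x i m| + τ ≤ τ * (1 + V) := by linarith
      gcongr
    rw [show l * φ (x i (m + 1)) ((m + 1 : ℕ) * τ) - l * φ (x i m) (m * τ) -
      l * τ * (Ft (x i m) (m * τ) + w i m * Fx (x i m) (m * τ)) =
      l * (φ (x i (m + 1)) ((m + 1 : ℕ) * τ) - φ (x i m) (m * τ) -
        (Ft (x i m) (m * τ) * τ + Fx (x i m) (m * τ) * (x i (m + 1) - x i m))) by
        rw [h3]; ring, abs_mul, abs_of_pos hl]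
    have := mul_le_mul_of_nonneg_left (h1.trans h4) hl.le
    refine this.trans (le_of_eq ?_)
    ring
  have hTel : (∑ m ∈ Finset.range M, ∑ i ∈ Finset.range N,
        (l * φ (x i (m + 1)) ((m + 1 : ℕ) * τ) - l * φ (x i m) (m * τ))) =
      - ∑ i ∈ Finset.range N, l * φ (x i 0) 0 := by
    rw [Finset.sum_comm, ← Finset.sum_neg_distrib]
    apply Finset.sum_congr rfl
    intro i _
    rw [Finset.sum_range_sub (fun m : ℕ => l * φ (x i m) (m * τ)), hT]
    simp
  -- summation by parts
  have hP : |(∑ m ∈ Finset.range M, ∑ i ∈ Finset.range N,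
        l * τ * (Ft (x i m) (m * τ) + w i m * Fx (x i m) (m * τ))) -
      ∑ m ∈ Finset.range M, ∑ i ∈ Finset.range N,
        l * τ * (Ft (x i m) (m * τ) + v (Rd N l x i m) * Fx (x i m) (m * τ))| ≤
      N * (l * τ * (2 * C * V + M * ((ε + K * (τ * (1 + V))) * V))) := by
    rw [Finset.sum_comm, Finset.sum_comm (s := Finset.range M), ← Finset.sum_sub_distrib]
    apply aux_sum_bound
    intro i hi
    have e : (∑ m ∈ Finset.range M,
          l * τ * (Ft (x i m) (m * τ) + w i m * Fx (x i m) (m * τ))) -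
        ∑ m ∈ Finset.range M,
          l * τ * (Ft (x i m) (m * τ) + v (Rd N l x i m) * Fx (x i m) (m * τ)) =
        l * τ * ((1 - θ) * ∑ m ∈ Finset.range M, Fx (x i m) (m * τ) *
          (v (Rd N l x i (m + 1)) - v (Rd N l x i m))) := by
      rw [← Finset.sum_sub_distrib, Finset.mul_sum, Finset.mul_sum]
      apply Finset.sum_congr rfl
      intro m _
      rw [hw]
      ring
    rw [e, abs_mul, abs_of_pos (mul_pos hl hτ)]
    apply mul_le_mul_of_nonneg_left _ (mul_pos hl hτ).le
    have hb : |∑ m ∈ Finset.range M, Fx (x i m) (m * τ) *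
          (v (Rd N l x i (m + 1)) - v (Rd N l x i m))| ≤
        2 * C * V + M * ((ε + K * (τ * (1 + V))) * V) := by
      rw [aux_parts (fun m => Fx (x i m) (m * τ)) (fun m => v (Rd N l x i m)) M]
      have h1 : |Fx (x i M) (M * τ) * v (Rd N l x i M)| ≤ C * V := by
        rw [abs_mul]; exact mul_le_mul (hCx _ _) (hV _) (abs_nonneg _) hC0
      have h2 : |Fx (x i 0) ((0 : ℕ) * τ) * v (Rd N l x i 0)| ≤ C * V := by
        rw [abs_mul]; exact mul_le_mul (hCx _ _) (hV _) (abs_nonneg _) hC0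
      have h3 : |∑ m ∈ Finset.range M, (Fx (x i (m + 1)) ((m + 1 : ℕ) * τ) - Fx (x i m) (m * τ)) *
          v (Rd N l x i (m + 1))| ≤ M * ((ε + K * (τ * (1 + V))) * V) := by
        apply aux_sum_bound
        intro m hm
        rw [abs_mul]
        refine mul_le_mul ((hKx _ _ _ _).trans ?_) (hV _) (abs_nonneg _) (by positivity)
        rw [hdt, abs_of_pos hτ]
        have := hdx m hm i hi
        have : |x i (m + 1) - x i m| + τ ≤ τ * (1 + V) := by linarith
        gcongr
      have h4 := abs_sub (Fx (x i M) (M * τ) * v (Rd N l x i M) -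
        Fx (x i 0) ((0 : ℕ) * τ) * v (Rd N l x i 0))
        (∑ m ∈ Finset.range M, (Fx (x i (m + 1)) ((m + 1 : ℕ) * τ) - Fx (x i m) (m * τ)) *
          v (Rd N l x i (m + 1)))
      have h5 := abs_sub (Fx (x i M) (M * τ) * v (Rd N l x i M))
        (Fx (x i 0) ((0 : ℕ) * τ) * v (Rd N l x i 0))
      linarith
    rw [abs_mul, abs_of_nonneg (by linarith [hθ.2] : (0 : ℝ) ≤ 1 - θ)]
    have := abs_nonneg (∑ m ∈ Finset.range M, Fx (x i m) (m * τ) *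
          (v (Rd N l x i (m + 1)) - v (Rd N l x i m)))
    nlinarith [hθ.1]
  rw [hTel] at hE
  rw [abs_le] at hG hE hP ⊢
  constructor <;> linarith [hG.1, hG.2, hE.1, hE.2, hP.1, hP.2]

lemma aux_init (ρb ψ : ℝ → ℝ) (L C a b : ℝ) (N : ℕ) (hN : 0 < N) (hL : 0 < L)
    (hi : Integrable ρb) (h0 : ∀ᵐ z, 0 ≤ ρb z) (hLdef : (∫ z, ρb z) = L)
    (ha : ∀ z < a, ρb z = 0) (hb : ∀ z, b < z → ρb z = 0) (xs : ℕ → ℝ) (hxa : xs 0 = a)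
    (hinit : ∀ i < N, IsLeast {z : ℝ | xs i ≤ z ∧ L / N ≤ ∫ s in (xs i)..z, ρb s} (xs (i + 1)))
    (hψ : Continuous ψ) (hψb : ∃ B, ∀ z, ‖ψ z‖ ≤ B) (hψL : ∀ y z, |ψ y - ψ z| ≤ C * |y - z|)
    (hC : 0 ≤ C) :
    xs N ≤ b ∧
    |(∫ z, ρb z * ψ z) - ∑ i ∈ Finset.range N, L / N * ψ (xs i)| ≤ L / N * (C * (b - a)) := by
  have hl : 0 < L / N := by positivity
  have hii : ∀ p q, IntervalIntegrable ρb volume p q := fun p q => hi.intervalIntegrable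
  have hle : ∀ i < N, xs i ≤ xs (i + 1) := fun i hiN => (hinit i hiN).1.1
  have hub : ∀ i < N, xs (i + 1) ≤ b := by
    intro i hiN
    by_contra hcon
    push Not at hcon
    have h1 := (hinit i hiN).1
    by_cases hxb : xs i ≤ b
    · have h2 : (∫ s in b..(xs (i + 1)), ρb s) = 0 := by
        rw [intervalIntegral.integral_of_le hcon.le]
        exact setIntegral_eq_zero_of_forall_eq_zero (fun z hz => hb z hz.1)
      have h3 := intervalIntegral.integral_add_adjacent_intervals (hii (xs i) b)
        (hii b (xs (i + 1)))
      have := (hinit i hiN).2 ⟨hxb, by rw [h2, add_zero] at h3; rw [h3]; exact h1.2⟩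
      linarith
    · push Not at hxb
      have h2 : (∫ s in (xs i)..(xs (i + 1)), ρb s) = 0 := by
        rw [intervalIntegral.integral_of_le h1.1]
        exact setIntegral_eq_zero_of_forall_eq_zero (fun z hz => hb z (hxb.trans hz.1))
      linarith [h1.2]
  have hex : ∀ i < N, (∫ s in (xs i)..(xs (i + 1)), ρb s) = L / N := by
    intro i hiN
    have h1 := (hinit i hiN).1
    refine le_antisymm ?_ h1.2
    by_contra hcon
    push Not at hcon
    have hcont : ContinuousOn (fun z => ∫ s in (xs i)..z, ρb s) (Set.Icc (xs i) (xs (i + 1))) :=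
      (intervalIntegral.continuous_primitive hii (xs i)).continuousOn
    have hmem : L / N ∈ Set.Icc (∫ s in (xs i)..(xs i), ρb s) (∫ s in (xs i)..(xs (i + 1)), ρb s) := by
      rw [intervalIntegral.integral_same]; exact ⟨hl.le, hcon.le⟩
    obtain ⟨z, hz, hzl⟩ := intermediate_value_Icc h1.1 hcont hmem
    simp only at hzl
    have h2 := (hinit i hiN).2 ⟨hz.1, hzl.ge⟩
    have h3 : z = xs (i + 1) := le_antisymm hz.2 h2
    rw [h3] at hzl
    linarith
  have hxN : xs N ≤ b := by
    obtain ⟨k, rfl⟩ : ∃ k, N = k + 1 := ⟨N - 1, by omega⟩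
    exact hub k (by omega)
  refine ⟨hxN, ?_⟩
  have hmonoN : ∀ k ≤ N, xs 0 ≤ xs k := by
    intro k
    induction k with
    | zero => intro _; exact le_rfl
    | succ k ih => intro hk; exact (ih (by omega)).trans (hle k (by omega))
  have htot : (∫ s in (xs 0)..(xs N), ρb s) = L := by
    rw [← intervalIntegral.sum_integral_adjacent_intervals (fun k _ => hii _ _),
      Finset.sum_congr rfl (fun i hi' => hex i (Finset.mem_range.1 hi'))]
    simp
    field_simp
  have hIic : (∫ s in Set.Iic (xs 0), ρb s) = 0 := by
    rw [integral_Iic_eq_integral_Iio]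
    exact setIntegral_eq_zero_of_forall_eq_zero (fun z hz => ha z (hxa ▸ hz))
  have hIoi : (∫ s in Set.Ioi (xs N), ρb s) = 0 := by
    have h1 := intervalIntegral.integral_Iic_sub_Iic (μ := volume) (f := ρb) (a := xs 0) (b := xs N)
      hi.integrableOn hi.integrableOn
    have h2 := intervalIntegral.integral_Iic_add_Ioi (μ := volume) (f := ρb) (b := xs N)
      hi.integrableOn hi.integrableOn
    linarith
  have haeIoi : ∀ᵐ z, z ∈ Set.Ioi (xs N) → ρb z = 0 := by
    have := (setIntegral_eq_zero_iff_of_nonneg_ae (ae_restrict_of_ae h0) hi.integrableOn).1 hIoi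
    exact (ae_restrict_iff' measurableSet_Ioi).1 this
  have hne : ∀ᵐ z : ℝ, z ≠ a := by
    simp [ae_iff]
  have hsplit : (∫ z, ρb z * ψ z) = ∫ z in (xs 0)..(xs N), ρb z * ψ z := by
    rw [intervalIntegral.integral_of_le (hmonoN N le_rfl)]
    symm
    apply setIntegral_eq_integral_of_ae_compl_eq_zero
    filter_upwards [haeIoi, hne] with z hz hza hzn
    have : ρb z = 0 := by
      by_cases h : xs N < z
      · exact hz h
      · push Not at h
        apply ha
        by_contra h'
        push Not at h'
        exact hzn ⟨by rw [hxa]; exact lt_of_le_of_ne h' (Ne.symm hza), h⟩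
    rw [this, zero_mul]
  obtain ⟨B, hB⟩ := hψb
  have hiψ : Integrable (fun z => ρb z * ψ z) :=
    hi.mul_bdd hψ.aestronglyMeasurable (Eventually.of_forall hB)
  rw [hsplit, ← intervalIntegral.sum_integral_adjacent_intervals
    (fun k _ => hiψ.intervalIntegrable), ← Finset.sum_sub_distrib]
  refine (Finset.abs_sum_le_sum_abs _ _).trans ?_
  have hcell : ∀ i ∈ Finset.range N,
      |(∫ z in (xs i)..(xs (i + 1)), ρb z * ψ z) - L / N * ψ (xs i)| ≤
        L / N * (C * (xs (i + 1) - xs i)) := by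
    intro i hi'
    have hiN := Finset.mem_range.1 hi'
    have e : (∫ z in (xs i)..(xs (i + 1)), ρb z * ψ z) - L / N * ψ (xs i) =
        ∫ z in (xs i)..(xs (i + 1)), (ρb z * ψ z - ρb z * ψ (xs i)) := by
      rw [intervalIntegral.integral_sub hiψ.intervalIntegrable ((hii _ _).mul_const _),
        intervalIntegral.integral_mul_const, hex i hiN]
    have e2 : L / N * (C * (xs (i + 1) - xs i)) =
        ∫ z in (xs i)..(xs (i + 1)), ρb z * (C * (xs (i + 1) - xs i)) := by
      rw [intervalIntegral.integral_mul_const, hex i hiN]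
    rw [e, e2, ← Real.norm_eq_abs]
    apply intervalIntegral.norm_integral_le_of_norm_le (hle i hiN) _ ((hii _ _).mul_const _)
    filter_upwards [h0] with z hz hzi
    rw [← mul_sub, norm_mul, Real.norm_eq_abs, Real.norm_eq_abs, abs_of_nonneg hz]
    refine mul_le_mul_of_nonneg_left ((hψL _ _).trans ?_) hz
    rw [abs_of_nonneg (by linarith [hzi.1])]
    exact mul_le_mul_of_nonneg_left (by linarith [hzi.2]) hC
  refine (Finset.sum_le_sum hcell).trans ?_
  rw [← Finset.mul_sum, ← Finset.mul_sum, Finset.sum_range_sub]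
  have : xs N - xs 0 ≤ b - a := by linarith
  gcongr

lemma aux_intble (T B a b : ℝ) (hT : 0 ≤ T) (h : ℝ → ℝ → ℝ) (hm : Measurable (Function.uncurry h))
    (hB : ∀ t ∈ Set.Icc (0 : ℝ) T, ∀ᵐ y, |h y t| ≤ B)
    (hs : ∀ t ∈ Set.Icc (0 : ℝ) T, ∀ y, (y < a ∨ b < y) → h y t = 0) :
    (∀ t ∈ Set.Icc (0 : ℝ) T, Integrable (fun y => h y t)) ∧
    IntervalIntegrable (fun t => ∫ y, h y t) volume 0 T := by
  have e : ∀ t ∈ Set.Icc (0 : ℝ) T, (fun y => h y t) = Set.indicator (Set.Icc a b) (fun y => h y t) := by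
    intro t ht
    ext y
    by_cases hy : y ∈ Set.Icc a b
    · rw [Set.indicator_of_mem hy]
    · rw [Set.indicator_of_notMem hy]
      apply hs t ht
      rw [Set.mem_Icc, not_and_or, not_le, not_le] at hy
      exact hy
  have hmt : ∀ t, Measurable (fun y => h y t) := fun t =>
    hm.comp (measurable_id.prodMk measurable_const)
  refine ⟨fun t ht => ?_, ?_⟩
  · rw [e t ht, integrable_indicator_iff measurableSet_Icc]
    refine Measure.integrableOn_of_bounded (M := B) (by simp) (hmt t).aestronglyMeasurable ?_
    exact ae_restrict_of_ae (hB t ht)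
  · rw [intervalIntegrable_iff_integrableOn_Ioc_of_le hT]
    have hsm : StronglyMeasurable (fun t => ∫ y, h y t) :=
      hm.stronglyMeasurable.integral_prod_left
    refine Measure.integrableOn_of_bounded (M := B * volume.real (Set.Icc a b)) (by simp)
      hsm.aestronglyMeasurable ?_
    refine (ae_restrict_iff' measurableSet_Ioc).2 (Eventually.of_forall fun t ht => ?_)
    have ht' : t ∈ Set.Icc (0 : ℝ) T := ⟨ht.1.le, ht.2⟩
    rw [e t ht', integral_indicator measurableSet_Icc]
    apply norm_setIntegral_le_of_norm_le_const_ae (by simp)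
    exact ae_restrict_of_ae (hB t ht')

lemma aux_conv (T R V K2 C a b : ℝ) (hT : 0 ≤ T) (hR : 0 ≤ R) (f g : ℝ → ℝ → ℝ)
    (hf : Measurable (Function.uncurry f)) (hg : Measurable (Function.uncurry g))
    (hfR : ∀ y t, f y t ∈ Set.Icc 0 R)
    (hgR : ∀ t ∈ Set.Icc (0 : ℝ) T, ∀ᵐ y, |g y t| ≤ R)
    (hfs : ∀ t ∈ Set.Icc (0 : ℝ) T, ∀ y, (y < a ∨ b < y) → f y t = 0)
    (hgs : ∀ t ∈ Set.Icc (0 : ℝ) T, ∀ y, (y < a ∨ b < y) → g y t = 0)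
    (v : ℝ → ℝ) (hv : Measurable v) (hV : ∀ r, |v r| ≤ V)
    (hK2 : ∀ r ∈ Set.Icc (0 : ℝ) R, ∀ s, |s| ≤ R → |r * v r - s * v s| ≤ K2 * |r - s|)
    (Ft Fx : ℝ → ℝ → ℝ)
    (hFt : Continuous (Function.uncurry Ft)) (hFx : Continuous (Function.uncurry Fx))
    (hCt : ∀ y t, |Ft y t| ≤ C) (hCx : ∀ y t, |Fx y t| ≤ C) :
    |(∫ t in (0 : ℝ)..T, ∫ y, (g y t * Ft y t + g y t * v (g y t) * Fx y t)) -
      (∫ t in (0 : ℝ)..T, ∫ y, (f y t * Ft y t + f y t * v (f y t) * Fx y t))| ≤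
    (1 + K2) * C * ∫ t in (0 : ℝ)..T, ∫ y, |f y t - g y t| := by
  have hV0 : 0 ≤ V := (abs_nonneg _).trans (hV 0)
  have hC0 : 0 ≤ C := (abs_nonneg _).trans (hCt 0 0)
  have hbd : ∀ r y t, |r| ≤ R → |r * Ft y t + r * v r * Fx y t| ≤ R * C + R * V * C := by
    intro r y t hr
    refine (abs_add_le _ _).trans ?_
    rw [abs_mul, abs_mul, abs_mul]
    have := hV r; have := hCt y t; have := hCx y t
    gcongr
  have hfR' : ∀ y t, |f y t| ≤ R := fun y t => by
    rw [abs_of_nonneg (hfR y t).1]; exact (hfR y t).2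
  have hmeas : ∀ h : ℝ → ℝ → ℝ, Measurable (Function.uncurry h) →
      Measurable (Function.uncurry fun y t => h y t * Ft y t + h y t * v (h y t) * Fx y t) := by
    intro h hh
    exact (hh.mul hFt.measurable).add ((hh.mul (hv.comp hh)).mul hFx.measurable)
  obtain ⟨f1, f2⟩ := aux_intble T (R * C + R * V * C) a b hT
    (fun y t => f y t * Ft y t + f y t * v (f y t) * Fx y t) (hmeas f hf)
    (fun t _ => Eventually.of_forall fun y => hbd _ _ _ (hfR' y t))
    (fun t ht y hy => by simp [hfs t ht y hy])
  obtain ⟨g1, g2⟩ := aux_intble T (R * C + R * V * C) a b hT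
    (fun y t => g y t * Ft y t + g y t * v (g y t) * Fx y t) (hmeas g hg)
    (fun t ht => by filter_upwards [hgR t ht] with y hy using hbd _ _ _ hy)
    (fun t ht y hy => by simp [hgs t ht y hy])
  obtain ⟨d1, d2⟩ := aux_intble T (R + R) a b hT
    (fun y t => |f y t - g y t|) (hf.sub hg).abs
    (fun t ht => by
      filter_upwards [hgR t ht] with y hy
      rw [abs_abs]
      exact (abs_sub _ _).trans (add_le_add (hfR' y t) hy))
    (fun t ht y hy => by simp [hgs t ht y hy, hfs t ht y hy])
  rw [← intervalIntegral.integral_sub g2 f2, ← intervalIntegral.integral_const_mul,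
    ← Real.norm_eq_abs]
  apply intervalIntegral.norm_integral_le_of_norm_le hT _ (d2.const_mul _)
  refine Eventually.of_forall fun t ht => ?_
  have ht' : t ∈ Set.Icc (0 : ℝ) T := ⟨ht.1.le, ht.2⟩
  rw [← integral_sub (g1 t ht') (f1 t ht'), ← integral_const_mul]
  apply norm_integral_le_of_norm_le ((d1 t ht').const_mul _)
  filter_upwards [hgR t ht'] with y hy
  rw [Real.norm_eq_abs]
  have h1 := hK2 (f y t) (hfR y t) (g y t) hy
  have h2 : |(g y t - f y t) * Ft y t| ≤ |f y t - g y t| * C := by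
    rw [abs_mul, abs_sub_comm]
    exact mul_le_mul_of_nonneg_left (hCt y t) (abs_nonneg _)
  have h3 : |(g y t * v (g y t) - f y t * v (f y t)) * Fx y t| ≤ K2 * |f y t - g y t| * C := by
    rw [abs_mul, abs_sub_comm]
    exact mul_le_mul h1 (hCx y t) (abs_nonneg _) ((abs_nonneg _).trans h1)
  have h4 := abs_add_le ((g y t - f y t) * Ft y t)
    ((g y t * v (g y t) - f y t * v (f y t)) * Fx y t)
  rw [show g y t * Ft y t + g y t * v (g y t) * Fx y t -
    (f y t * Ft y t + f y t * v (f y t) * Fx y t) =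
    (g y t - f y t) * Ft y t + (g y t * v (g y t) - f y t * v (f y t)) * Fx y t by ring]
  linarith

lemma aux_disc (N M : ℕ) (l τ R a b : ℝ) (hτ : 0 < τ) (hR : 0 ≤ R) (x : ℕ → ℕ → ℝ)
    (hx : ∀ m ≤ M, ∀ i < N, x i m < x (i + 1) m)
    (hbnd : ∀ m ≤ M, ∀ i < N, 0 < Rd N l x i m ∧ Rd N l x i m ≤ R)
    (ha : ∀ m ≤ M, a ≤ x 0 m) (hb : ∀ m ≤ M, x N m ≤ b) :
    Measurable (Function.uncurry (discDens N M l τ x)) ∧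
    (∀ y t, discDens N M l τ x y t ∈ Set.Icc 0 R) ∧
    (∀ y t, (y < a ∨ b < y) → discDens N M l τ x y t = 0) := by
  refine ⟨?_, ?_, ?_⟩
  · unfold discDens Function.uncurry
    refine Finset.measurable_sum _ fun m _ => Finset.measurable_sum _ fun i _ => ?_
    refine Measurable.mul (measurable_const.mul ?_) ?_
    · exact (measurable_const.indicator measurableSet_Ico).comp measurable_fst
    · exact (measurable_const.indicator measurableSet_Ico).comp measurable_snd
  · intro y t
    by_cases ht : ∃ m < M, t ∈ Set.Ico ((m : ℝ) * τ) (((m : ℝ) + 1) * τ)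
    · obtain ⟨m, hm, ht⟩ := ht
      rw [aux_slice N M l τ hτ x m hm y t ht]
      constructor
      · apply Finset.sum_nonneg
        intro i hi
        exact mul_nonneg (hbnd m hm.le i (Finset.mem_range.1 hi)).1.le
          (Set.indicator_nonneg (fun _ _ => zero_le_one) _)
      · have h2 := aux_cells N (fun i => x i m) (hx m hm.le) (fun i => Rd N l x i m)
          (fun r => if r ≤ R then 0 else 1) (by simp [hR]) y
        rw [Finset.sum_eq_zero (s := Finset.range N) (f := fun i =>
          (if Rd N l x i m ≤ R then (0 : ℝ) else 1) *
            Set.indicator (Set.Ico (x i m) (x (i + 1) m)) (fun _ => (1 : ℝ)) y)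
          (fun i hi => by rw [if_pos (hbnd m hm.le i (Finset.mem_range.1 hi)).2, zero_mul])] at h2
        by_contra hcon
        rw [if_neg hcon] at h2
        exact one_ne_zero h2
    · push Not at ht
      have : discDens N M l τ x y t = 0 := by
        unfold discDens
        refine Finset.sum_eq_zero fun m hm => Finset.sum_eq_zero fun i _ => ?_
        rw [Set.indicator_of_notMem (ht m (Finset.mem_range.1 hm)), mul_zero]
      rw [this]
      exact ⟨le_rfl, hR⟩
  · intro y t hy
    unfold discDens
    refine Finset.sum_eq_zero fun m hm => Finset.sum_eq_zero fun i hi => ?_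
    have hm := (Finset.mem_range.1 hm).le
    have hi := Finset.mem_range.1 hi
    have h1 := aux_mono N (fun i => x i m) (hx m hm) 0 i (by omega) (by omega)
    have h2 := aux_mono N (fun i => x i m) (hx m hm) (i + 1) N (by omega) (by omega)
    have h3 := ha m hm
    have h4 := hb m hm
    rw [Set.indicator_of_notMem (s := Set.Ico (x i m) (x (i + 1) m)), mul_zero, zero_mul]
    intro hy'
    rcases hy with hy | hy
    · linarith [hy'.1]
    · linarith [hy'.2]

lemma aux_pos (N M : ℕ) (hN : 0 < N) (l τ θ V a b : ℝ) (hτ : 0 < τ)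
    (hθ : θ ∈ Set.Icc (0 : ℝ) 1) (x : ℕ → ℕ → ℝ) (v : ℝ → ℝ)
    (hs : IsScheme N M l τ θ v x) (hV : ∀ r, |v r| ≤ V)
    (ha : a ≤ x 0 0) (hb : x N 0 ≤ b) :
    (∀ m ≤ M, a - M * τ * V ≤ x 0 m) ∧ (∀ m ≤ M, x N m ≤ b + M * τ * V) := by
  obtain ⟨hmono, hlead, hstep⟩ := hs
  have hV0 : 0 ≤ V := (abs_nonneg _).trans (hV 0)
  have key : ∀ m : ℕ, m ≤ M → a - m * (τ * V) ≤ x 0 m ∧ x N m ≤ b + m * (τ * V) := by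
    intro m
    induction m with
    | zero => intro _; simp [ha, hb]
    | succ k ih =>
      intro hk
      obtain ⟨i1, i2⟩ := ih (by omega)
      rw [hlead k (by omega), hstep k (by omega) 0 hN]
      have h1 := abs_le.1 (hV (Rd N l x 0 k))
      have h2 := abs_le.1 (hV (Rd N l x 0 (k + 1)))
      have h3 := mul_le_mul_of_nonneg_left (abs_le.1 (hV 0)).2 hτ.le
      have : -V ≤ θ * v (Rd N l x 0 k) + (1 - θ) * v (Rd N l x 0 (k + 1)) := by
        have := hθ.1
        have : 0 ≤ 1 - θ := by linarith [hθ.2]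
        nlinarith
      have h4 := mul_le_mul_of_nonneg_left this hτ.le
      push_cast
      constructor <;> nlinarith
  have hmm : ∀ m : ℕ, m ≤ M → (m : ℝ) * (τ * V) ≤ M * τ * V := by
    intro m hm
    have : (m : ℝ) ≤ M := by exact_mod_cast hm
    rw [mul_assoc]
    gcongr
  exact ⟨fun m hm => by linarith [(key m hm).1, hmm m hm],
    fun m hm => by linarith [(key m hm).2, hmm m hm]⟩
/-- if the discrete densities converge in `L¹(ℝ × [0,T])` to a bounded,
compactly supported `ρ` with time-sections of bounded variation, then `ρ` is a weak
solution of `∂_t ρ + ∂_x(ρ v(ρ)) = 0`, `ρ(·,0) = ρb`. -/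
theorem limit_is_weak_solution
    (R T L θ Lv : ℝ) (v : ℝ → ℝ) (ρb : ℝ → ℝ)
    (Nn Mn : ℕ → ℕ) (x : ℕ → ℕ → ℕ → ℝ) (ρ : ℝ → ℝ → ℝ)
    (hR : 0 < R) (hT : 0 < T) (hLpos : 0 < L)
    (hθ : θ ∈ Set.Icc (0 : ℝ) 1)
    (hv : ContDiffOn ℝ 1 v (Set.Icc 0 R))
    (hv' : ∀ ρ' ∈ Set.Icc (0 : ℝ) R, derivWithin v (Set.Icc 0 R) ρ' < 0)
    (hvleft : ∀ ρ' < (0 : ℝ), v ρ' = v 0)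
    (hvright : ∀ ρ', R < ρ' → v ρ' = v R)
    (hLv : ∀ a ∈ Set.Icc (0 : ℝ) R, ∀ b ∈ Set.Icc (0 : ℝ) R, |v a - v b| ≤ Lv * |a - b|)
    (hBV : BoundedVariationOn ρb Set.univ)
    (hsupp : HasCompactSupport ρb)
    (hbound : ∀ᵐ z ∂(volume : Measure ℝ), ρb z ∈ Set.Icc 0 R)
    (hLdef : (∫ z, ρb z) = L)
    (hNpos : ∀ n, 0 < Nn n) (hMpos : ∀ n, 0 < Mn n)
    (hNtop : Tendsto Nn atTop atTop) (hMtop : Tendsto Mn atTop atTop)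
    (hCFL : ∀ n, θ * (Nn n) * T * Lv * R ^ 2 < L * (Mn n))
    (hscheme : ∀ n, IsScheme (Nn n) (Mn n) (L / Nn n) (T / Mn n) θ v (x n))
    (hinit0 : ∀ n, x n 0 0 = sInf (tsupport ρb))
    (hinit : ∀ n, ∀ i < Nn n,
      IsLeast {z : ℝ | x n i 0 ≤ z ∧ L / Nn n ≤ ∫ s in (x n i 0)..z, ρb s} (x n (i + 1) 0))
    (hbnd : ∀ n, ∀ m ≤ Mn n, ∀ i < Nn n,
      0 < Rd (Nn n) (L / Nn n) (x n) i m ∧ Rd (Nn n) (L / Nn n) (x n) i m ≤ R)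
    (hρmeas : Measurable (Function.uncurry ρ))
    (hρsupp : ∃ A B : ℝ, ∀ t ∈ Set.Icc (0 : ℝ) T, ∀ y : ℝ, (y < A ∨ B < y) → ρ y t = 0)
    (hρbd : ∀ t ∈ Set.Icc (0 : ℝ) T, ∀ᵐ y ∂(volume : Measure ℝ), |ρ y t| ≤ R)
    (hρTV : ∀ t ∈ Set.Icc (0 : ℝ) T,
      eVariationOn (fun y => ρ y t) Set.univ ≤ eVariationOn ρb Set.univ)
    (hconv : Tendsto
      (fun n => ∫ t in (0 : ℝ)..T, ∫ y : ℝ,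
        |discDens (Nn n) (Mn n) (L / Nn n) (T / Mn n) (x n) y t - ρ y t|)
      atTop (nhds 0)) :
    ∀ φ : ℝ → ℝ → ℝ,
      ContDiff ℝ 1 (Function.uncurry φ) →
      HasCompactSupport (Function.uncurry φ) →
      (∀ y : ℝ, ∀ t : ℝ, T ≤ t → φ y t = 0) →
      (∫ t in (0 : ℝ)..T, ∫ y : ℝ,
          (ρ y t * deriv (fun s => φ y s) t +
            ρ y t * v (ρ y t) * deriv (fun z => φ z t) y)) +
        (∫ y : ℝ, ρb y * φ y 0) = 0 := by
  intro φ hφ hφs hφT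
  -- properties of `v`
  have hLv0 : 0 ≤ Lv := by
    have h1 := hLv 0 ⟨le_rfl, hR.le⟩ R ⟨hR.le, le_rfl⟩
    rw [zero_sub, abs_neg, abs_of_pos hR] at h1
    by_contra hcon
    push Not at hcon
    have := mul_neg_of_neg_of_pos hcon hR
    linarith [abs_nonneg (v 0 - v R)]
  have hcl : ∀ r, max 0 (min R r) ∈ Set.Icc (0 : ℝ) R :=
    fun r => ⟨le_max_left _ _, max_le hR.le (min_le_left _ _)⟩
  have hvcl : ∀ r, v r = v (max 0 (min R r)) := by
    intro r
    by_cases h0 : r < 0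
    · rw [min_eq_right (by linarith), max_eq_left h0.le, hvleft r h0]
    · push Not at h0
      by_cases h1 : R < r
      · rw [min_eq_left h1.le, max_eq_right hR.le, hvright r h1]
      · push Not at h1
        rw [min_eq_right h1, max_eq_right h0]
  have hvc : Continuous v := by
    have : Continuous (fun r => v (max 0 (min R r))) :=
      hv.continuousOn.comp_continuous (by fun_prop) hcl
    have e : v = fun r => v (max 0 (min R r)) := funext hvcl
    rw [e]; exact this
  obtain ⟨V, hV'⟩ := isCompact_Icc.exists_bound_of_continuousOn hv.continuousOn
  have hV : ∀ r, |v r| ≤ V := fun r => by rw [hvcl r]; exact hV' _ (hcl r)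
  have hV0 : 0 ≤ V := (abs_nonneg _).trans (hV 0)
  have hK2 : ∀ r ∈ Set.Icc (0 : ℝ) R, ∀ s, |s| ≤ R →
      |r * v r - s * v s| ≤ (R * Lv + V) * |r - s| := by
    intro r hr s _
    have h1 : |v r - v s| ≤ Lv * |r - s| := by
      rw [hvcl s]
      refine (hLv r hr _ (hcl s)).trans (mul_le_mul_of_nonneg_left ?_ hLv0)
      have hr' : r = max 0 (min R r) := by rw [min_eq_right hr.2, max_eq_right hr.1]
      conv_lhs => rw [hr']
      rw [max_comm 0 (min R r), max_comm 0 (min R s)]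
      refine (abs_max_sub_max_le_abs (min R r) (min R s) 0).trans ?_
      rw [min_comm R r, min_comm R s]
      exact abs_inf_sub_inf_le_abs r s R
    have h2 : |r * (v r - v s)| ≤ R * (Lv * |r - s|) := by
      rw [abs_mul, abs_of_nonneg hr.1]
      exact mul_le_mul hr.2 h1 (abs_nonneg _) hR.le
    have h3 : |(r - s) * v s| ≤ |r - s| * V := by
      rw [abs_mul]; exact mul_le_mul_of_nonneg_left (hV s) (abs_nonneg _)
    have h4 := abs_add_le (r * (v r - v s)) ((r - s) * v s)
    rw [show r * v r - s * v s = r * (v r - v s) + (r - s) * v s by ring]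
    linarith
  -- test function
  obtain ⟨hdt, hdx, hFtc, hFxc, hFts, hFxs⟩ := aux_partial φ hφ hφs
  set Ft : ℝ → ℝ → ℝ := fun y t => deriv (fun s => φ y s) t with hFt
  set Fx : ℝ → ℝ → ℝ := fun y t => deriv (fun z => φ z t) y with hFx
  obtain ⟨⟨C1, hC10, hC1⟩, hmod1⟩ := aux_modulus Ft hFtc hFts
  obtain ⟨⟨C2, hC20, hC2⟩, hmod2⟩ := aux_modulus Fx hFxc hFxs
  obtain ⟨Cφ, hCφ⟩ := hφs.exists_bound_of_continuous hφ.continuous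
  set C := C1 + C2 with hC
  have hC0 : 0 ≤ C := by positivity
  have hCt : ∀ y t, |Ft y t| ≤ C := fun y t => (hC1 y t).trans (by linarith)
  have hCx : ∀ y t, |Fx y t| ≤ C := fun y t => (hC2 y t).trans (by linarith)
  have hψL : ∀ y z, |φ y 0 - φ z 0| ≤ C * |y - z| := by
    intro y z
    have := aux_lin (fun z => φ z 0) (fun z => Fx z 0) (fun z => hdx z 0) z y 0 C
      (fun s _ => by rw [sub_zero]; exact hCx s 0)
    simpa using this
  have hψc : Continuous (fun y => φ y 0) := by
    exact hφ.continuous.comp (f := fun y : ℝ => (y, (0 : ℝ))) (by fun_prop)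
  -- initial datum
  have hi : Integrable ρb := by
    by_contra hcon
    rw [integral_undef hcon] at hLdef
    linarith
  have h0 : ∀ᵐ z, 0 ≤ ρb z := hbound.mono fun z hz => hz.1
  have hcs : IsCompact (tsupport ρb) := hsupp
  obtain ⟨b, hb⟩ := hcs.bddAbove
  set a := sInf (tsupport ρb) with ha
  have haz : ∀ z < a, ρb z = 0 := by
    intro z hz
    by_contra hcon
    have := csInf_le hcs.bddBelow (subset_tsupport ρb hcon)
    linarith
  have hbz : ∀ z, b < z → ρb z = 0 := by
    intro z hz
    by_contra hcon
    have := hb (subset_tsupport ρb hcon)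
    linarith
  obtain ⟨A₀, B₀, hAB⟩ := hρsupp
  set I0 := ∫ y : ℝ, ρb y * φ y 0 with hI0
  set A := ∫ t in (0 : ℝ)..T, ∫ y : ℝ, (ρ y t * Ft y t + ρ y t * v (ρ y t) * Fx y t) with hA
  set dn : ℕ → ℝ := fun n => ∫ t in (0 : ℝ)..T, ∫ y : ℝ,
        |discDens (Nn n) (Mn n) (L / Nn n) (T / Mn n) (x n) y t - ρ y t| with hdn
  set D := (b + T * V) - (a - T * V) with hD
  have hmain : ∀ ε > 0, |A + I0| ≤ (3 * (1 + V) * T * L) * ε := by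
    intro ε hε
    obtain ⟨K1, hK10, hK1⟩ := hmod1 ε hε
    obtain ⟨K2', hK20, hK2'⟩ := hmod2 ε hε
    set K := K1 + K2' with hK
    have hK0 : 0 ≤ K := by positivity
    have hKt : ∀ y t y' t', |Ft y t - Ft y' t'| ≤ ε + K * (|y - y'| + |t - t'|) := by
      intro y t y' t'
      refine (hK1 y t y' t').trans ?_
      gcongr
      linarith
    have hKx : ∀ y t y' t', |Fx y t - Fx y' t'| ≤ ε + K * (|y - y'| + |t - t'|) := by
      intro y t y' t'
      refine (hK2' y t y' t').trans ?_
      gcongr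
      linarith
    let F : ℝ × ℝ × ℝ → ℝ := fun p =>
      (1 + (R * Lv + V)) * C * p.2.2 +
      (T * ((1 + V) * (L * ε + L * K * p.1 + p.2.1 * K * D)) +
        T * L * ((1 + V) * (ε + K * (p.1 * (1 + V)))) +
        L * (2 * C * V * p.1 + T * ((ε + K * (p.1 * (1 + V))) * V))) +
      p.2.1 * (C * (b - a))
    have hFc : Continuous F := by fun_prop
    have hbn : ∀ n, |A + I0| ≤ F (T / Mn n, L / Nn n, dn n) := by
      intro n
      have hNp : (0 : ℝ) < Nn n := by exact_mod_cast hNpos n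
      have hMp : (0 : ℝ) < Mn n := by exact_mod_cast hMpos n
      set τ := T / Mn n with hτd
      set l := L / Nn n with hld
      have hτ : 0 < τ := by positivity
      have hl : 0 < l := by positivity
      have hMτ : (Mn n : ℝ) * τ = T := by rw [hτd]; field_simp
      have hNl : (Nn n : ℝ) * l = L := by rw [hld]; field_simp
      obtain ⟨hxN, hI⟩ := aux_init ρb (fun y => φ y 0) L C a b (Nn n) (hNpos n) hLpos hi h0 hLdef
        haz hbz (fun i => x n i 0) (hinit0 n) (hinit n) hψc ⟨Cφ, fun z => hCφ (z, 0)⟩ hψL hC0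
      obtain ⟨hp1, hp2⟩ := aux_pos (Nn n) (Mn n) (hNpos n) l τ θ V a b hτ hθ (x n) v (hscheme n) hV
        (hinit0 n).ge hxN
      rw [hMτ] at hp1 hp2
      obtain ⟨hd1, hd2, hd3⟩ := aux_disc (Nn n) (Mn n) l τ R (a - T * V) (b + T * V) hτ hR.le (x n)
        (hscheme n).1 (hbnd n) hp1 hp2
      have hmn := aux_main (Nn n) (Mn n) l τ θ V C D ε K hl hτ hθ (x n) v (hscheme n) hV
        (fun m hm => by linarith [hp1 m hm.le, hp2 m hm.le]) hε.le hK0 hC0 φ Ft Fx hdt hdx hFtc hFxc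
        hCx hKt hKx (fun y => hφT y _ hMτ.ge)
      rw [hMτ] at hmn
      have hcv := aux_conv T R V (R * Lv + V) C (min A₀ (a - T * V)) (max B₀ (b + T * V)) hT.le hR.le
        (discDens (Nn n) (Mn n) l τ (x n)) ρ hd1 hρmeas hd2 hρbd
        (fun t _ y hy => hd3 y t (hy.imp (fun h => h.trans_le (min_le_right _ _))
          (fun h => (le_max_right _ _).trans_lt h)))
        (fun t ht y hy => hAB t ht y (hy.imp (fun h => h.trans_le (min_le_left _ _))
          (fun h => (le_max_left _ _).trans_lt h)))
        v hvc.measurable hV hK2 Ft Fx hFtc hFxc hCt hCx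
      have e1 : (Mn n : ℝ) * (τ * ((1 + V) * (Nn n * l * ε + Nn n * l * K * τ + l * K * D))) =
          T * ((1 + V) * (L * ε + L * K * τ + l * K * D)) := by
        rw [hNl, ← mul_assoc, hMτ]
      have e2 : (Mn n : ℝ) * (Nn n * (l * τ * ((1 + V) * (ε + K * (τ * (1 + V)))))) =
          T * L * ((1 + V) * (ε + K * (τ * (1 + V)))) := by
        rw [← hMτ, ← hNl]; ring
      have e3 : (Nn n : ℝ) * (l * τ * (2 * C * V + Mn n * ((ε + K * (τ * (1 + V))) * V))) =
          L * (2 * C * V * τ + T * ((ε + K * (τ * (1 + V))) * V)) := by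
        rw [← hMτ, ← hNl]; ring
      rw [e1, e2, e3] at hmn
      simp only [F]
      rw [abs_le] at hI hmn hcv ⊢
      constructor <;> linarith [hI.1, hI.2, hmn.1, hmn.2, hcv.1, hcv.2]
    have hτlim : Tendsto (fun n => T / (Mn n : ℝ)) atTop (nhds 0) :=
      (tendsto_const_div_atTop_nhds_zero_nat T).comp hMtop
    have hllim : Tendsto (fun n => L / (Nn n : ℝ)) atTop (nhds 0) :=
      (tendsto_const_div_atTop_nhds_zero_nat L).comp hNtop
    have hlim : Tendsto (fun n => F (T / Mn n, L / Nn n, dn n)) atTop (nhds (F (0, 0, 0))) :=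
      (hFc.tendsto _).comp (hτlim.prodMk_nhds (hllim.prodMk_nhds hconv))
    have hfin := ge_of_tendsto' hlim hbn
    refine hfin.trans ?_
    simp only [F]
    have : 0 ≤ T * L * ε := by positivity
    nlinarith
  have hzero : |A + I0| ≤ 0 := by
    have hlim : Tendsto (fun ε : ℝ => (3 * (1 + V) * T * L) * ε) (nhdsWithin 0 (Set.Ioi 0))
        (nhds ((3 * (1 + V) * T * L) * 0)) :=
      ((continuous_const.mul continuous_id).tendsto 0).mono_left nhdsWithin_le_nhds
    rw [mul_zero] at hlim
    refine ge_of_tendsto hlim ?_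
    filter_upwards [self_mem_nhdsWithin] with ε hε using hmain ε hε
  exact abs_nonpos_iff.1 hzero
end

section
/- Under the setting of the context (θ-scheme configurations with parameters N_n, M_n → ∞ satisfying the CFL condition θ N_n T [v]_Lip R² < L M_n, initial positions at the ℓ_n-quantile points of ρ̄, 0 < R_i^{(n),m} ≤ R, and discrete densities ρ_n), assume in addition that N_n/M_n → 0 (equivalently τ_n/ℓ_n → 0), and that ρ_n → ρ strongly in L¹(ℝ × [0,T]) for some ρ ∈ L∞(ℝ × [0,T]) with compact support satisfying, for every t ∈ [0,T], ‖ρ(·,t)‖_{L∞(ℝ)} ≤ R and TV(ρ(·,t)) ≤ TV(ρ̄). Then ρ is an entropy solution: for every k ∈ [0,R] and every nonnegative continuously differentiable test function φ with compact support contained in ℝ × [0,T), ∫_0^T ∫_ℝ ( |ρ − k| ∂_t φ + sgn(ρ − k)( f(ρ) − f(k) ) ∂_x φ ) dx dt + ∫_ℝ |ρ̄(x) − k| φ(x,0) dx ≥ 0, where f(ρ) = ρ v(ρ). -/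
open MeasureTheory Filter

set_option maxHeartbeats 1000000 in
lemma cell_ineq {k R l τ θ Lv Cv K δ r r' vr vr' vk V0 V1 Q0 Q1 D D' P0 P1 P0' P1' p0 p1 : ℝ}
    (hk0 : 0 ≤ k) (hkR : k ≤ R) (hr0 : 0 < r) (hrR : r ≤ R) (hr0' : 0 < r') (hrR' : r' ≤ R)
    (hτ : 0 ≤ τ) (hθ0 : 0 ≤ θ) (hθ1 : θ ≤ 1) (hLv : 0 ≤ Lv) (hK : 0 ≤ K)
    (hCFL : θ * τ * Lv * R ^ 2 ≤ l) (hD0 : 0 < D)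
    (hD : r * D = l) (hD' : r' * D' = l) (hDD : D' = D + τ * (V1 - V0))
    (hm1 : r ≤ k → vk ≤ vr) (hm2 : k ≤ r → vr ≤ vk)
    (hm1' : r' ≤ k → vk ≤ vr') (hm2' : k ≤ r' → vr' ≤ vk)
    (hl1 : |vr - vk| ≤ Lv * |r - k|) (hl2 : |vr' - vr| ≤ Lv * |r' - r|)
    (hvr : |vr| ≤ Cv) (hV0b : |V0| ≤ Cv) (hV1b : |V1| ≤ Cv)
    (hV0 : V0 = θ * vr + (1 - θ) * vr') (hQ1 : |V1 - vk| ≤ Q1)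
    (hQ0 : Q0 = θ * |vr - vk| + (1 - θ) * |vr' - vk|)
    (hδ : |r' - r| ≤ δ) (hp0 : 0 ≤ p0) (hp1 : 0 ≤ p1)
    (hp : |p1 - p0| ≤ K * D) (hP : 0 ≤ P1 - P0)
    (hPp1 : |P1 - P0 - D * p1| ≤ K * D ^ 2) (hPp0 : |P1 - P0 - D * p0| ≤ K * D ^ 2)
    (hβ0 : |P0' - P0 - τ * V0 * p0| ≤ K * τ ^ 2 * Cv ^ 2)
    (hβ1 : |P1' - P1 - τ * V1 * p1| ≤ K * τ ^ 2 * Cv ^ 2) :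
    |r' - k| * (P1' - P0') - |r - k| * (P1 - P0) ≤
      τ * ((|r - k| * vr - k * |vr - vk|) * (p1 - p0) + k * (Q1 * p1 - Q0 * p0))
        + τ * δ * D * (K * (5 * Cv + 5 * R * Lv)) + τ * K * l * |V1 - V0|
        + 2 * R * K * Cv ^ 2 * τ ^ 2 := by
  have hR : 0 ≤ R := hk0.trans hkR
  have hCv : 0 ≤ Cv := (abs_nonneg _).trans hvr
  have hδ0 : 0 ≤ δ := (abs_nonneg _).trans hδ
  -- the sign
  obtain ⟨s, hs, hs1, hs2⟩ : ∃ s : ℝ, (s = 1 ∨ s = -1) ∧ |r' - k| = s * (k - r') ∧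
      |vr' - vk| = s * (vr' - vk) := by
    rcases le_total r' k with h | h
    · refine ⟨1, Or.inl rfl, ?_, ?_⟩
      · rw [abs_of_nonpos (by linarith)]; ring
      · rw [abs_of_nonneg (by linarith [hm1' h])]; ring
    · refine ⟨-1, Or.inr rfl, ?_, ?_⟩
      · rw [abs_of_nonneg (by linarith)]; ring
      · rw [abs_of_nonpos (by linarith [hm2' h])]; ring
  have hsabs : |s| = 1 := by rcases hs with h | h <;> simp [h]
  have hsle : ∀ a : ℝ, s * a ≤ |a| := fun a => by
    have := le_abs_self (s * a); rwa [abs_mul, hsabs, one_mul] at this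
  set z := |r - k| - s * (k - r) with hz
  set z' := |vr - vk| - s * (vr - vk) with hz'
  have hz0 : 0 ≤ z := by
    have := hsle (k - r); rw [abs_sub_comm] at this; linarith
  have hz'0 : 0 ≤ z' := by have := hsle (vr - vk); linarith
  have hsk : 0 ≤ s * (k - r') := by rw [← hs1]; exact abs_nonneg _
  have hz2 : z ≤ 2 * δ := by
    have h1 := hsle (r - r'); have h2 := hsle (r' - r)
    have h3 : |r - r'| ≤ δ := by rw [abs_sub_comm]; exact hδ
    rcases abs_cases (r - k) with h | h <;> rcases hs with h' | h' <;> subst h' <;> linarith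
  have hzz : z' ≤ Lv * z := by
    rcases le_total r k with h | h
    · have hv := hm1 h
      rcases hs with h' | h'
      · have : z' = 0 := by rw [hz', abs_of_nonneg (by linarith), h']; ring
        rw [this]; positivity
      · have e1 : z' = 2 * |vr - vk| := by rw [hz', abs_of_nonneg (by linarith), h']; ring
        have e2 : z = 2 * |r - k| := by rw [hz, abs_of_nonpos (by linarith), h']; ring
        rw [e1, e2]; linarith
    · have hv := hm2 h
      rcases hs with h' | h'
      · have e1 : z' = 2 * |vr - vk| := by rw [hz', abs_of_nonpos (by linarith), h']; ring
        have e2 : z = 2 * |r - k| := by rw [hz, abs_of_nonneg (by linarith), h']; ring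
        rw [e1, e2]; linarith
      · have : z' = 0 := by rw [hz', abs_of_nonpos (by linarith), h']; ring
        rw [this]; positivity
  -- algebraic identity
  obtain ⟨β0, hbetaA⟩ : ∃ b, b = P0' - P0 - τ * V0 * p0 := ⟨_, rfl⟩
  obtain ⟨β1, hbetaB⟩ : ∃ b, b = P1' - P1 - τ * V1 * p1 := ⟨_, rfl⟩
  rw [← hbetaA] at hβ0
  rw [← hbetaB] at hβ1
  have hP0' : P0' = P0 + τ * V0 * p0 + β0 := by rw [hbetaA]; ring
  have hP1' : P1' = P1 + τ * V1 * p1 + β1 := by rw [hbetaB]; ring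
  obtain ⟨w, hw⟩ : ∃ w, w = (P1 - P0) / D := ⟨_, rfl⟩
  have hwD : P1 - P0 = D * w := by rw [hw]; field_simp
  have hw0 : 0 ≤ w := by rw [hw]; positivity
  have hw1 : |w - p1| ≤ K * D := by
    rw [hwD, ← mul_sub, abs_mul, abs_of_pos hD0] at hPp1
    have : D * |w - p1| ≤ D * (K * D) := by rw [show D * (K * D) = K * D ^ 2 by ring]; assumption
    exact le_of_mul_le_mul_left this hD0
  have hw2 : |w - p0| ≤ K * D := by
    rw [hwD, ← mul_sub, abs_mul, abs_of_pos hD0] at hPp0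
    have : D * |w - p0| ≤ D * (K * D) := by rw [show D * (K * D) = K * D ^ 2 by ring]; assumption
    exact le_of_mul_le_mul_left this hD0
  have hrr : (r' - r) * D = - r' * τ * (V1 - V0) := by
    have : r' * (D + τ * (V1 - V0)) = r * D := by rw [← hDD, hD', hD]
    linarith
  have key : |r' - k| * (P1' - P0') - |r - k| * (P1 - P0) =
      τ * (s * k * (V1 - vk) * p1 - s * k * (V0 - vk) * p0
        + s * (k * vk - r' * V0) * (p1 - p0))
      - s * r' * τ * (V1 - V0) * (p1 - w) + s * (k - r') * (β1 - β0) - z * (P1 - P0) := by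
    have e1 : |r - k| = z + s * (k - r) := by rw [hz]; ring
    rw [hs1, e1, hP0', hP1']
    have e2 : s * (r' - r) * (P1 - P0) = - s * r' * τ * (V1 - V0) * w := by
      rw [hwD]; linear_combination s * w * hrr
    linear_combination -e2
  -- bounds
  have b1 : s * k * (V1 - vk) * p1 ≤ k * (Q1 * p1) := by
    have := (hsle (V1 - vk)).trans hQ1
    have h2 : 0 ≤ k * p1 := by positivity
    have h3 := mul_le_mul_of_nonneg_left this h2
    linarith
  have b2 : - (s * k * (V0 - vk) * p0) = - (k * (Q0 * p0)) + k * θ * z' * p0 := by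
    have e : |vr - vk| = z' + s * (vr - vk) := by rw [hz']; ring
    rw [hQ0, hs2, e, hV0]; ring
  have b3 : τ * (k * θ * z' * p0) ≤ z * (P1 - P0) + τ * δ * D * (2 * R * Lv * K) := by
    have h1 : p0 ≤ w + K * D := by linarith [(abs_le.mp hw2).1]
    have h2 : τ * (k * θ * z' * p0) ≤ τ * (k * θ * (Lv * z) * (w + K * D)) := by
      gcongr
    have h3 : τ * k * θ * Lv ≤ D := by
      have : (τ * k * θ * Lv) * r ≤ D * r := by
        calc (τ * k * θ * Lv) * r = (θ * τ * Lv) * (k * r) := by ring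
          _ ≤ (θ * τ * Lv) * (R * R) := by gcongr
          _ = θ * τ * Lv * R ^ 2 := by ring
          _ ≤ l := hCFL
          _ = D * r := by rw [← hD]; ring
      exact le_of_mul_le_mul_right this hr0
    have h4 : τ * (k * θ * (Lv * z) * w) ≤ z * (P1 - P0) := by
      rw [hwD]
      calc τ * (k * θ * (Lv * z) * w) = (τ * k * θ * Lv) * (z * w) := by ring
        _ ≤ D * (z * w) := by gcongr
        _ = z * (D * w) := by ring
    have h5 : τ * (k * θ * (Lv * z) * (K * D)) ≤ τ * (R * 1 * (Lv * (2 * δ)) * (K * D)) := by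
      gcongr
    linarith
  have hV0v : |V0 - vr| ≤ Lv * δ := by
    have : V0 - vr = (1 - θ) * (vr' - vr) := by rw [hV0]; ring
    rw [this, abs_mul, abs_of_nonneg (by linarith : 0 ≤ 1 - θ)]
    calc (1 - θ) * |vr' - vr| ≤ 1 * (Lv * δ) := by
          gcongr
          · linarith
          · exact hl2.trans (by gcongr)
      _ = _ := by ring
  have b4 : s * (k * vk - r' * V0) * (p1 - p0) ≤ (|r - k| * vr - k * |vr - vk|) * (p1 - p0)
      + δ * D * (K * (3 * Cv + 3 * R * Lv)) := by
    have e : s * (k * vk - r' * V0) - (|r - k| * vr - k * |vr - vk|) =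
        s * ((r - r') * V0) + s * (r * (vr - V0)) - z * vr + k * z' := by
      rw [hz, hz']; ring
    have h1 : |s * ((r - r') * V0) + s * (r * (vr - V0)) - z * vr + k * z'| ≤
        δ * Cv + R * (Lv * δ) + 2 * δ * Cv + R * (Lv * (2 * δ)) := by
      have a1 : |s * ((r - r') * V0)| ≤ δ * Cv := by
        rw [abs_mul, hsabs, one_mul, abs_mul, abs_sub_comm]; gcongr
      have a2 : |s * (r * (vr - V0))| ≤ R * (Lv * δ) := by
        rw [abs_mul, hsabs, one_mul, abs_mul, abs_sub_comm, abs_of_pos hr0]; gcongr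
      have a3 : |z * vr| ≤ 2 * δ * Cv := by
        rw [abs_mul, abs_of_nonneg hz0]; gcongr
      have a4 : |k * z'| ≤ R * (Lv * (2 * δ)) := by
        rw [abs_mul, abs_of_nonneg hz'0, abs_of_nonneg hk0]
        have : z' ≤ Lv * (2 * δ) := hzz.trans (by gcongr)
        gcongr
      rw [abs_le] at *
      constructor <;> linarith [a1.1, a1.2, a2.1, a2.2, a3.1, a3.2, a4.1, a4.2]
    rw [← e] at h1
    have h2 := (le_abs_self ((s * (k * vk - r' * V0) - (|r - k| * vr - k * |vr - vk|)) * (p1 - p0)))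
    rw [abs_mul] at h2
    have h3 := h2.trans (mul_le_mul h1 hp (abs_nonneg _) (by positivity))
    linarith
  have b5 : - (s * r' * τ * (V1 - V0) * (p1 - w)) ≤ τ * K * l * |V1 - V0|
      + τ * δ * D * (K * (2 * Cv)) := by
    have h1 := neg_abs_le (s * r' * τ * (V1 - V0) * (p1 - w))
    have h2 : |s * r' * τ * (V1 - V0) * (p1 - w)| = r' * τ * |V1 - V0| * |w - p1| := by
      rw [abs_mul, abs_mul, abs_mul, abs_mul, hsabs, abs_of_pos hr0', abs_of_nonneg hτ,
        abs_sub_comm w]; ring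
    have h3 : r' * D ≤ l + δ * D := by
      have := mul_le_mul_of_nonneg_right (abs_le.mp hδ).2 hD0.le
      linarith
    have h4 : |V1 - V0| ≤ 2 * Cv := by
      rw [abs_le] at *; constructor <;> linarith [hV0b.1, hV0b.2, hV1b.1, hV1b.2]
    calc - (s * r' * τ * (V1 - V0) * (p1 - w)) ≤ r' * τ * |V1 - V0| * |w - p1| := by linarith
      _ ≤ r' * τ * |V1 - V0| * (K * D) := by gcongr
      _ = (τ * K * |V1 - V0|) * (r' * D) := by ring
      _ ≤ (τ * K * |V1 - V0|) * (l + δ * D) := by gcongr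
      _ = τ * K * l * |V1 - V0| + τ * K * |V1 - V0| * (δ * D) := by ring
      _ ≤ τ * K * l * |V1 - V0| + τ * K * (2 * Cv) * (δ * D) := by gcongr
      _ = _ := by ring
  have b6 : s * (k - r') * (β1 - β0) ≤ 2 * R * K * Cv ^ 2 * τ ^ 2 := by
    have h1 : s * (k - r') ≤ R := by
      rw [← hs1, abs_le]; constructor <;> linarith
    have h2 : β1 - β0 ≤ 2 * (K * τ ^ 2 * Cv ^ 2) := by
      linarith [(abs_le.mp hβ1).2, (abs_le.mp hβ0).1]
    calc s * (k - r') * (β1 - β0) ≤ s * (k - r') * (2 * (K * τ ^ 2 * Cv ^ 2)) := by gcongr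
      _ ≤ R * (2 * (K * τ ^ 2 * Cv ^ 2)) := by gcongr
      _ = _ := by ring
  rw [key]
  have c1 := mul_le_mul_of_nonneg_left b1 hτ
  have c4 := mul_le_mul_of_nonneg_left b4 hτ
  have c2 : τ * (- (s * k * (V0 - vk) * p0)) = τ * (- (k * (Q0 * p0)) + k * θ * z' * p0) := by
    rw [b2]
  linarith

lemma step_ineq {N : ℕ} {x X r r' : ℕ → ℝ} {v Ψ ψ : ℝ → ℝ} {k R l τ θ Lv Cv K W : ℝ}
    (hk0 : 0 ≤ k) (hkR : k ≤ R) (hl : 0 < l)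
    (hτ : 0 ≤ τ) (hθ0 : 0 ≤ θ) (hθ1 : θ ≤ 1) (hLv : 0 ≤ Lv) (hK : 0 ≤ K)
    (hCFL : θ * τ * Lv * R ^ 2 ≤ l)
    (hanti : Antitone v) (hlip : ∀ a b, |v a - v b| ≤ Lv * |a - b|) (hvb : ∀ a, |v a| ≤ Cv)
    (hr : ∀ i < N, 0 < r i ∧ r i ≤ R) (hr' : ∀ i < N, 0 < r' i ∧ r' i ≤ R)
    (hrN : r N = 0) (hrN' : r' N = 0)
    (hx : ∀ i < N, x i < x (i + 1))
    (hrx : ∀ i < N, r i * (x (i + 1) - x i) = l) (hrX : ∀ i < N, r' i * (X (i + 1) - X i) = l)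
    (hX : ∀ i ≤ N, X i = x i + τ * (θ * v (r i) + (1 - θ) * v (r' i)))
    (hψ0 : ∀ a, 0 ≤ ψ a) (hψ : ∀ a b, |ψ a - ψ b| ≤ K * |a - b|)
    (hΨψ : ∀ a h, |Ψ (a + h) - Ψ a - h * ψ a| ≤ K * h ^ 2) (hΨ : Monotone Ψ)
    (hTV : ∑ i ∈ Finset.range N, |r (i + 1) - r i| ≤ W)
    (hTV' : ∑ i ∈ Finset.range N, |r' (i + 1) - r' i| ≤ W) :
    ∑ i ∈ Finset.range N, (|r' i - k| - k) * (Ψ (X (i + 1)) - Ψ (X i))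
      - ∑ i ∈ Finset.range N, (|r i - k| - k) * (Ψ (x (i + 1)) - Ψ (x i)) ≤
    τ * ∑ i ∈ Finset.range N,
        (|r i - k| * v (r i) - k * |v (r i) - v k| - k * v k) * (ψ (x (i + 1)) - ψ (x i))
      + τ * ((2 * R ^ 2 * Cv * τ / l) * (x N - x 0) * (K * (5 * Cv + 5 * R * Lv)) + K * l * (Lv * W)
        + 2 * R * K * Cv ^ 2 * N * τ + 2 * R * K * Cv ^ 2 * τ) := by
  have hR : 0 ≤ R := hk0.trans hkR
  have hCv : 0 ≤ Cv := (abs_nonneg _).trans (hvb 0)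
  obtain ⟨V, hV⟩ : ∃ V : ℕ → ℝ, ∀ i, V i = θ * v (r i) + (1 - θ) * v (r' i) := ⟨_, fun _ => rfl⟩
  obtain ⟨Q, hQ⟩ : ∃ Q : ℕ → ℝ, ∀ i, Q i = θ * |v (r i) - v k| + (1 - θ) * |v (r' i) - v k| :=
    ⟨_, fun _ => rfl⟩
  have h1θ : 0 ≤ 1 - θ := by linarith
  have hVb : ∀ i, |V i| ≤ Cv := fun i => by
    rw [hV]
    calc _ ≤ |θ * v (r i)| + |(1 - θ) * v (r' i)| := abs_add_le _ _
      _ ≤ θ * Cv + (1 - θ) * Cv := by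
        rw [abs_mul, abs_mul, abs_of_nonneg hθ0, abs_of_nonneg h1θ]
        gcongr <;> exact hvb _
      _ = Cv := by ring
  have hVQ : ∀ i, |V i - v k| ≤ Q i := fun i => by
    have : V i - v k = θ * (v (r i) - v k) + (1 - θ) * (v (r' i) - v k) := by rw [hV]; ring
    rw [hQ, this]
    refine (abs_add_le _ _).trans ?_
    rw [abs_mul, abs_mul, abs_of_nonneg hθ0, abs_of_nonneg h1θ]
  have hX' : ∀ i ≤ N, X i = x i + τ * V i := fun i hi => by rw [hX i hi, hV]
  have hβ : ∀ i ≤ N, |Ψ (X i) - Ψ (x i) - τ * V i * ψ (x i)| ≤ K * τ ^ 2 * Cv ^ 2 := fun i hi => by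
    rw [hX' i hi]
    refine (hΨψ _ _).trans ?_
    have : V i ^ 2 ≤ Cv ^ 2 := sq_le_sq' (by linarith [(abs_le.mp (hVb i)).1]) (abs_le.mp (hVb i)).2
    calc K * (τ * V i) ^ 2 = K * τ ^ 2 * V i ^ 2 := by ring
      _ ≤ _ := by gcongr
  set δ := 2 * R ^ 2 * Cv * τ / l with hδ
  have hδ0 : 0 ≤ δ := by positivity
  have hcell : ∀ i ∈ Finset.range N,
      |r' i - k| * (Ψ (X (i + 1)) - Ψ (X i)) - |r i - k| * (Ψ (x (i + 1)) - Ψ (x i)) ≤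
      τ * ((|r i - k| * v (r i) - k * |v (r i) - v k|) * (ψ (x (i + 1)) - ψ (x i))
          + k * (Q (i + 1) * ψ (x (i + 1)) - Q i * ψ (x i)))
        + τ * δ * (x (i + 1) - x i) * (K * (5 * Cv + 5 * R * Lv)) + τ * K * l * |V (i + 1) - V i|
        + 2 * R * K * Cv ^ 2 * τ ^ 2 := by
    intro i hi
    have hi := Finset.mem_range.mp hi
    obtain ⟨hr0, hrR⟩ := hr i hi
    obtain ⟨hr0', hrR'⟩ := hr' i hi
    have hD0 : 0 < x (i + 1) - x i := sub_pos.mpr (hx i hi)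
    have hDD : X (i + 1) - X i = x (i + 1) - x i + τ * (V (i + 1) - V i) := by
      rw [hX' _ hi, hX' _ hi.le]; ring
    refine cell_ineq (D' := X (i + 1) - X i) (vr' := v (r' i)) (θ := θ) (V0 := V i) (r := r i)
      (r' := r' i)
      hk0 hkR hr0 hrR hr0' hrR' hτ hθ0 hθ1 hLv hK hCFL hD0 (hrx i hi)
      (hrX i hi) hDD (fun h => hanti h) (fun h => hanti h) (fun h => hanti h) (fun h => hanti h)
      (hlip _ _) (hlip _ _) (hvb _) (hVb _) (hVb _) (hV i) (hVQ _) (hQ i) ?_ (hψ0 _) (hψ0 _) ?_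
      (sub_nonneg.mpr (hΨ (hx i hi).le)) ?_ ?_ (hβ _ hi.le) (hβ _ hi)
    · have e : (r' i - r i) * l = - (r i * r' i * τ * (V (i + 1) - V i)) := by
        have h1 := hrx i hi
        have h2 := hrX i hi
        rw [hDD] at h2
        linear_combination r i * h2 - r' i * h1
      have h4 : |V (i + 1) - V i| ≤ 2 * Cv := by
        have a := hVb i
        have b := hVb (i + 1)
        rw [abs_le] at *; constructor <;> linarith [a.1, a.2, b.1, b.2]
      rw [hδ, le_div_iff₀ hl]
      calc |r' i - r i| * l = |(r' i - r i) * l| := by rw [abs_mul, abs_of_pos hl]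
        _ = r i * r' i * τ * |V (i + 1) - V i| := by
          rw [e, abs_neg, abs_mul, abs_of_nonneg (by positivity)]
        _ ≤ R * R * τ * (2 * Cv) := by gcongr
        _ = _ := by ring
    · have := hψ (x (i + 1)) (x i)
      rwa [abs_of_pos hD0] at this
    · have := hΨψ (x (i + 1)) (x i - x (i + 1))
      rw [← abs_neg] at this
      calc _ = _ := ?_
        _ ≤ _ := this
        _ = _ := by ring
      congr 1
      rw [show x (i + 1) + (x i - x (i + 1)) = x i by ring]; ring
    · have := hΨψ (x i) (x (i + 1) - x i)
      rwa [show x i + (x (i + 1) - x i) = x (i + 1) by ring] at this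
  have hsum := Finset.sum_le_sum hcell
  simp only [Finset.sum_add_distrib, Finset.sum_sub_distrib, ← Finset.mul_sum,
    ← Finset.sum_mul, Finset.sum_const, Finset.card_range, nsmul_eq_mul] at hsum
  have tx : ∑ i ∈ Finset.range N, (x (i + 1) - x i) = x N - x 0 := Finset.sum_range_sub x N
  have tx2 : ∑ i ∈ Finset.range N, (Ψ (x (i + 1)) - Ψ (x i)) = Ψ (x N) - Ψ (x 0) :=
    Finset.sum_range_sub (fun i => Ψ (x i)) N
  have tX2 : ∑ i ∈ Finset.range N, (Ψ (X (i + 1)) - Ψ (X i)) = Ψ (X N) - Ψ (X 0) :=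
    Finset.sum_range_sub (fun i => Ψ (X i)) N
  have tψ : ∑ i ∈ Finset.range N, (ψ (x (i + 1)) - ψ (x i)) = ψ (x N) - ψ (x 0) :=
    Finset.sum_range_sub (fun i => ψ (x i)) N
  have tQ : ∑ i ∈ Finset.range N, (Q (i + 1) * ψ (x (i + 1)) - Q i * ψ (x i)) =
      Q N * ψ (x N) - Q 0 * ψ (x 0) :=
    Finset.sum_range_sub (fun i => Q i * ψ (x i)) N
  have tV : ∑ i ∈ Finset.range N, |V (i + 1) - V i| ≤ Lv * W := by
    calc ∑ i ∈ Finset.range N, |V (i + 1) - V i|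
        ≤ ∑ i ∈ Finset.range N, (θ * (Lv * |r (i + 1) - r i|)
          + (1 - θ) * (Lv * |r' (i + 1) - r' i|)) := by
          refine Finset.sum_le_sum fun i _ => ?_
          have : V (i + 1) - V i = θ * (v (r (i + 1)) - v (r i))
            + (1 - θ) * (v (r' (i + 1)) - v (r' i)) := by rw [hV, hV]; ring
          rw [this]
          refine (abs_add_le _ _).trans ?_
          rw [abs_mul, abs_mul, abs_of_nonneg hθ0, abs_of_nonneg h1θ]
          gcongr <;> exact hlip _ _
      _ = θ * (Lv * ∑ i ∈ Finset.range N, |r (i + 1) - r i|)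
          + (1 - θ) * (Lv * ∑ i ∈ Finset.range N, |r' (i + 1) - r' i|) := by
          simp only [Finset.sum_add_distrib, Finset.mul_sum]
      _ ≤ θ * (Lv * W) + (1 - θ) * (Lv * W) := by gcongr
      _ = Lv * W := by ring
  have e1 : ∑ i ∈ Finset.range N, (|r' i - k| - k) * (Ψ (X (i + 1)) - Ψ (X i)) =
      ∑ i ∈ Finset.range N, |r' i - k| * (Ψ (X (i + 1)) - Ψ (X i)) - k * (Ψ (X N) - Ψ (X 0)) := by
    rw [← tX2, Finset.mul_sum, ← Finset.sum_sub_distrib]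
    exact Finset.sum_congr rfl fun _ _ => by ring
  have e2 : ∑ i ∈ Finset.range N, (|r i - k| - k) * (Ψ (x (i + 1)) - Ψ (x i)) =
      ∑ i ∈ Finset.range N, |r i - k| * (Ψ (x (i + 1)) - Ψ (x i)) - k * (Ψ (x N) - Ψ (x 0)) := by
    rw [← tx2, Finset.mul_sum, ← Finset.sum_sub_distrib]
    exact Finset.sum_congr rfl fun _ _ => by ring
  have e3 : ∑ i ∈ Finset.range N,
        (|r i - k| * v (r i) - k * |v (r i) - v k| - k * v k) * (ψ (x (i + 1)) - ψ (x i)) =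
      ∑ i ∈ Finset.range N,
        (|r i - k| * v (r i) - k * |v (r i) - v k|) * (ψ (x (i + 1)) - ψ (x i))
        - k * v k * (ψ (x N) - ψ (x 0)) := by
    rw [← tψ, Finset.mul_sum, ← Finset.sum_sub_distrib]
    exact Finset.sum_congr rfl fun _ _ => by ring
  rw [e1, e2, e3]
  simp only [Finset.sum_sub_distrib] at tQ tx
  have tV' := mul_le_mul_of_nonneg_left tV (show 0 ≤ τ * K * l by positivity)
  rw [tx, tQ] at hsum
  have b0 := mul_le_mul_of_nonneg_left (abs_le.mp (hβ 0 (Nat.zero_le _))).2 hk0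
  have bN := mul_le_mul_of_nonneg_left (abs_le.mp (hβ N le_rfl)).1 hk0
  have hQN : Q N = V N - v k := by
    rw [hQ, hV, hrN, hrN', abs_of_nonneg (sub_nonneg.mpr (hanti hk0))]; ring
  have hQ0 : τ * k * ψ (x 0) * (V 0 - v k) ≤ τ * k * ψ (x 0) * Q 0 := by
    have := hψ0 (x 0)
    have h2 := (le_abs_self _).trans (hVQ 0)
    gcongr
  have hkR2 : k * (K * τ ^ 2 * Cv ^ 2) ≤ R * (K * τ ^ 2 * Cv ^ 2) := by gcongr
  rw [hQN] at hsum
  linarith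

lemma slope_exists {v : ℝ → ℝ} {Lv : ℝ} (hLv : 0 ≤ Lv)
    (hanti : Antitone v) (hlip : ∀ a b, |v a - v b| ≤ Lv * |a - b|) (p q : ℝ) :
    ∃ a, 0 ≤ a ∧ a ≤ Lv ∧ v q - v p = - a * (q - p) := by
  rcases lt_trichotomy p q with h | h | h
  · have h1 := hanti h.le
    have h2 := hlip p q
    rw [abs_of_nonneg (by linarith), abs_of_neg (by linarith)] at h2
    refine ⟨(v p - v q) / (q - p), div_nonneg (by linarith) (by linarith), ?_, ?_⟩
    · rw [div_le_iff₀ (by linarith)]; linarith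
    · have : q - p ≠ 0 := by linarith
      field_simp; ring
  · subst h; exact ⟨0, le_rfl, hLv, by ring⟩
  · have h1 := hanti h.le
    have h2 := hlip q p
    rw [abs_of_nonneg (by linarith), abs_of_neg (by linarith)] at h2
    refine ⟨(v q - v p) / (p - q), div_nonneg (by linarith) (by linarith), ?_, ?_⟩
    · rw [div_le_iff₀ (by linarith)]; linarith
    · have : p - q ≠ 0 := by linarith
      field_simp; ring

lemma tvd {N : ℕ} {x X r r' : ℕ → ℝ} {v : ℝ → ℝ} {R l τ θ Lv : ℝ} (hR : 0 ≤ R)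
    (hl : 0 < l) (hτ : 0 ≤ τ) (hθ0 : 0 ≤ θ) (hθ1 : θ ≤ 1) (hLv : 0 ≤ Lv)
    (hCFL : θ * τ * Lv * R ^ 2 ≤ l)
    (hanti : Antitone v) (hlip : ∀ a b, |v a - v b| ≤ Lv * |a - b|)
    (hr : ∀ i < N, 0 < r i ∧ r i ≤ R) (hr' : ∀ i < N, 0 < r' i ∧ r' i ≤ R)
    (hrN : r N = 0) (hrN' : r' N = 0)
    (hrx : ∀ i < N, r i * (x (i + 1) - x i) = l) (hrX : ∀ i < N, r' i * (X (i + 1) - X i) = l)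
    (hX : ∀ i ≤ N, X i = x i + τ * (θ * v (r i) + (1 - θ) * v (r' i))) :
    ∑ i ∈ Finset.range N, |r' (i + 1) - r' i| ≤ ∑ i ∈ Finset.range N, |r (i + 1) - r i| := by
  have h1θ : 0 ≤ 1 - θ := by linarith
  choose a ha0 haL ha using fun i => slope_exists hLv hanti hlip (r i) (r (i + 1))
  choose a' ha0' haL' ha' using fun i => slope_exists hLv hanti hlip (r' i) (r' (i + 1))
  obtain ⟨d, hd⟩ : ∃ d : ℕ → ℝ, ∀ i, d i = if i < N then r i * r' i * τ / l * θ * a i else 0 :=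
    ⟨_, fun _ => rfl⟩
  obtain ⟨c, hc⟩ : ∃ c : ℕ → ℝ, ∀ i, c i = if i < N then r i * r' i * τ / l * (1 - θ) * a' i else 0 :=
    ⟨_, fun _ => rfl⟩
  have hd0 : ∀ i, 0 ≤ d i := fun i => by
    rw [hd]; split_ifs with h
    · have := (hr i h).1; have := (hr' i h).1; have := ha0 i; positivity
    · exact le_rfl
  have hc0 : ∀ i, 0 ≤ c i := fun i => by
    rw [hc]; split_ifs with h
    · have := (hr i h).1; have := (hr' i h).1; have := ha0' i; positivity
    · exact le_rfl
  have hd1 : ∀ i, d i ≤ 1 := fun i => by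
    rw [hd]; split_ifs with h
    · obtain ⟨h1, h2⟩ := hr i h
      obtain ⟨h3, h4⟩ := hr' i h
      have h5 := haL i
      have h6 := ha0 i
      calc r i * r' i * τ / l * θ * a i ≤ R * R * τ / l * θ * Lv := by gcongr
        _ = (θ * τ * Lv * R ^ 2) / l := by ring
        _ ≤ 1 := by rw [div_le_one hl]; exact hCFL
    · exact zero_le_one
  have hrel : ∀ i ≤ N, r' i - c i * (r' (i + 1) - r' i) = r i + d i * (r (i + 1) - r i) := by
    intro i hi
    rcases hi.lt_or_eq with h | h
    · have h1 := hrx i h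
      have h2 := hrX i h
      rw [hX _ h, hX _ h.le] at h2
      have h3 := ha i
      have h4 := ha' i
      rw [hd, hc, if_pos h, if_pos h]
      field_simp
      have e : (r' i - r i) * l = - (r i * r' i * τ * (θ * (v (r (i + 1)) - v (r i)) +
          (1 - θ) * (v (r' (i + 1)) - v (r' i)))) := by
        linear_combination r i * h2 - r' i * h1
      rw [h3, h4] at e
      linear_combination e
    · subst h; simp [hd, hc, hrN, hrN']
  have hkey : ∀ i ∈ Finset.range N, |r' (i + 1) - r' i| ≤ |r (i + 1) - r i|
      + ((d (i + 1) * |r (i + 1 + 1) - r (i + 1)| + c (i + 1) * |r' (i + 1 + 1) - r' (i + 1)|)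
      - (d i * |r (i + 1) - r i| + c i * |r' (i + 1) - r' i|)) := by
    intro i hi
    have hi := Finset.mem_range.mp hi
    have h1 := hrel i hi.le
    have h2 := hrel (i + 1) hi
    have e : (1 + c i) * (r' (i + 1) - r' i) = (1 - d i) * (r (i + 1) - r i)
        + d (i + 1) * (r (i + 1 + 1) - r (i + 1)) + c (i + 1) * (r' (i + 1 + 1) - r' (i + 1)) := by
      linear_combination h2 - h1
    have e2 := congrArg abs e
    rw [abs_mul, abs_of_nonneg (by linarith [hc0 i])] at e2
    have e3 := abs_add_three ((1 - d i) * (r (i + 1) - r i))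
        (d (i + 1) * (r (i + 1 + 1) - r (i + 1))) (c (i + 1) * (r' (i + 1 + 1) - r' (i + 1)))
    rw [abs_mul, abs_mul, abs_mul, abs_of_nonneg (hd0 _), abs_of_nonneg (hc0 _),
      abs_of_nonneg (sub_nonneg.mpr (hd1 i)), ← e2] at e3
    linarith
  refine (Finset.sum_le_sum hkey).trans ?_
  rw [Finset.sum_add_distrib, Finset.sum_range_sub
    (fun i => d i * |r (i + 1) - r i| + c i * |r' (i + 1) - r' i|)]
  have hdN : d N = 0 := by simp [hd]
  have hcN : c N = 0 := by simp [hc]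
  have := hd0 0
  have := hc0 0
  rw [hdN, hcN]
  have : 0 ≤ d 0 * |r (0 + 1) - r 0| + c 0 * |r' (0 + 1) - r' 0| := by positivity
  linarith

lemma avg_close {f : ℝ → ℝ} {p q c V l r : ℝ} (hpq : p < q) (hf : IntervalIntegrable f volume p q)
    (hl : ∫ s in p..q, f s = l) (hr : r = l / (q - p))
    (hV : ∀ s ∈ Set.Icc p q, |c - f s| ≤ V) : |c - r| ≤ V := by
  have hD : 0 < q - p := sub_pos.mpr hpq
  have h1 : (q - p) * (c - r) = ∫ s in p..q, (c - f s) := by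
    rw [intervalIntegral.integral_sub (by simp) hf, hl, hr]
    simp
    field_simp
  have h2 : ‖∫ s in p..q, (c - f s)‖ ≤ V * |q - p| := by
    refine intervalIntegral.norm_integral_le_of_norm_le_const fun s hs => ?_
    rw [Set.uIoc_of_le hpq.le] at hs
    exact hV s ⟨hs.1.le, hs.2⟩
  rw [← h1, Real.norm_eq_abs, abs_mul, abs_of_pos hD] at h2
  exact le_of_mul_le_mul_left (by linarith) hD

lemma initial_facts {ρb : ℝ → ℝ} {R L : ℝ} (hLpos : 0 < L)
    (hBV : BoundedVariationOn ρb Set.univ)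
    (hsupp : HasCompactSupport ρb)
    (hbound : ∀ᵐ z ∂(volume : Measure ℝ), ρb z ∈ Set.Icc 0 R)
    (hLdef : (∫ z, ρb z) = L) :
    ∃ a b TV : ℝ, a ≤ b ∧ 0 ≤ TV ∧ ∀ (N : ℕ) (x r : ℕ → ℝ), 0 < N → x 0 = sInf (tsupport ρb) →
      (∀ i < N, x i < x (i + 1)) →
      (∀ i < N, IsLeast {z : ℝ | x i ≤ z ∧ L / N ≤ ∫ s in (x i)..z, ρb s} (x (i + 1))) →
      (∀ i < N, r i = L / N / (x (i + 1) - x i)) → r N = 0 → (∀ i < N, 0 < r i ∧ r i ≤ R) → 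
      (a ≤ x 0 ∧ x N ≤ b) ∧ (∑ i ∈ Finset.range N, |r (i + 1) - r i| ≤ 2 * TV + R) ∧
      ∀ (h ψ : ℝ → ℝ) (K : ℝ), (∀ p q, |h p - h q| ≤ |p - q|) → h 0 = 0 → Continuous ψ →
        (∀ y, |ψ y| ≤ K) →
        |(∫ y, h (ρb y) * ψ y) - ∑ i ∈ Finset.range N, h (r i) * ∫ y in (x i)..(x (i + 1)), ψ y| ≤
          K * (Real.sqrt (L / N) * (TV + 2 * (b - a))) := by
  have hIntg : Integrable ρb := by
    by_contra h
    rw [integral_undef h] at hLdef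
    linarith
  have hne : (tsupport ρb).Nonempty := by
    by_contra h
    rw [Set.not_nonempty_iff_eq_empty, tsupport_eq_empty_iff] at h
    rw [h] at hLdef
    simp at hLdef
    linarith
  have hbb : BddBelow (tsupport ρb) := hsupp.isCompact.bddBelow
  have hba : BddAbove (tsupport ρb) := hsupp.isCompact.bddAbove
  set a := sInf (tsupport ρb) with ha
  set b := sSup (tsupport ρb) with hb
  have hab : a ≤ b := Real.sInf_le_sSup _ hbb hba
  have hzero : ∀ y, b < y → ρb y = 0 := fun y hy => by
    by_contra hc
    have : y ∈ tsupport ρb := subset_tsupport _ hc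
    exact absurd (le_csSup hba this) (not_le.mpr hy)
  have hloc : LocallyBoundedVariationOn ρb Set.univ := hBV.locallyBoundedVariationOn
  obtain ⟨g, hg⟩ : ∃ g : ℝ → ℝ, g = variationOnFromTo ρb Set.univ a := ⟨_, rfl⟩
  have hgd : ∀ p q, p ≤ q → |ρb p - ρb q| ≤ g q - g p := by
    intro p q hpq
    have h1 := variationOnFromTo.add hloc (Set.mem_univ a) (Set.mem_univ p) (Set.mem_univ q)
    have h2 : g q - g p = variationOnFromTo ρb Set.univ p q := by rw [hg]; linarith
    rw [h2, variationOnFromTo.eq_of_le _ _ hpq, Set.univ_inter]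
    have h3 := (hloc p q (Set.mem_univ _) (Set.mem_univ _))
    rw [Set.univ_inter] at h3
    exact BoundedVariationOn.dist_le h3 (Set.left_mem_Icc.mpr hpq) (Set.right_mem_Icc.mpr hpq)
  have hgm : Monotone g := fun p q hpq => by
    have := (abs_nonneg _).trans (hgd p q hpq); linarith
  set TV := (eVariationOn ρb Set.univ).toReal with hTV
  have hga : g a = 0 := by rw [hg]; exact variationOnFromTo.self _ _ _
  have hgT : ∀ y, a ≤ y → g y ≤ TV := fun y hy => by
    rw [hg, variationOnFromTo.eq_of_le _ _ hy]
    exact ENNReal.toReal_mono hBV (eVariationOn.mono _ (by simp))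
  refine ⟨a, b, TV, hab, ENNReal.toReal_nonneg, ?_⟩
  intro N x r hN hx0 hx hleast hr hrN hrb
  have hNpos : (0:ℝ) < N := by exact_mod_cast hN
  have hl : 0 < L / N := by positivity
  set l := L / N with hldef
  have hxb : ∀ i ≤ N, x i ≤ b := by
    intro i
    induction i with
    | zero => intro _; rw [hx0]; exact hab
    | succ i ih =>
      intro hi
      have hi' := ih (by omega)
      by_contra hc
      push Not at hc
      have h1 := hleast i (by omega)
      have h2 : (∫ s in (x i)..b, ρb s) = ∫ s in (x i)..(x (i + 1)), ρb s := by
        rw [← intervalIntegral.integral_add_adjacent_intervals (a := x i) (b := b) (c := x (i + 1))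
          hIntg.intervalIntegrable hIntg.intervalIntegrable]
        have : ∫ s in b..(x (i + 1)), ρb s = ∫ s in b..(x (i + 1)), (0:ℝ) := by
          refine intervalIntegral.integral_congr_ae (ae_of_all _ fun s hs => ?_)
          rw [Set.uIoc_of_le hc.le] at hs
          exact hzero s hs.1
        rw [this]; simp
      have := h1.2 (show b ∈ _ from ⟨hi', by rw [h2]; exact h1.1.2⟩)
      linarith
  have hmono : ∀ i j, i ≤ j → j ≤ N → x i ≤ x j := by
    intro i j hij
    induction j, hij using Nat.le_induction with
    | base => intro _; exact le_rfl
    | succ j _ ih => intro hj; exact (ih (by omega)).trans (hx j (by omega)).le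
  have hax : ∀ i ≤ N, a ≤ x i := fun i hi => by rw [← hx0]; exact hmono 0 i (Nat.zero_le _) hi
  have hnn : 0 ≤ᵐ[volume] ρb := hbound.mono fun z hz => hz.1
  have hsumI : ∑ i ∈ Finset.range N, ∫ s in (x i)..(x (i + 1)), ρb s = ∫ s in (x 0)..(x N), ρb s :=
    intervalIntegral.sum_integral_adjacent_intervals fun i _ => hIntg.intervalIntegrable
  have h0N : x 0 ≤ x N := hmono 0 N (Nat.zero_le _) le_rfl
  have hle : ∫ s in (x 0)..(x N), ρb s ≤ L := by
    rw [intervalIntegral.integral_of_le h0N, ← hLdef]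
    exact setIntegral_le_integral hIntg hnn
  have hge : ∀ i ∈ Finset.range N, l ≤ ∫ s in (x i)..(x (i + 1)), ρb s :=
    fun i hi => (hleast i (Finset.mem_range.mp hi)).1.2
  have hNl : ∑ i ∈ Finset.range N, l = L := by
    simp [hldef]; field_simp
  have hcell : ∀ i < N, ∫ s in (x i)..(x (i + 1)), ρb s = l := by
    have hs : ∑ i ∈ Finset.range N, l = ∑ i ∈ Finset.range N, ∫ s in (x i)..(x (i + 1)), ρb s :=
      le_antisymm (Finset.sum_le_sum hge) (by rw [hNl, hsumI]; exact hle)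
    have := (Finset.sum_eq_sum_iff_of_le hge).mp hs
    exact fun i hi => (this i (Finset.mem_range.mpr hi)).symm
  have hclose : ∀ i < N, ∀ y ∈ Set.Icc (x i) (x (i + 1)), |ρb y - r i| ≤ g (x (i + 1)) - g (x i) := by
    intro i hi y hy
    refine avg_close (hx i hi) hIntg.intervalIntegrable (hcell i hi) (hr i hi) fun s hs => ?_
    rcases le_total y s with h | h
    · have := hgd y s h
      linarith [hgm hy.1, hgm hs.2]
    · have := hgd s y h
      rw [abs_sub_comm]
      linarith [hgm hs.1, hgm hy.2]
  have hgsum : ∑ i ∈ Finset.range N, (g (x (i + 1)) - g (x i)) ≤ TV := by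
    rw [Finset.sum_range_sub (fun i => g (x i)), hx0, hga, sub_zero]
    exact hgT _ (hax N le_rfl)
  refine ⟨⟨hx0.ge, hxb N le_rfl⟩, ?_, ?_⟩
  · obtain ⟨n, rfl⟩ : ∃ n, N = n + 1 := ⟨N - 1, by omega⟩
    rw [Finset.sum_range_succ]
    have h1 : |r (n + 1) - r n| ≤ R := by
      obtain ⟨h, h'⟩ := hrb n (by omega)
      rw [hrN, zero_sub, abs_neg, abs_of_pos h]; exact h'
    have h2 : ∑ i ∈ Finset.range n, |r (i + 1) - r i| ≤
        ∑ i ∈ Finset.range n, ((g (x (i + 1 + 1)) - g (x (i + 1))) + (g (x (i + 1)) - g (x i))) := by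
      refine Finset.sum_le_sum fun i hi => ?_
      have hi := Finset.mem_range.mp hi
      have e1 := hclose i (by omega) (x (i + 1)) ⟨(hx i (by omega)).le, le_rfl⟩
      have e2 := hclose (i + 1) (by omega) (x (i + 1)) ⟨le_rfl, (hx (i + 1) (by omega)).le⟩
      rw [abs_le] at *
      constructor <;> linarith [e1.1, e1.2, e2.1, e2.2]
    rw [Finset.sum_add_distrib, Finset.sum_range_sub (fun i => g (x i)),
      Finset.sum_range_sub (fun i => g (x (i + 1)))] at h2
    have h3 := hgT _ (hax (n + 1) le_rfl)
    have h4 := hgT _ (hax n (by omega))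
    have h5 := hgm (hax 0 (by omega))
    have h6 := hgm (hax 1 (by omega))
    simp only [zero_add] at h2
    linarith
  · intro h ψ K hlip h0 hψ hK
    have hKn : 0 ≤ K := (abs_nonneg _).trans (hK 0)
    have hhb : ∀ p, |h p| ≤ |p| := fun p => by simpa [h0] using hlip p 0
    have hhc : Continuous h := by
      have : LipschitzWith 1 h := LipschitzWith.of_dist_le_mul fun p q => by
        simpa [Real.dist_eq] using hlip p q
      exact this.continuous
    have hI : Integrable (fun y => h (ρb y) * ψ y) := by
      refine Integrable.mono' (hIntg.norm.const_mul K)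
        ((hhc.comp_aestronglyMeasurable hIntg.aestronglyMeasurable).mul hψ.aestronglyMeasurable) ?_
      refine ae_of_all _ fun y => ?_
      rw [norm_mul, mul_comm]
      exact mul_le_mul (hK y) (hhb _) (norm_nonneg _) hKn
    have hout : ∀ᵐ y ∂(volume.restrict (Set.Ioc (x 0) (x N))ᶜ), ρb y = 0 := by
      have h1 : ∫ y in (Set.Ioc (x 0) (x N))ᶜ, ρb y = 0 := by
        have := integral_add_compl (measurableSet_Ioc (a := x 0) (b := x N)) hIntg
        rw [hLdef, ← intervalIntegral.integral_of_le h0N, ← hsumI,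
          Finset.sum_congr rfl (fun i hi => hcell i (Finset.mem_range.mp hi)), hNl] at this
        linarith
      have := (setIntegral_eq_zero_iff_of_nonneg_ae (ae_restrict_of_ae hnn)
        hIntg.integrableOn).mp h1
      exact this
    have e1 : (∫ y, h (ρb y) * ψ y) = ∑ i ∈ Finset.range N, ∫ y in (x i)..(x (i + 1)),
        h (ρb y) * ψ y := by
      rw [intervalIntegral.sum_integral_adjacent_intervals fun i _ => hI.intervalIntegrable,
        intervalIntegral.integral_of_le h0N,
        ← integral_add_compl (measurableSet_Ioc (a := x 0) (b := x N)) hI]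
      have : ∫ y in (Set.Ioc (x 0) (x N))ᶜ, h (ρb y) * ψ y = 0 := by
        rw [integral_congr_ae (g := fun _ => (0:ℝ)) (hout.mono fun y hy => by simp [hy, h0])]
        simp
      rw [this, add_zero]
    rw [e1, ← Finset.sum_sub_distrib]
    refine (Finset.abs_sum_le_sum_abs _ _).trans ?_
    have e2 : ∀ i ∈ Finset.range N, |(∫ y in (x i)..(x (i + 1)), h (ρb y) * ψ y)
        - h (r i) * ∫ y in (x i)..(x (i + 1)), ψ y| ≤
        K * (Real.sqrt l * ((g (x (i + 1)) - g (x i)) + 2 * (x (i + 1) - x i))) := by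
      intro i hi
      have hi := Finset.mem_range.mp hi
      have hxi := (hx i hi).le
      have hD : 0 < x (i + 1) - x i := sub_pos.mpr (hx i hi)
      have hVn : 0 ≤ g (x (i + 1)) - g (x i) := sub_nonneg.mpr (hgm hxi)
      have hri := (hrb i hi).1
      have hrD : r i * (x (i + 1) - x i) = l := by rw [hr i hi]; field_simp
      have hIab : IntervalIntegrable (fun y => |ρb y - r i|) volume (x i) (x (i + 1)) :=
        (hIntg.intervalIntegrable.sub intervalIntegrable_const).abs
      rw [← intervalIntegral.integral_const_mul, ← intervalIntegral.integral_sub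
        hI.intervalIntegrable ((hψ.intervalIntegrable _ _).const_mul _)]
      have f1 : |∫ y in (x i)..(x (i + 1)), (h (ρb y) * ψ y - h (r i) * ψ y)| ≤
          ∫ y in (x i)..(x (i + 1)), K * |ρb y - r i| := by
        refine intervalIntegral.abs_integral_le_integral_abs hxi |>.trans ?_
        refine intervalIntegral.integral_mono_on hxi ?_ (hIab.const_mul K) fun y _ => ?_
        · exact (hI.intervalIntegrable.sub ((hψ.intervalIntegrable _ _).const_mul _)).abs
        · rw [← sub_mul, abs_mul, mul_comm]
          exact mul_le_mul (hK y) (hlip _ _) (abs_nonneg _) hKn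
      refine f1.trans ?_
      rw [intervalIntegral.integral_const_mul]
      refine mul_le_mul_of_nonneg_left ?_ hKn
      have hsq : Real.sqrt l * Real.sqrt l = l := Real.mul_self_sqrt hl.le
      have hsq0 : 0 < Real.sqrt l := Real.sqrt_pos.mpr hl
      rcases le_total (x (i + 1) - x i) (Real.sqrt l) with hc | hc
      · have f2 : ∫ y in (x i)..(x (i + 1)), |ρb y - r i| ≤
            ∫ y in (x i)..(x (i + 1)), (g (x (i + 1)) - g (x i)) :=
          intervalIntegral.integral_mono_on hxi hIab intervalIntegrable_const
            fun y hy => hclose i hi y hy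
        rw [intervalIntegral.integral_const, smul_eq_mul] at f2
        have f3 := mul_le_mul_of_nonneg_right hc hVn
        have f4 : 0 ≤ Real.sqrt l * (2 * (x (i + 1) - x i)) := by positivity
        linarith
      · have f2 : ∫ y in (x i)..(x (i + 1)), |ρb y - r i| ≤
            ∫ y in (x i)..(x (i + 1)), (ρb y + r i) := by
          rw [intervalIntegral.integral_of_le hxi, intervalIntegral.integral_of_le hxi]
          refine integral_mono_ae ?_ ?_ ?_
          · exact (intervalIntegrable_iff_integrableOn_Ioc_of_le hxi).mp hIab
          · exact (intervalIntegrable_iff_integrableOn_Ioc_of_le hxi).mp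
              (hIntg.intervalIntegrable.add intervalIntegrable_const)
          · refine (ae_restrict_of_ae hnn).mono fun y hy => ?_
            simp only [Pi.zero_apply] at hy
            show |ρb y - r i| ≤ ρb y + r i
            rw [abs_le]; constructor <;> linarith
        rw [intervalIntegral.integral_add hIntg.intervalIntegrable intervalIntegrable_const,
          hcell i hi, intervalIntegral.integral_const, smul_eq_mul, mul_comm, hrD] at f2
        have f3 := mul_le_mul_of_nonneg_left hc hsq0.le
        have f4 : 0 ≤ Real.sqrt l * (g (x (i + 1)) - g (x i)) := by positivity
        linarith
    refine (Finset.sum_le_sum e2).trans ?_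
    rw [← Finset.mul_sum, ← Finset.mul_sum, Finset.sum_add_distrib, ← Finset.mul_sum,
      Finset.sum_range_sub x]
    have := hxb N le_rfl
    rw [hx0]
    gcongr

lemma phi_facts {φ : ℝ → ℝ → ℝ} (hφ : ContDiff ℝ 1 (Function.uncurry φ))
    (hc : HasCompactSupport (Function.uncurry φ)) :
    ∃ (K S : ℝ) (φx φt : ℝ → ℝ → ℝ), 0 ≤ K ∧ 0 ≤ S ∧ 
      Continuous (Function.uncurry φx) ∧ Continuous (Function.uncurry φt) ∧
      (∀ y t, HasDerivAt (fun z => φ z t) (φx y t) y) ∧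
      (∀ y t, HasDerivAt (fun s => φ y s) (φt y t) t) ∧
      (∀ y t, |φ y t| ≤ K) ∧ (∀ y t, |φx y t| ≤ K) ∧ (∀ y t, |φt y t| ≤ K) ∧
      (∀ y t, S < |y| → φ y t = 0 ∧ φx y t = 0 ∧ φt y t = 0) := by
  have hd : ∀ p, HasFDerivAt (Function.uncurry φ) (fderiv ℝ (Function.uncurry φ) p) p := fun p =>
    (hφ.differentiable (by norm_num) p).hasFDerivAt
  have hcont : Continuous (fderiv ℝ (Function.uncurry φ)) := hφ.continuous_fderiv (by norm_num)
  have hcs : HasCompactSupport (fderiv ℝ (Function.uncurry φ)) := hc.fderiv (𝕜 := ℝ)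
  obtain ⟨K1, hK1⟩ := hφ.continuous.bounded_above_of_compact_support hc
  obtain ⟨K2, hK2⟩ := hcont.bounded_above_of_compact_support hcs
  obtain ⟨S, hS⟩ := hc.isCompact.isBounded.subset_closedBall (0 : ℝ × ℝ)
  have hout : ∀ y t, S < |y| → (y, t) ∉ tsupport (Function.uncurry φ) := fun y t h h' => by
    have h1 := hS h'
    rw [mem_closedBall_zero_iff] at h1
    have h2 := norm_fst_le (y, t)
    simp only [Real.norm_eq_abs] at h2
    linarith
  have hn1 : ‖((1:ℝ), (0:ℝ))‖ = 1 := by simp [Prod.norm_def]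
  have hn2 : ‖((0:ℝ), (1:ℝ))‖ = 1 := by simp [Prod.norm_def]
  have hb : ∀ (p e : ℝ × ℝ), ‖e‖ = 1 → |fderiv ℝ (Function.uncurry φ) p e| ≤ max K1 K2 := by
    intro p e he
    have := (fderiv ℝ (Function.uncurry φ) p).le_opNorm e
    rw [he, mul_one] at this
    exact this.trans ((hK2 p).trans (le_max_right _ _))
  have hz : ∀ y t, S < |y| → fderiv ℝ (Function.uncurry φ) (y, t) = 0 := fun y t h => by
    by_contra hne
    exact hout y t h (support_fderiv_subset ℝ hne)
  refine ⟨max K1 K2, max S 0, fun y t => fderiv ℝ (Function.uncurry φ) (y, t) (1, 0),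
    fun y t => fderiv ℝ (Function.uncurry φ) (y, t) (0, 1), 
    le_max_of_le_left ((norm_nonneg _).trans (hK1 (0, 0))), le_max_right _ _,
    hcont.clm_apply continuous_const, hcont.clm_apply continuous_const, ?_, ?_, 
    fun y t => (hK1 (y, t)).trans (le_max_left _ _), fun y t => hb _ _ hn1, fun y t => hb _ _ hn2, ?_⟩
  · intro y t
    have h1 : HasDerivAt (fun z : ℝ => (z, t)) (1, 0) y :=
      (hasDerivAt_id y).prodMk (hasDerivAt_const y t)
    exact (hd (y, t)).comp_hasDerivAt y h1
  · intro y t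
    have h1 : HasDerivAt (fun s : ℝ => (y, s)) (0, 1) t :=
      (hasDerivAt_const t y).prodMk (hasDerivAt_id t)
    exact (hd (y, t)).comp_hasDerivAt t h1
  · intro y t h
    have h' : S < |y| := lt_of_le_of_lt (le_max_left _ _) h
    refine ⟨?_, ?_, ?_⟩
    · exact image_eq_zero_of_notMem_tsupport (f := Function.uncurry φ) (hout y t h')
    · simp [hz y t h']
    · simp [hz y t h']

lemma lip_of_deriv {f f' : ℝ → ℝ} {K : ℝ} (h : ∀ y, HasDerivAt f (f' y) y) (hK : ∀ y, |f' y| ≤ K)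
    (a b : ℝ) : |f a - f b| ≤ K * |a - b| := by
  have := Convex.norm_image_sub_le_of_norm_hasDerivWithin_le (f := f) (f' := f') (s := Set.univ)
    (x := b) (y := a) (C := K)
    (fun x _ => (h x).hasDerivWithinAt) (fun x _ => hK x) convex_univ (Set.mem_univ _) (Set.mem_univ _)
  simpa using this

lemma prim_facts {f : ℝ → ℝ} {K : ℝ} (hf : Continuous f) (hf0 : ∀ a, 0 ≤ f a)
    (hK : ∀ a b, |f a - f b| ≤ K * |a - b|) :
    (∀ a b, (∫ s in (0:ℝ)..b, f s) - (∫ s in (0:ℝ)..a, f s) = ∫ s in a..b, f s) ∧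
    (∀ a h, |(∫ s in (0:ℝ)..(a + h), f s) - (∫ s in (0:ℝ)..a, f s) - h * f a| ≤ K * h ^ 2) ∧
    Monotone (fun z => ∫ s in (0:ℝ)..z, f s) := by
  have h1 : ∀ a b, (∫ s in (0:ℝ)..b, f s) - (∫ s in (0:ℝ)..a, f s) = ∫ s in a..b, f s := fun a b =>
    intervalIntegral.integral_interval_sub_left (hf.intervalIntegrable _ _)
      (hf.intervalIntegrable _ _)
  refine ⟨h1, ?_, ?_⟩
  · intro a h
    rw [h1]
    have e : (∫ s in a..(a + h), f s) - h * f a = ∫ s in a..(a + h), (f s - f a) := by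
      rw [intervalIntegral.integral_sub (hf.intervalIntegrable _ _) (by simp)]
      simp
    rw [e]
    have hK0 : 0 ≤ K := by
      have := (abs_nonneg _).trans (hK 1 0)
      simpa using this
    have := intervalIntegral.norm_integral_le_of_norm_le_const (a := a) (b := a + h)
      (f := fun s => f s - f a) (C := K * |h|) (fun s hs => by
        refine (hK s a).trans ?_
        have := Set.abs_sub_left_of_mem_uIcc (Set.uIoc_subset_uIcc hs)
        simp at this
        gcongr)
    rw [Real.norm_eq_abs] at this
    refine this.trans ?_
    rw [add_sub_cancel_left, ← sq_abs h]
    apply le_of_eq; ring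
  · intro a b hab
    have := intervalIntegral.integral_nonneg (f := f) (μ := volume) hab (fun u _ => hf0 u)
    rw [← h1] at this
    simpa using this

lemma v_facts {R Lv : ℝ} {v : ℝ → ℝ} (hR : 0 < R)
    (hv : ContDiffOn ℝ 1 v (Set.Icc 0 R))
    (hv' : ∀ ρ' ∈ Set.Icc (0 : ℝ) R, derivWithin v (Set.Icc 0 R) ρ' < 0)
    (hvleft : ∀ ρ' < (0 : ℝ), v ρ' = v 0)
    (hvright : ∀ ρ', R < ρ' → v ρ' = v R)
    (hLv : ∀ a ∈ Set.Icc (0 : ℝ) R, ∀ b ∈ Set.Icc (0 : ℝ) R, |v a - v b| ≤ Lv * |a - b|) :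
    0 ≤ Lv ∧ Antitone v ∧ (∀ a b, |v a - v b| ≤ Lv * |a - b|) ∧ ∃ Cv, ∀ a, |v a| ≤ Cv := by
  have hL0 : 0 ≤ Lv := by
    have := (abs_nonneg _).trans (hLv R ⟨hR.le, le_rfl⟩ 0 ⟨le_rfl, hR.le⟩)
    rw [sub_zero, abs_of_pos hR] at this
    exact nonneg_of_mul_nonneg_left this hR
  have hanti : AntitoneOn v (Set.Icc 0 R) := by
    refine antitoneOn_of_deriv_nonpos (convex_Icc _ _) hv.continuousOn ?_ ?_
    · exact (hv.differentiableOn (by norm_num)).mono interior_subset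
    · intro y hy
      have h1 := hv' y (interior_subset hy)
      rw [derivWithin_of_mem_nhds (mem_interior_iff_mem_nhds.mp hy)] at h1
      exact h1.le
  obtain ⟨c, hc⟩ : ∃ c : ℝ → ℝ, ∀ a, c a = max 0 (min R a) := ⟨_, fun _ => rfl⟩
  have hcI : ∀ a, c a ∈ Set.Icc 0 R := fun a => by
    rw [hc]; exact ⟨le_max_left _ _, max_le hR.le (min_le_left _ _)⟩
  have hvc : ∀ a, v a = v (c a) := fun a => by
    rw [hc]
    rcases lt_or_ge a 0 with h | h
    · rw [min_eq_right (by linarith), max_eq_left h.le]; exact hvleft a h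
    · rcases lt_or_ge R a with h' | h'
      · rw [min_eq_left h'.le, max_eq_right hR.le]; exact hvright a h'
      · rw [min_eq_right h', max_eq_right h]
  have hcm : Monotone c := fun a b h => by
    rw [hc, hc]; exact max_le_max le_rfl (min_le_min le_rfl h)
  have hlip : ∀ a b, |v a - v b| ≤ Lv * |a - b| := fun a b => by
    rw [hvc a, hvc b]
    refine (hLv _ (hcI a) _ (hcI b)).trans ?_
    refine mul_le_mul_of_nonneg_left ?_ hL0
    rw [hc, hc]
    refine (abs_max_sub_max_le_max (0:ℝ) (min R a) 0 (min R b)).trans ?_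
    refine max_le (by simp) ((abs_min_sub_min_le_max R a R b).trans (by simp))
  refine ⟨hL0, ?_, hlip, |v 0| + Lv * R, ?_⟩
  · intro a b h
    rw [hvc a, hvc b]
    exact hanti (hcI a) (hcI b) (hcm h)
  · intro a
    rw [hvc a]
    have h1 := hlip (c a) 0
    have h2 : |c a - 0| ≤ R := by
      rw [sub_zero, abs_of_nonneg (hcI a).1]; exact (hcI a).2
    have h3 := abs_sub_abs_le_abs_sub (v (c a)) (v 0)
    have h4 := mul_le_mul_of_nonneg_left h2 hL0
    linarith

lemma map_sum_ind {ι α : Type*} (s : Finset ι) (A : ι → Set α) (c : ι → ℝ) (h : ℝ → ℝ)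
    (h0 : h 0 = 0) (z : α) (hdisj : ∀ i ∈ s, ∀ j ∈ s, z ∈ A i → z ∈ A j → i = j) :
    h (∑ i ∈ s, c i * (A i).indicator (fun _ => (1:ℝ)) z) =
      ∑ i ∈ s, h (c i) * (A i).indicator (fun _ => (1:ℝ)) z := by
  by_cases hz : ∃ j ∈ s, z ∈ A j
  · obtain ⟨j, hj, hzj⟩ := hz
    have hne : ∀ i ∈ s, i ≠ j → z ∉ A i := fun i hi hij hzi => hij (hdisj i hi j hj hzi hzj)
    rw [Finset.sum_eq_single j, Finset.sum_eq_single j]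
    · simp [hzj]
    · intro i hi hij; simp [hne i hi hij]
    · intro h; exact absurd hj h
    · intro i hi hij; simp [hne i hi hij]
    · intro h; exact absurd hj h
  · push Not at hz
    rw [Finset.sum_eq_zero (fun i hi => by simp [hz i hi]),
      Finset.sum_eq_zero (fun i hi => by simp [hz i hi]), h0]

lemma map_discDens {N M : ℕ} {l τ : ℝ} {x : ℕ → ℕ → ℝ} {h : ℝ → ℝ} (h0 : h 0 = 0) (hτ : 0 < τ)
    (hx : ∀ m ≤ M, ∀ i < N, x i m < x (i + 1) m) (y t : ℝ) :
    h (discDens N M l τ x y t) = ∑ m ∈ Finset.range M, ∑ i ∈ Finset.range N,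
    h (Rd N l x i m) * Set.indicator (Set.Ico (x i m) (x (i + 1) m)) (fun _ => (1 : ℝ)) y *
      Set.indicator (Set.Ico ((m : ℝ) * τ) (((m : ℝ) + 1) * τ)) (fun _ => (1 : ℝ)) t := by
  have key : ∀ c : ℕ → ℕ → ℝ, ∑ m ∈ Finset.range M, ∑ i ∈ Finset.range N,
      c i m * Set.indicator (Set.Ico (x i m) (x (i + 1) m)) (fun _ => (1 : ℝ)) y *
      Set.indicator (Set.Ico ((m : ℝ) * τ) (((m : ℝ) + 1) * τ)) (fun _ => (1 : ℝ)) t =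
      ∑ p ∈ Finset.range M ×ˢ Finset.range N, c p.2 p.1 * Set.indicator
        (Set.Ico (x p.2 p.1) (x (p.2 + 1) p.1) ×ˢ
          (Set.Ico ((p.1 : ℝ) * τ) (((p.1 : ℝ) + 1) * τ))) (fun _ => (1 : ℝ)) (y, t) := by
    intro c
    rw [Finset.sum_product]
    refine Finset.sum_congr rfl fun m _ => Finset.sum_congr rfl fun i _ => ?_
    rw [mul_assoc]
    congr 1
    simp only [Set.indicator_apply, Set.mem_prod]
    split_ifs <;> simp_all
  rw [discDens, key, key (fun i m => h (Rd N l x i m))]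
  refine map_sum_ind _ _ (fun p : ℕ × ℕ => Rd N l x p.2 p.1) h h0 _ ?_
  rintro ⟨m, i⟩ hp ⟨m', i'⟩ hp' hz hz'
  simp only [Finset.mem_product, Finset.mem_range, Set.mem_prod, Set.mem_Ico] at hp hp' hz hz'
  have hm : m = m' := by
    have h1 : (m:ℝ) < m' + 1 := lt_of_mul_lt_mul_right (hz.2.1.trans_lt hz'.2.2) hτ.le
    have h2 : (m':ℝ) < m + 1 := lt_of_mul_lt_mul_right (hz'.2.1.trans_lt hz.2.2) hτ.le
    norm_cast at h1 h2
    omega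
  subst hm
  have hmono : ∀ i j, i ≤ j → j ≤ N → x i m ≤ x j m := by
    intro i j hij
    induction j, hij using Nat.le_induction with
    | base => intro _; exact le_rfl
    | succ j _ ih => intro hj; exact (ih (by omega)).trans (hx m hp.1.le j (by omega)).le
  have hi : i = i' := by
    rcases lt_trichotomy i i' with h | h | h
    · have := hmono (i + 1) i' h (by omega); linarith
    · exact h
    · have := hmono (i' + 1) i h (by omega); linarith
  rw [hi]

lemma integral_ind_Ico {F : ℝ → ℝ} {a b : ℝ} (hab : a ≤ b) :
    ∫ y, Set.indicator (Set.Ico a b) (fun _ => (1 : ℝ)) y * F y = ∫ y in a..b, F y := by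
  have : (fun y => Set.indicator (Set.Ico a b) (fun _ => (1 : ℝ)) y * F y) =
      Set.indicator (Set.Ico a b) F := by
    ext y; simp only [Set.indicator_apply]; split_ifs <;> simp
  rw [this, integral_indicator measurableSet_Ico, intervalIntegral.integral_of_le hab,
    integral_Ico_eq_integral_Ioc]

lemma integrable_ind_Ico {F : ℝ → ℝ} (hF : Continuous F) {a b : ℝ} :
    Integrable (fun y => Set.indicator (Set.Ico a b) (fun _ => (1 : ℝ)) y * F y) := by
  have : (fun y => Set.indicator (Set.Ico a b) (fun _ => (1 : ℝ)) y * F y) =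
      Set.indicator (Set.Ico a b) F := by
    ext y; simp only [Set.indicator_apply]; split_ifs <;> simp
  rw [this, integrable_indicator_iff measurableSet_Ico]
  exact (hF.continuousOn.integrableOn_compact isCompact_Icc).mono_set Set.Ico_subset_Icc_self

lemma integral_discDens {N M : ℕ} {l τ T : ℝ} {x : ℕ → ℕ → ℝ} {h : ℝ → ℝ} {F : ℝ → ℝ → ℝ}
    (h0 : h 0 = 0) (hτ : 0 < τ) (hT : M * τ = T)
    (hx : ∀ m ≤ M, ∀ i < N, x i m < x (i + 1) m) (hF : Continuous (Function.uncurry F)) :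
    ∫ t in (0:ℝ)..T, ∫ y, h (discDens N M l τ x y t) * F y t =
      ∑ m ∈ Finset.range M, ∑ i ∈ Finset.range N, h (Rd N l x i m) *
        ∫ t in ((m:ℝ) * τ)..(((m:ℝ) + 1) * τ), ∫ y in (x i m)..(x (i + 1) m), F y t := by
  have hFy : ∀ t, Continuous (fun y => F y t) := fun t => by fun_prop
  have hin : ∀ t, ∫ y, h (discDens N M l τ x y t) * F y t =
      ∑ m ∈ Finset.range M, ∑ i ∈ Finset.range N, h (Rd N l x i m) *
        (Set.indicator (Set.Ico ((m : ℝ) * τ) (((m : ℝ) + 1) * τ)) (fun _ => (1 : ℝ)) t *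
          ∫ y in (x i m)..(x (i + 1) m), F y t) := by
    intro t
    simp_rw [map_discDens h0 hτ hx, Finset.sum_mul]
    have hIntg : ∀ m i : ℕ, Integrable (fun y => h (Rd N l x i m) *
        Set.indicator (Set.Ico (x i m) (x (i + 1) m)) (fun _ => (1 : ℝ)) y *
        Set.indicator (Set.Ico ((m : ℝ) * τ) (((m : ℝ) + 1) * τ)) (fun _ => (1 : ℝ)) t * F y t) := by
      intro m i
      refine ((integrable_ind_Ico (hFy t) (a := x i m) (b := x (i + 1) m)).const_mul
        (h (Rd N l x i m) * Set.indicator (Set.Ico ((m : ℝ) * τ) (((m : ℝ) + 1) * τ))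
          (fun _ => (1 : ℝ)) t)).congr (ae_of_all _ fun y => ?_)
      show _ = _
      ring
    rw [integral_finsetSum _ fun m _ => integrable_finsetSum _ fun i _ => hIntg m i]
    refine Finset.sum_congr rfl fun m hm => ?_
    rw [integral_finsetSum _ fun i _ => hIntg m i]
    refine Finset.sum_congr rfl fun i hi => ?_
    rw [← integral_ind_Ico (hx m (Finset.mem_range.mp hm).le i (Finset.mem_range.mp hi)).le,
      ← mul_assoc, ← integral_const_mul]
    congr 1; ext y; ring
  simp_rw [hin]
  have hcont : ∀ m i, Continuous (fun t => ∫ y in (x i m)..(x (i + 1) m), F y t) := fun m i =>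
    intervalIntegral.continuous_parametric_intervalIntegral_of_continuous'
      (f := fun t y => F y t) (by fun_prop) _ _
  have hint2 : ∀ m i : ℕ, IntervalIntegrable (fun t => h (Rd N l x i m) *
        (Set.indicator (Set.Ico ((m : ℝ) * τ) (((m : ℝ) + 1) * τ)) (fun _ => (1 : ℝ)) t *
          ∫ y in (x i m)..(x (i + 1) m), F y t)) volume 0 T := fun m i =>
    ((integrable_ind_Ico (hcont m i)).const_mul _).intervalIntegrable
  have hint3 : ∀ m : ℕ, IntervalIntegrable (fun t => ∑ i ∈ Finset.range N, h (Rd N l x i m) *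
        (Set.indicator (Set.Ico ((m : ℝ) * τ) (((m : ℝ) + 1) * τ)) (fun _ => (1 : ℝ)) t *
          ∫ y in (x i m)..(x (i + 1) m), F y t)) volume 0 T := fun m =>
    (integrable_finsetSum _ fun i _ => (integrable_ind_Ico (hcont m i)).const_mul _).intervalIntegrable
  rw [intervalIntegral.integral_finsetSum fun m _ => hint3 m]
  refine Finset.sum_congr rfl fun m hm => ?_
  rw [intervalIntegral.integral_finsetSum fun i _ => hint2 m i]
  refine Finset.sum_congr rfl fun i hi => ?_
  rw [intervalIntegral.integral_const_mul]
  congr 1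
  have hm : m < M := Finset.mem_range.mp hm
  have hm1 : ((m:ℝ) + 1) * τ ≤ T := by
    rw [← hT]; gcongr; exact_mod_cast hm
  have hmτ : (m:ℝ) * τ ≤ ((m:ℝ) + 1) * τ := by gcongr; linarith
  have hT0 : 0 ≤ T := by rw [← hT]; positivity
  have hm0 : 0 ≤ (m:ℝ) * τ := by positivity
  have e : ∀ t, Set.indicator (Set.Ico ((m : ℝ) * τ) (((m : ℝ) + 1) * τ)) (fun _ => (1 : ℝ)) t *
          (∫ y in (x i m)..(x (i + 1) m), F y t) = Set.indicator (Set.Ico ((m : ℝ) * τ) (((m : ℝ) + 1) * τ))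
          (fun t => ∫ y in (x i m)..(x (i + 1) m), F y t) t := by
    intro t; simp only [Set.indicator_apply]; split_ifs <;> simp
  simp_rw [e]
  rw [intervalIntegral.integral_of_le hT0, intervalIntegral.integral_of_le hmτ,
    ← integral_Ico_eq_integral_Ioc, ← integral_Ico_eq_integral_Ioc,
    setIntegral_indicator measurableSet_Ico]
  congr 2
  exact Set.inter_eq_right.mpr (Set.Ico_subset_Ico hm0 hm1)

lemma g_bound {v : ℝ → ℝ} {k R Cv r : ℝ} (hk0 : 0 ≤ k) (hkR : k ≤ R) (hvb : ∀ a, |v a| ≤ Cv)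
    (hr : 0 ≤ r) (hrR : r ≤ R) :
    |(|r - k| * v r - k * |v r - v k| - k * v k)| ≤ 4 * R * Cv := by
  have hCv : 0 ≤ Cv := (abs_nonneg _).trans (hvb 0)
  have h1 : |r - k| ≤ R := abs_le.mpr ⟨by linarith, by linarith⟩
  have a1 : |(|r - k| * v r)| ≤ R * Cv := by
    rw [abs_mul, abs_abs]; exact mul_le_mul h1 (hvb _) (abs_nonneg _) (by linarith)
  have a2 : |(k * |v r - v k|)| ≤ R * (2 * Cv) := by
    rw [abs_mul, abs_abs, abs_of_nonneg hk0]
    refine mul_le_mul hkR ?_ (abs_nonneg _) (by linarith)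
    have := abs_sub (v r) (v k)
    linarith [hvb r, hvb k]
  have a3 : |k * v k| ≤ R * Cv := by
    rw [abs_mul, abs_of_nonneg hk0]; exact mul_le_mul hkR (hvb _) (abs_nonneg _) (by linarith)
  rw [abs_le] at *
  constructor <;> linarith

lemma discrete_ineq {N M : ℕ} {l τ T θ k R Lv Cv K W S0 a b : ℝ} {x : ℕ → ℕ → ℝ} {v : ℝ → ℝ}
    {φ φx φt : ℝ → ℝ → ℝ}
    (hk0 : 0 ≤ k) (hkR : k ≤ R) (hl : 0 < l)
    (hτ : 0 < τ) (hT : M * τ = T) (hθ0 : 0 ≤ θ) (hθ1 : θ ≤ 1) (hLv : 0 ≤ Lv) (hK : 0 ≤ K)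
    (hCFL : θ * τ * Lv * R ^ 2 ≤ l)
    (hanti : Antitone v) (hlip : ∀ a b, |v a - v b| ≤ Lv * |a - b|) (hvb : ∀ a, |v a| ≤ Cv)
    (hs : IsScheme N M l τ θ v x)
    (hbnd : ∀ m ≤ M, ∀ i < N, 0 < Rd N l x i m ∧ Rd N l x i m ≤ R)
    (hW : ∑ i ∈ Finset.range N, |Rd N l x (i + 1) 0 - Rd N l x i 0| ≤ W)
    (ha : a ≤ x 0 0) (hb : x N 0 ≤ b) (hS0 : S0 = b - a + 2 * (Cv * T))
    (cφ : Continuous (Function.uncurry φ))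
    (cφx : Continuous (Function.uncurry φx)) (cφt : Continuous (Function.uncurry φt))
    (dφx : ∀ y t, HasDerivAt (fun z => φ z t) (φx y t) y)
    (dφt : ∀ y t, HasDerivAt (fun s => φ y s) (φt y t) t)
    (bx : ∀ y t, |φx y t| ≤ K) (bt : ∀ y t, |φt y t| ≤ K)
    (hφ0 : ∀ y t, 0 ≤ φ y t) (hφT : ∀ y, φ y T = 0) :
    -(T * ((2 * R ^ 2 * Cv * τ / l) * S0 * (K * (5 * Cv + 5 * R * Lv)) + K * l * (Lv * W)
        + 2 * R * K * Cv ^ 2 * N * τ + 2 * R * K * Cv ^ 2 * τ) + T * (8 * R * Cv * K * N * τ)) ≤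
    (∫ t in (0:ℝ)..T, ∫ y, (|discDens N M l τ x y t - k| - k) * φt y t) +
    (∫ t in (0:ℝ)..T, ∫ y, (|discDens N M l τ x y t - k| * v (discDens N M l τ x y t)
      - k * |v (discDens N M l τ x y t) - v k| - k * v k) * φx y t) +
    ∑ i ∈ Finset.range N, (|Rd N l x i 0 - k| - k) * ∫ y in (x i 0)..(x (i + 1) 0), φ y 0 := by
  have hR : 0 ≤ R := hk0.trans hkR
  have hCv : 0 ≤ Cv := (abs_nonneg _).trans (hvb 0)
  have hT0 : 0 ≤ T := by rw [← hT]; positivity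
  obtain ⟨hx, hxN, hxi⟩ := hs
  have hRN : ∀ m, Rd N l x N m = 0 := fun m => by simp [Rd]
  have hRx : ∀ m ≤ M, ∀ i < N, Rd N l x i m * (x (i + 1) m - x i m) = l := by
    intro m hm i hi
    have := hx m hm i hi
    rw [Rd, if_pos hi, div_mul_cancel₀]
    linarith
  have hX : ∀ m < M, ∀ i ≤ N, x i (m + 1) = x i m + τ * (θ * v (Rd N l x i m) +
      (1 - θ) * v (Rd N l x i (m + 1))) := by
    intro m hm i hi
    rcases hi.lt_or_eq with h | h
    · exact hxi m hm i h
    · subst h; rw [hRN, hRN, hxN m hm]; ring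
  have hTV : ∀ m ≤ M, ∑ i ∈ Finset.range N, |Rd N l x (i + 1) m - Rd N l x i m| ≤ W := by
    intro m
    induction m with
    | zero => intro _; exact hW
    | succ m ih =>
      intro hm
      refine le_trans ?_ (ih (by omega))
      exact tvd (x := fun i => x i m) (X := fun i => x i (m + 1)) (r := fun i => Rd N l x i m)
        (r' := fun i => Rd N l x i (m + 1)) hR hl hτ.le hθ0 hθ1 hLv hCFL hanti hlip
        (hbnd m (by omega)) (hbnd (m + 1) hm) (hRN m) (hRN _) (hRx m (by omega)) (hRx _ hm)
        (hX m (by omega))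
  have hV : ∀ m i, |θ * v (Rd N l x i m) + (1 - θ) * v (Rd N l x i (m + 1))| ≤ Cv := by
    intro m i
    have h1 := abs_le.mp (hvb (Rd N l x i m))
    have h2 := abs_le.mp (hvb (Rd N l x i (m + 1)))
    rw [abs_le]; constructor <;> nlinarith
  have hpos : ∀ m ≤ M, ∀ i ≤ N, |x i m - x i 0| ≤ m * τ * Cv := by
    intro m
    induction m with
    | zero => intro _ i _; simp
    | succ m ih =>
      intro hm i hi
      have e1 := ih (by omega) i hi
      have e2 : |x i (m + 1) - x i m| ≤ τ * Cv := by
        rw [hX m (by omega) i hi, add_sub_cancel_left, abs_mul, abs_of_pos hτ]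
        exact mul_le_mul_of_nonneg_left (hV m i) hτ.le
      have := abs_sub_le (x i (m + 1)) (x i m) (x i 0)
      push_cast
      nlinarith
  have hS : ∀ m ≤ M, x N m - x 0 m ≤ S0 := by
    intro m hm
    have e1 := (abs_le.mp (hpos m hm N le_rfl)).2
    have e2 := (abs_le.mp (hpos m hm 0 (Nat.zero_le _))).1
    have : (m:ℝ) * τ * Cv ≤ Cv * T := by
      rw [← hT, mul_comm]; gcongr
    rw [hS0]; linarith
  -- names
  obtain ⟨h, hh⟩ : ∃ h : ℝ → ℝ, ∀ r, h r = |r - k| - k := ⟨_, fun _ => rfl⟩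
  obtain ⟨g, hg⟩ : ∃ g : ℝ → ℝ, ∀ r, g r = |r - k| * v r - k * |v r - v k| - k * v k :=
    ⟨_, fun _ => rfl⟩
  simp_rw [← hh, ← hg]
  have h0 : h 0 = 0 := by rw [hh]; simp [abs_of_nonneg hk0]
  have g0 : g 0 = 0 := by
    have := hanti hk0
    rw [hg, zero_sub, abs_neg, abs_of_nonneg hk0, abs_of_nonneg (by linarith)]; ring
  have hφc : ∀ t, Continuous (fun y => φ y t) := fun t => by fun_prop
  -- B
  obtain ⟨B, hB⟩ : ∃ B : ℕ → ℕ → ℝ, ∀ m j, B m j = ∑ i ∈ Finset.range N, h (Rd N l x i m) *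
    ∫ y in (x i m)..(x (i + 1) m), φ y (j * τ) := ⟨_, fun _ _ => rfl⟩
  have hB0 : ∑ i ∈ Finset.range N, h (Rd N l x i 0) * ∫ y in (x i 0)..(x (i + 1) 0), φ y 0 = B 0 0 := by
    rw [hB]; simp
  have hBM : B M M = 0 := by
    rw [hB]
    simp [hT, hφT]
  have E1 : (∫ t in (0:ℝ)..T, ∫ y, h (discDens N M l τ x y t) * φt y t) =
      ∑ m ∈ Finset.range M, (B m (m + 1) - B m m) := by
    rw [integral_discDens h0 hτ hT hx cφt]
    refine Finset.sum_congr rfl fun m hm => ?_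
    rw [hB, hB, ← Finset.sum_sub_distrib]
    refine Finset.sum_congr rfl fun i hi => ?_
    rw [← mul_sub]
    congr 1
    rw [intervalIntegral_intervalIntegral_swap]
    · rw [← intervalIntegral.integral_sub ((hφc _).intervalIntegrable _ _)
        ((hφc _).intervalIntegrable _ _)]
      refine intervalIntegral.integral_congr fun y _ => ?_
      rw [intervalIntegral.integral_eq_sub_of_hasDerivAt (f := fun s => φ y s)
        (fun t _ => dφt y t)]
      · push_cast; rfl
      · apply Continuous.intervalIntegrable; fun_prop
    · have c : Continuous (Function.uncurry fun t y => φt y t) := by fun_prop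
      exact (c.continuousOn.integrableOn_compact (isCompact_uIcc.prod isCompact_uIcc)).mono_set
        (Set.prod_mono Set.uIoc_subset_uIcc Set.uIoc_subset_uIcc)
  have E2 : |(∫ t in (0:ℝ)..T, ∫ y, g (discDens N M l τ x y t) * φx y t) -
      ∑ m ∈ Finset.range M, τ * ∑ i ∈ Finset.range N, g (Rd N l x i m) *
        (φ (x (i + 1) m) ((m + 1 : ℕ) * τ) - φ (x i m) ((m + 1 : ℕ) * τ))| ≤
      T * (8 * R * Cv * K * N * τ) := by
    rw [integral_discDens g0 hτ hT hx cφx, ← Finset.sum_sub_distrib]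
    have hm1 : ∀ m ∈ Finset.range M, |(∑ i ∈ Finset.range N, g (Rd N l x i m) *
        ∫ t in ((m:ℝ) * τ)..(((m:ℝ) + 1) * τ), ∫ y in (x i m)..(x (i + 1) m), φx y t) - 
        τ * ∑ i ∈ Finset.range N, g (Rd N l x i m) *
        (φ (x (i + 1) m) ((m + 1 : ℕ) * τ) - φ (x i m) ((m + 1 : ℕ) * τ))| ≤
        N * (4 * R * Cv * (2 * K * τ * τ)) := by
      intro m hm
      have hm' := Finset.mem_range.mp hm
      rw [Finset.mul_sum, ← Finset.sum_sub_distrib]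
      refine (Finset.abs_sum_le_sum_abs _ _).trans ?_
      refine (Finset.sum_le_card_nsmul _ _ (4 * R * Cv * (2 * K * τ * τ)) ?_).trans (by simp)
      intro i hi
      have hi' := Finset.mem_range.mp hi
      have hgb : |g (Rd N l x i m)| ≤ 4 * R * Cv := by
        rw [hg]; exact g_bound hk0 hkR hvb (hbnd m hm'.le i hi').1.le (hbnd m hm'.le i hi').2
      have e1 : ∀ t, ∫ y in (x i m)..(x (i + 1) m), φx y t = φ (x (i + 1) m) t - φ (x i m) t := by
        intro t
        refine intervalIntegral.integral_eq_sub_of_hasDerivAt (f := fun y => φ y t)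
          (fun y _ => dφx y t) ?_
        apply Continuous.intervalIntegrable; fun_prop
      simp_rw [e1]
      have e2 : g (Rd N l x i m) * (∫ t in ((m:ℝ) * τ)..(((m:ℝ) + 1) * τ),
          (φ (x (i + 1) m) t - φ (x i m) t)) - τ * (g (Rd N l x i m) *
        (φ (x (i + 1) m) ((m + 1 : ℕ) * τ) - φ (x i m) ((m + 1 : ℕ) * τ))) =
        g (Rd N l x i m) * ∫ t in ((m:ℝ) * τ)..(((m:ℝ) + 1) * τ), ((φ (x (i + 1) m) t - φ (x i m) t)
          - (φ (x (i + 1) m) ((m + 1 : ℕ) * τ) - φ (x i m) ((m + 1 : ℕ) * τ))) := by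
        have ci : IntervalIntegrable (fun t => φ (x (i + 1) m) t - φ (x i m) t) volume
            ((m:ℝ) * τ) (((m:ℝ) + 1) * τ) := by
          apply Continuous.intervalIntegrable; fun_prop
        rw [intervalIntegral.integral_sub ci intervalIntegrable_const,
          intervalIntegral.integral_const, smul_eq_mul]
        ring
      rw [e2, abs_mul]
      refine mul_le_mul hgb ?_ (abs_nonneg _) (by positivity)
      have hmτ : (m:ℝ) * τ ≤ ((m:ℝ) + 1) * τ := by gcongr; linarith
      have e3 := intervalIntegral.norm_integral_le_of_norm_le_const (C := 2 * K * τ)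
        (a := (m:ℝ) * τ) (b := ((m:ℝ) + 1) * τ)
        (f := fun t => ((φ (x (i + 1) m) t - φ (x i m) t)
          - (φ (x (i + 1) m) ((m + 1 : ℕ) * τ) - φ (x i m) ((m + 1 : ℕ) * τ)))) (by
        intro t ht
        rw [Set.uIoc_of_le hmτ] at ht
        have l1 := lip_of_deriv (dφt (x (i + 1) m)) (bt (x (i + 1) m)) t ((m + 1 : ℕ) * τ)
        have l2 := lip_of_deriv (dφt (x i m)) (bt (x i m)) t ((m + 1 : ℕ) * τ)
        have l3 : |t - ((m + 1 : ℕ) * τ)| ≤ τ := by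
          push_cast
          rw [abs_le]; constructor <;> linarith [ht.1, ht.2]
        have l4 := mul_le_mul_of_nonneg_left l3 hK
        have l1 := abs_le.mp (l1.trans l4)
        have l2 := abs_le.mp (l2.trans l4)
        rw [Real.norm_eq_abs, abs_le]
        constructor <;> linarith [l1.1, l1.2, l2.1, l2.2])
      rw [show ((m:ℝ) + 1) * τ - m * τ = τ by ring, abs_of_pos hτ] at e3
      exact e3
    refine (Finset.abs_sum_le_sum_abs _ _).trans ((Finset.sum_le_card_nsmul _ _ _ hm1).trans ?_)
    simp only [Finset.card_range, nsmul_eq_mul]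
    rw [← hT]
    exact le_of_eq (by ring)
  have E3 : ∀ m ∈ Finset.range M, B (m + 1) (m + 1) - B m (m + 1) ≤ 
      τ * ∑ i ∈ Finset.range N, g (Rd N l x i m) *
        (φ (x (i + 1) m) ((m + 1 : ℕ) * τ) - φ (x i m) ((m + 1 : ℕ) * τ)) +
      τ * ((2 * R ^ 2 * Cv * τ / l) * S0 * (K * (5 * Cv + 5 * R * Lv)) + K * l * (Lv * W)
        + 2 * R * K * Cv ^ 2 * N * τ + 2 * R * K * Cv ^ 2 * τ) := by
    intro m hm
    have hm' := Finset.mem_range.mp hm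
    have hψl : ∀ a b, |φ a ((m + 1 : ℕ) * τ) - φ b ((m + 1 : ℕ) * τ)| ≤ K * |a - b| :=
      lip_of_deriv (f := fun y => φ y ((m + 1 : ℕ) * τ)) (fun y => dφx y _) (fun y => bx y _)
    obtain ⟨p1, p2, p3⟩ := prim_facts (hφc ((m + 1 : ℕ) * τ)) (fun y => hφ0 y _) hψl
    have st := step_ineq (x := fun i => x i m) (X := fun i => x i (m + 1))
      (r := fun i => Rd N l x i m) (ψ := fun y => φ y ((m + 1 : ℕ) * τ))
      (r' := fun i => Rd N l x i (m + 1)) hk0 hkR hl hτ.le hθ0 hθ1 hLv hK hCFL hanti hlip hvb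
        (hbnd m (by omega)) (hbnd (m + 1) hm') (hRN m) (hRN _) (hx m (by omega))
        (hRx m (by omega)) (hRx _ hm')
        (hX m (by omega)) (fun y => hφ0 y _) hψl p2 p3 (hTV m (by omega)) (hTV _ hm')
    simp_rw [p1, ← hh, ← hg] at st
    rw [hB, hB]
    refine st.trans ?_
    have := hS m (by omega)
    have hKK : 0 ≤ K * (5 * Cv + 5 * R * Lv) := by positivity
    have hcc : 0 ≤ 2 * R ^ 2 * Cv * τ / l := by positivity
    gcongr
  have E4 := Finset.sum_le_sum E3
  rw [Finset.sum_add_distrib, Finset.sum_const, Finset.card_range, nsmul_eq_mul, ← mul_assoc, hT] at E4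
  have E5 : ∑ m ∈ Finset.range M, (B (m + 1) (m + 1) - B m (m + 1)) =
      -(∑ m ∈ Finset.range M, (B m (m + 1) - B m m)) - B 0 0 := by
    have := Finset.sum_range_sub (fun m => B m m) M
    simp only [hBM] at this
    have e : ∑ m ∈ Finset.range M, (B (m + 1) (m + 1) - B m (m + 1)) =
      (∑ m ∈ Finset.range M, (B (m + 1) (m + 1) - B m m)) -
      ∑ m ∈ Finset.range M, (B m (m + 1) - B m m) := by
      rw [← Finset.sum_sub_distrib]; exact Finset.sum_congr rfl fun _ _ => by ring
    rw [e, this]; ring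
  rw [E5] at E4
  rw [E1, hB0]
  have E2' := (abs_le.mp E2).1
  linarith

lemma bdd_int {F : ℝ → ℝ → ℝ} {T C S : ℝ} (hT : 0 ≤ T) (hF : Measurable (Function.uncurry F))
    (hb : ∀ t ∈ Set.Icc (0:ℝ) T, ∀ y, |F y t| ≤ C)
    (hs : ∀ t ∈ Set.Icc (0:ℝ) T, ∀ y, S < |y| → F y t = 0) :
    Integrable (fun p : ℝ × ℝ => F p.2 p.1) ((volume.restrict (Set.Ioc 0 T)).prod volume) := by
  have hi : Integrable (Set.indicator (Set.Icc (-S) S) (fun _ : ℝ => C)) volume := by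
    rw [integrable_indicator_iff measurableSet_Icc]
    exact integrableOn_const (by simp)
  have hi2 : Integrable (fun p : ℝ × ℝ => Set.indicator (Set.Icc (-S) S) (fun _ : ℝ => C) p.2)
      ((volume.restrict (Set.Ioc 0 T)).prod volume) := hi.comp_snd _
  refine hi2.mono' (hF.comp measurable_swap).aestronglyMeasurable ?_
  have : ∀ᵐ p : ℝ × ℝ ∂((volume.restrict (Set.Ioc 0 T)).prod volume), p.1 ∈ Set.Ioc 0 T :=
    Measure.quasiMeasurePreserving_fst.ae (ae_restrict_mem measurableSet_Ioc)
  filter_upwards [this] with p hp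
  have hp' : p.1 ∈ Set.Icc (0:ℝ) T := ⟨hp.1.le, hp.2⟩
  by_cases h : p.2 ∈ Set.Icc (-S) S
  · rw [Set.indicator_of_mem h]; exact hb _ hp' _
  · rw [Set.indicator_of_notMem h, hs _ hp' _ (by
      by_contra hc
      push Not at hc
      exact h (abs_le.mp hc))]
    simp

lemma iter_eq {F : ℝ → ℝ → ℝ} {T : ℝ} (hT : 0 ≤ T)
    (hi : Integrable (fun p : ℝ × ℝ => F p.2 p.1) ((volume.restrict (Set.Ioc 0 T)).prod volume)) :
    ∫ t in (0:ℝ)..T, ∫ y, F y t =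
      ∫ p : ℝ × ℝ, F p.2 p.1 ∂((volume.restrict (Set.Ioc 0 T)).prod volume) := by
  rw [integral_prod _ hi, intervalIntegral.integral_of_le hT]

lemma sign_id {v : ℝ → ℝ} (hanti : Antitone v) (k r : ℝ) :
    Real.sign (r - k) * (r * v r - k * v k) = |r - k| * v r - k * |v r - v k| := by
  rcases lt_trichotomy r k with h | h | h
  · have := hanti h.le
    rw [Real.sign_of_neg (by linarith), abs_of_neg (by linarith), abs_of_nonneg (by linarith)]
    ring
  · simp [h]
  · have := hanti h.le
    rw [Real.sign_of_pos (by linarith), abs_of_pos (by linarith), abs_of_nonpos (by linarith)]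
    ring

lemma g_lip {v : ℝ → ℝ} {k R Cv Lv r s : ℝ} (hk0 : 0 ≤ k) (hkR : k ≤ R) (hLv : 0 ≤ Lv)
    (hvb : ∀ a, |v a| ≤ Cv) (hlip : ∀ a b, |v a - v b| ≤ Lv * |a - b|) (hs : |s| ≤ R) :
    |(|r - k| * v r - k * |v r - v k| - k * v k) - (|s - k| * v s - k * |v s - v k| - k * v k)| ≤
      (Cv + 3 * R * Lv) * |r - s| := by
  have hR : 0 ≤ R := hk0.trans hkR
  have e1 : |(|r - k| - |s - k|) * v r| ≤ Cv * |r - s| := by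
    rw [abs_mul, mul_comm]
    refine mul_le_mul (hvb _) ?_ (abs_nonneg _) ((abs_nonneg _).trans (hvb 0))
    simpa using abs_abs_sub_abs_le_abs_sub (r - k) (s - k)
  have e2 : |(|s - k| * (v r - v s))| ≤ (2 * R) * (Lv * |r - s|) := by
    rw [abs_mul, abs_abs]
    refine mul_le_mul ?_ (hlip _ _) (abs_nonneg _) (by positivity)
    have := abs_le.mp hs
    rw [abs_le]; constructor <;> linarith
  have e3 : |k * (|v r - v k| - |v s - v k|)| ≤ R * (Lv * |r - s|) := by
    rw [abs_mul, abs_of_nonneg hk0]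
    refine mul_le_mul hkR ?_ (abs_nonneg _) hR
    refine le_trans ?_ (hlip r s)
    simpa using abs_abs_sub_abs_le_abs_sub (v r - v k) (v s - v k)
  have e : (|r - k| * v r - k * |v r - v k| - k * v k) - (|s - k| * v s - k * |v s - v k| - k * v k)
    = (|r - k| - |s - k|) * v r + |s - k| * (v r - v s) - k * (|v r - v k| - |v s - v k|) := by ring
  rw [e]
  have a1 := abs_sub ((|r - k| - |s - k|) * v r + |s - k| * (v r - v s))
    (k * (|v r - v k| - |v s - v k|))
  have a2 := abs_add_le ((|r - k| - |s - k|) * v r) (|s - k| * (v r - v s))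
  linarith

lemma discDens_meas {N M : ℕ} {l τ : ℝ} {x : ℕ → ℕ → ℝ} :
    Measurable (Function.uncurry (discDens N M l τ x)) := by
  unfold discDens Function.uncurry
  refine Finset.measurable_sum _ fun m _ => Finset.measurable_sum _ fun i _ => ?_
  refine (measurable_const.mul ?_).mul ?_
  · exact (measurable_const.indicator measurableSet_Ico).comp measurable_fst
  · exact (measurable_const.indicator measurableSet_Ico).comp measurable_snd

lemma discDens_bd {N M : ℕ} {l τ R : ℝ} {x : ℕ → ℕ → ℝ} (hR : 0 ≤ R) (hτ : 0 < τ)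
    (hx : ∀ m ≤ M, ∀ i < N, x i m < x (i + 1) m)
    (hbnd : ∀ m ≤ M, ∀ i < N, 0 < Rd N l x i m ∧ Rd N l x i m ≤ R) (y t : ℝ) :
    0 ≤ discDens N M l τ x y t ∧ discDens N M l τ x y t ≤ R := by
  have h := map_discDens (h := fun r => max 0 (min R r)) (l := l) (by simp [hR]) hτ hx y t
  have e : discDens N M l τ x y t = max 0 (min R (discDens N M l τ x y t)) := by
    rw [h]
    unfold discDens
    refine Finset.sum_congr rfl fun m hm => Finset.sum_congr rfl fun i hi => ?_
    have := hbnd m (Finset.mem_range.mp hm).le i (Finset.mem_range.mp hi)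
    rw [min_eq_right this.2, max_eq_right this.1.le]
  rw [e]
  exact ⟨le_max_left _ _, max_le hR (min_le_left _ _)⟩

lemma discDens_supp {N M : ℕ} {l τ : ℝ} {x : ℕ → ℕ → ℝ} :
    ∃ S, ∀ y t, S < |y| → discDens N M l τ x y t = 0 := by
  refine ⟨∑ m ∈ Finset.range (M + 1), ∑ i ∈ Finset.range (N + 1), |x i m|, fun y t hy => ?_⟩
  have hb : ∀ m < M, ∀ i ≤ N, |x i m| < |y| := by
    intro m hm i hi
    refine lt_of_le_of_lt ?_ hy
    refine le_trans ?_ (Finset.single_le_sum (f := fun m => ∑ i ∈ Finset.range (N + 1), |x i m|)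
      (fun m _ => Finset.sum_nonneg fun i _ => abs_nonneg _) (Finset.mem_range.mpr (by omega : m < M + 1)))
    exact Finset.single_le_sum (f := fun i => |x i m|)
      (fun m _ => abs_nonneg _) (Finset.mem_range.mpr (by omega : i < N + 1))
  unfold discDens
  refine Finset.sum_eq_zero fun m hm => Finset.sum_eq_zero fun i hi => ?_
  have hm := Finset.mem_range.mp hm
  have hi := Finset.mem_range.mp hi
  rw [Set.indicator_of_notMem]
  · ring
  · rintro ⟨h1, h2⟩
    have b1 := abs_lt.mp (hb m hm i hi.le)
    have b2 := abs_lt.mp (hb m hm (i + 1) hi)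
    rcases abs_cases y with h | h <;> linarith

lemma int_cs {f : ℝ → ℝ} {S : ℝ} (hf : Continuous f) (hs : ∀ y, S < |y| → f y = 0) :
    Integrable f := by
  refine hf.integrable_of_hasCompactSupport (HasCompactSupport.intro (isCompact_Icc (a := -S) (b := S)) ?_)
  intro y hy
  refine hs y ?_
  by_contra hc
  push Not at hc
  exact hy (abs_le.mp hc)

lemma const_id {T K S : ℝ} {φ φx φt : ℝ → ℝ → ℝ} (hT : 0 ≤ T)
    (cφ : Continuous (Function.uncurry φ))
    (cφx : Continuous (Function.uncurry φx)) (cφt : Continuous (Function.uncurry φt))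
    (dφx : ∀ y t, HasDerivAt (fun z => φ z t) (φx y t) y)
    (dφt : ∀ y t, HasDerivAt (fun s => φ y s) (φt y t) t)
    (bx : ∀ y t, |φx y t| ≤ K) (bt : ∀ y t, |φt y t| ≤ K)
    (hS : ∀ y t, S < |y| → φ y t = 0 ∧ φx y t = 0 ∧ φt y t = 0)
    (hφT : ∀ y, φ y T = 0) :
    (∫ p : ℝ × ℝ, φx p.2 p.1 ∂((volume.restrict (Set.Ioc 0 T)).prod volume) = 0) ∧
    (∫ p : ℝ × ℝ, φt p.2 p.1 ∂((volume.restrict (Set.Ioc 0 T)).prod volume) = - ∫ y, φ y 0) := by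
  have ix := bdd_int hT cφx.measurable (fun t _ y => bx y t) (fun t _ y hy => (hS y t hy).2.1)
  have it := bdd_int hT cφt.measurable (fun t _ y => bt y t) (fun t _ y hy => (hS y t hy).2.2)
  constructor
  · rw [integral_prod _ ix]
    have : ∀ t, ∫ y, φx y t = 0 := fun t => by
      refine integral_eq_zero_of_hasDerivAt_of_integrable (f := fun y => φ y t) (fun y => dφx y t) ?_ ?_
      · exact int_cs (by fun_prop) (fun y hy => (hS y t hy).2.1)
      · exact int_cs (by fun_prop) (fun y hy => (hS y t hy).1)
    simp [this]
  · rw [integral_prod_symm _ it, ← integral_neg]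
    congr 1; ext y
    simp only
    rw [← intervalIntegral.integral_of_le hT, intervalIntegral.integral_eq_sub_of_hasDerivAt
      (f := fun s => φ y s) (fun t _ => dφt y t), hφT]
    · ring
    · apply Continuous.intervalIntegrable; fun_prop

/-- if in addition `N_n/M_n → 0`, then the `L¹` limit `ρ` of the discrete
densities is an entropy solution: for every `k ∈ [0,R]` and every nonnegative `C¹` test
function `φ` with compact support in `ℝ × [0,T)`, the Kruzhkov entropy inequality holds,
with `f(ρ) = ρ v(ρ)`. -/
theorem limit_is_entropy_solution
    (R T L θ Lv : ℝ) (v : ℝ → ℝ) (ρb : ℝ → ℝ)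
    (Nn Mn : ℕ → ℕ) (x : ℕ → ℕ → ℕ → ℝ) (ρ : ℝ → ℝ → ℝ)
    (hR : 0 < R) (hT : 0 < T) (hLpos : 0 < L)
    (hθ : θ ∈ Set.Icc (0 : ℝ) 1)
    (hv : ContDiffOn ℝ 1 v (Set.Icc 0 R))
    (hv' : ∀ ρ' ∈ Set.Icc (0 : ℝ) R, derivWithin v (Set.Icc 0 R) ρ' < 0)
    (hvleft : ∀ ρ' < (0 : ℝ), v ρ' = v 0)
    (hvright : ∀ ρ', R < ρ' → v ρ' = v R)
    (hLv : ∀ a ∈ Set.Icc (0 : ℝ) R, ∀ b ∈ Set.Icc (0 : ℝ) R, |v a - v b| ≤ Lv * |a - b|)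
    (hBV : BoundedVariationOn ρb Set.univ)
    (hsupp : HasCompactSupport ρb)
    (hbound : ∀ᵐ z ∂(volume : Measure ℝ), ρb z ∈ Set.Icc 0 R)
    (hLdef : (∫ z, ρb z) = L)
    (hNpos : ∀ n, 0 < Nn n) (hMpos : ∀ n, 0 < Mn n)
    (hNtop : Tendsto Nn atTop atTop) (hMtop : Tendsto Mn atTop atTop)
    (hCFL : ∀ n, θ * (Nn n) * T * Lv * R ^ 2 < L * (Mn n))
    (hratio : Tendsto (fun n => (Nn n : ℝ) / (Mn n : ℝ)) atTop (nhds 0))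
    (hscheme : ∀ n, IsScheme (Nn n) (Mn n) (L / Nn n) (T / Mn n) θ v (x n))
    (hinit0 : ∀ n, x n 0 0 = sInf (tsupport ρb))
    (hinit : ∀ n, ∀ i < Nn n,
      IsLeast {z : ℝ | x n i 0 ≤ z ∧ L / Nn n ≤ ∫ s in (x n i 0)..z, ρb s} (x n (i + 1) 0))
    (hbnd : ∀ n, ∀ m ≤ Mn n, ∀ i < Nn n,
      0 < Rd (Nn n) (L / Nn n) (x n) i m ∧ Rd (Nn n) (L / Nn n) (x n) i m ≤ R)
    (hρmeas : Measurable (Function.uncurry ρ))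
    (hρsupp : ∃ A B : ℝ, ∀ t ∈ Set.Icc (0 : ℝ) T, ∀ y : ℝ, (y < A ∨ B < y) → ρ y t = 0)
    (hρbd : ∀ t ∈ Set.Icc (0 : ℝ) T, ∀ᵐ y ∂(volume : Measure ℝ), |ρ y t| ≤ R)
    (hρTV : ∀ t ∈ Set.Icc (0 : ℝ) T,
      eVariationOn (fun y => ρ y t) Set.univ ≤ eVariationOn ρb Set.univ)
    (hconv : Tendsto
      (fun n => ∫ t in (0 : ℝ)..T, ∫ y : ℝ,
        |discDens (Nn n) (Mn n) (L / Nn n) (T / Mn n) (x n) y t - ρ y t|)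
      atTop (nhds 0)) :
    ∀ k ∈ Set.Icc (0 : ℝ) R, ∀ φ : ℝ → ℝ → ℝ,
      ContDiff ℝ 1 (Function.uncurry φ) →
      HasCompactSupport (Function.uncurry φ) →
      (∀ y : ℝ, ∀ t : ℝ, T ≤ t → φ y t = 0) →
      (∀ y t : ℝ, 0 ≤ φ y t) →
      0 ≤ (∫ t in (0 : ℝ)..T, ∫ y : ℝ,
            (|ρ y t - k| * deriv (fun s => φ y s) t +
              Real.sign (ρ y t - k) * (ρ y t * v (ρ y t) - k * v k) *
                deriv (fun z => φ z t) y)) +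
          (∫ y : ℝ, |ρb y - k| * φ y 0) := by
  intro k hk φ hφ hφc hφT hφ0
  obtain ⟨hk0, hkR⟩ := hk
  obtain ⟨hLv0, hanti, hlip, Cv, hvb⟩ := v_facts hR hv hv' hvleft hvright hLv
  obtain ⟨K, S, φx, φt, hK, hS0, cφx, cφt, dφx, dφt, bφ, bx, bt, hS⟩ := phi_facts hφ hφc
  obtain ⟨a, b, TV, hab, hTV, hfacts⟩ := initial_facts hLpos hBV hsupp hbound hLdef
  have hρbint : Integrable ρb := by
    by_contra h
    rw [integral_undef h] at hLdef
    linarith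
  have hCv : 0 ≤ Cv := (abs_nonneg _).trans (hvb 0)
  have hvm : Measurable v := hanti.measurable
  have cφ : Continuous (Function.uncurry φ) := hφ.continuous
  obtain ⟨P, hP⟩ : ∃ P : Measure (ℝ × ℝ), P = (volume.restrict (Set.Ioc 0 T)).prod volume :=
    ⟨_, rfl⟩
  obtain ⟨h, hh⟩ : ∃ h : ℝ → ℝ, ∀ r, h r = |r - k| - k := ⟨_, fun _ => rfl⟩
  obtain ⟨g, hg⟩ : ∃ g : ℝ → ℝ, ∀ r, g r = |r - k| * v r - k * |v r - v k| - k * v k :=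
    ⟨_, fun _ => rfl⟩
  have hhm : Measurable h := by
    rw [show h = fun r => |r - k| - k from funext hh]; fun_prop
  have hgm : Measurable g := by
    rw [show g = fun r => |r - k| * v r - k * |v r - v k| - k * v k from funext hg]; fun_prop
  have hhlip : ∀ p q, |h p - h q| ≤ |p - q| := fun p q => by
    rw [hh, hh]
    simpa using abs_abs_sub_abs_le_abs_sub (p - k) (q - k)
  have hh0 : h 0 = 0 := by rw [hh]; simp [abs_of_nonneg hk0]
  have hhb : ∀ r, |r| ≤ R → |h r| ≤ R := fun r hr => by
    have := hhlip r 0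
    rw [hh0, sub_zero, sub_zero] at this
    exact this.trans hr
  have hg0 : g 0 = 0 := by
    have := hanti hk0
    rw [hg, zero_sub, abs_neg, abs_of_nonneg hk0, abs_of_nonneg (by linarith)]; ring
  have hglip : ∀ r s, |s| ≤ R → |g r - g s| ≤ (Cv + 3 * R * Lv) * |r - s| := fun r s hs => by
    rw [hg, hg]; exact g_lip hk0 hkR hLv0 hvb hlip hs
  have hCg : 0 ≤ Cv + 3 * R * Lv := by positivity
  have hgb : ∀ r, |r| ≤ R → |g r| ≤ (Cv + 3 * R * Lv) * R := fun r hr => by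
    have := hglip r 0 (by simpa using hR.le)
    rw [hg0, sub_zero, sub_zero] at this
    exact this.trans (mul_le_mul_of_nonneg_left hr hCg)
  -- the clamped limit
  obtain ⟨w, hw⟩ : ∃ w : ℝ → ℝ → ℝ, ∀ y t, w y t = max (-R) (min R (ρ y t)) :=
    ⟨_, fun _ _ => rfl⟩
  have hwm : Measurable (Function.uncurry w) := by
    rw [show Function.uncurry w = fun p => max (-R) (min R (Function.uncurry ρ p)) from
      funext fun p => hw p.1 p.2]
    exact measurable_const.max (measurable_const.min hρmeas)
  have hwb : ∀ y t, |w y t| ≤ R := fun y t => by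
    rw [hw, abs_le]
    exact ⟨le_max_left _ _, max_le (by linarith) (min_le_left _ _)⟩
  have hwρ : ∀ t ∈ Set.Icc (0:ℝ) T, ∀ᵐ y ∂(volume : Measure ℝ), ρ y t = w y t := by
    intro t ht
    filter_upwards [hρbd t ht] with y hy
    have := abs_le.mp hy
    rw [hw, min_eq_right this.2, max_eq_right this.1]
  obtain ⟨A, B, hAB⟩ := hρsupp
  have hws : ∀ t ∈ Set.Icc (0:ℝ) T, ∀ y, |A| + |B| < |y| → w y t = 0 := by
    intro t ht y hy
    have : ρ y t = 0 := by
      refine hAB t ht y ?_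
      rcases abs_cases y with h | h
      · right; have := le_abs_self B; have := abs_nonneg A; linarith
      · left; have := neg_abs_le A; have := abs_nonneg B; linarith
    rw [hw, this, min_eq_right hR.le, max_eq_right (by linarith)]
  -- integrability
  have I1 : ∀ u : ℝ → ℝ → ℝ, Measurable (Function.uncurry u) → (∀ y t, |u y t| ≤ R) →
      ∀ (q : ℝ → ℝ) (C : ℝ), Measurable q → (∀ r, |r| ≤ R → |q r| ≤ C) →
      ∀ ζ : ℝ → ℝ → ℝ, Continuous (Function.uncurry ζ) → (∀ y t, |ζ y t| ≤ K) →
      (∀ y t, S < |y| → ζ y t = 0) → Integrable (fun p : ℝ × ℝ => q (u p.2 p.1) * ζ p.2 p.1) P := by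
    intro u um ub q C qm qb ζ cζ bζ sζ
    rw [hP]
    refine bdd_int (F := fun y t => q (u y t) * ζ y t) (C := C * K) (S := S) hT.le
      ((qm.comp um).mul cζ.measurable) ?_ ?_
    · intro t _ y
      rw [abs_mul]
      exact mul_le_mul (qb _ (ub y t)) (bζ y t) (abs_nonneg _) ((abs_nonneg _).trans (qb _ (ub y t)))
    · intro t _ y hy
      simp [sζ y t hy]
  have sx : ∀ y t, S < |y| → φx y t = 0 := fun y t hy => (hS y t hy).2.1
  have st : ∀ y t, S < |y| → φt y t = 0 := fun y t hy => (hS y t hy).2.2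
  obtain ⟨u, hu⟩ : ∃ u : ℕ → ℝ → ℝ → ℝ, ∀ n,
    u n = discDens (Nn n) (Mn n) (L / Nn n) (T / Mn n) (x n) := ⟨_, fun _ => rfl⟩
  have hMr : ∀ n, (0:ℝ) < Mn n := fun n => by exact_mod_cast hMpos n
  have hNr : ∀ n, (0:ℝ) < Nn n := fun n => by exact_mod_cast hNpos n
  have hτ : ∀ n, 0 < T / Mn n := fun n => div_pos hT (hMr n)
  have hum : ∀ n, Measurable (Function.uncurry (u n)) := fun n => by rw [hu]; exact discDens_meas
  have hub : ∀ n y t, |u n y t| ≤ R := fun n y t => by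
    have := discDens_bd hR.le (hτ n) (hscheme n).1 (hbnd n) y t
    rw [hu, abs_le]; exact ⟨by linarith, this.2⟩
  obtain ⟨D, hD⟩ : ∃ D : ℕ → ℝ, ∀ n, D n = ∫ p : ℝ × ℝ, |u n p.2 p.1 - w p.2 p.1| ∂P :=
    ⟨_, fun _ => rfl⟩
  have hDint : ∀ n, Integrable (fun p : ℝ × ℝ => |u n p.2 p.1 - w p.2 p.1|) P := by
    intro n
    obtain ⟨S1, hS1⟩ := discDens_supp (N := Nn n) (M := Mn n) (l := L / Nn n) (τ := T / Mn n)
      (x := x n)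
    rw [hP]
    refine bdd_int (F := fun y t => |u n y t - w y t|) (C := R + R) (S := max S1 (|A| + |B|)) hT.le
      (((hum n).sub hwm).abs) ?_ ?_
    · intro t _ y
      rw [abs_abs]
      exact (abs_sub _ _).trans (add_le_add (hub n y t) (hwb y t))
    · intro t ht y hy
      have h1 := hws t ht y ((le_max_right _ _).trans_lt hy)
      have h2 := hS1 y t ((le_max_left _ _).trans_lt hy)
      simp only [hu, h1, h2]; simp
  have hD0 : Tendsto D atTop (nhds 0) := by
    refine hconv.congr fun n => ?_
    rw [hD, hP, ← iter_eq (F := fun y t => |u n y t - w y t|) hT.le (hP ▸ hDint n)]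
    refine intervalIntegral.integral_congr fun t ht => ?_
    rw [Set.uIcc_of_le hT.le] at ht
    refine integral_congr_ae ?_
    filter_upwards [hwρ t ht] with y hy
    rw [hy, hu]
  have I2 : ∀ n (q : ℝ → ℝ) (C C' : ℝ), Measurable q → (∀ r, |r| ≤ R → |q r| ≤ C) → 0 ≤ C' →
      (∀ r s, |s| ≤ R → |q r - q s| ≤ C' * |r - s|) →
      ∀ ζ : ℝ → ℝ → ℝ, Continuous (Function.uncurry ζ) → (∀ y t, |ζ y t| ≤ K) →
      (∀ y t, S < |y| → ζ y t = 0) →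
      ∫ t in (0:ℝ)..T, ∫ y, q (u n y t) * ζ y t ≤
        (∫ p : ℝ × ℝ, q (w p.2 p.1) * ζ p.2 p.1 ∂P) + C' * K * D n := by
    intro n q C C' qm qb hC' ql ζ cζ bζ sζ
    have i1 := I1 (u n) (hum n) (hub n) q C qm qb ζ cζ bζ sζ
    have i2 := I1 w hwm hwb q C qm qb ζ cζ bζ sζ
    rw [iter_eq (F := fun y t => q (u n y t) * ζ y t) hT.le (hP ▸ i1), ← hP, hD,
      ← integral_const_mul, ← integral_add i2 ((hDint n).const_mul _)]
    refine integral_mono i1 (i2.add ((hDint n).const_mul _)) fun p => ?_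
    simp only [Pi.add_apply]
    have e1 := ql (u n p.2 p.1) (w p.2 p.1) (hwb _ _)
    have e2 : |(q (u n p.2 p.1) - q (w p.2 p.1)) * ζ p.2 p.1| ≤
        (C' * |u n p.2 p.1 - w p.2 p.1|) * K := by
      rw [abs_mul]
      exact mul_le_mul e1 (bζ _ _) (abs_nonneg _) (by positivity)
    have e3 := (abs_le.mp e2).2
    linarith
  -- error term
  obtain ⟨err, herr⟩ : ∃ err : ℕ → ℝ, ∀ n, err n = 
    (T * ((2 * R ^ 2 * Cv * (T / Mn n) / (L / Nn n)) * (b - a + 2 * (Cv * T)) *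
        (K * (5 * Cv + 5 * R * Lv)) + K * (L / Nn n) * (Lv * (2 * TV + R))
        + 2 * R * K * Cv ^ 2 * Nn n * (T / Mn n) + 2 * R * K * Cv ^ 2 * (T / Mn n))
        + T * (8 * R * Cv * K * Nn n * (T / Mn n))) +
      K * (Real.sqrt (L / Nn n) * (TV + 2 * (b - a))) + K * D n + (Cv + 3 * R * Lv) * K * D n :=
    ⟨_, fun _ => rfl⟩
  have herr0 : Tendsto err atTop (nhds 0) := by
    have hNt : Tendsto (fun n => (Nn n : ℝ)) atTop atTop := tendsto_natCast_atTop_atTop.comp hNtop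
    have hMt : Tendsto (fun n => (Mn n : ℝ)) atTop atTop := tendsto_natCast_atTop_atTop.comp hMtop
    have t1 : Tendsto (fun n => L / (Nn n : ℝ)) atTop (nhds 0) := hNt.const_div_atTop L
    have t2 : Tendsto (fun n => T / (Mn n : ℝ)) atTop (nhds 0) := hMt.const_div_atTop T
    have t3 : Tendsto (fun n => Real.sqrt (L / (Nn n : ℝ))) atTop (nhds 0) := by
      have := (Real.continuous_sqrt.tendsto 0).comp t1
      rwa [Real.sqrt_zero] at this
    have hF : Continuous (fun q : ℝ × ℝ × ℝ × ℝ × ℝ => 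
      (T * ((2 * R ^ 2 * Cv * T / L * q.1) * (b - a + 2 * (Cv * T)) *
        (K * (5 * Cv + 5 * R * Lv)) + K * q.2.1 * (Lv * (2 * TV + R))
        + 2 * R * K * Cv ^ 2 * T * q.1 + 2 * R * K * Cv ^ 2 * q.2.2.1)
        + T * (8 * R * Cv * K * T * q.1)) +
      K * (q.2.2.2.1 * (TV + 2 * (b - a))) + K * q.2.2.2.2 + (Cv + 3 * R * Lv) * K * q.2.2.2.2) := by
      fun_prop
    have tq := (hF.tendsto (0, 0, 0, 0, 0)).comp
      (hratio.prodMk_nhds (t1.prodMk_nhds (t2.prodMk_nhds (t3.prodMk_nhds hD0))))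
    simp only [mul_zero, zero_mul, add_zero] at tq
    refine tq.congr fun n => ?_
    have := (hMr n).ne'
    have := (hNr n).ne'
    rw [herr]
    simp only [Function.comp]
    field_simp
  have key : ∀ n, 0 ≤ (∫ p : ℝ × ℝ, h (w p.2 p.1) * φt p.2 p.1 ∂P) +
      (∫ p : ℝ × ℝ, g (w p.2 p.1) * φx p.2 p.1 ∂P) + (∫ y, h (ρb y) * φ y 0) + err n := by
    intro n
    have hl : 0 < L / Nn n := div_pos hLpos (hNr n)
    have hxs := (hscheme n).1 0 (Nat.zero_le _)
    obtain ⟨⟨f1, f2⟩, f3, f4⟩ := hfacts (Nn n) (fun i => x n i 0)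
      (fun i => Rd (Nn n) (L / Nn n) (x n) i 0) (hNpos n) (hinit0 n) hxs (hinit n)
      (fun i hi => by simp [Rd, hi]) (by simp [Rd]) (hbnd n 0 (Nat.zero_le _))
    have hcfl : θ * (T / Mn n) * Lv * R ^ 2 ≤ L / Nn n := by
      rw [le_div_iff₀ (hNr n)]
      have e : θ * (T / Mn n) * Lv * R ^ 2 * Nn n = θ * Nn n * T * Lv * R ^ 2 / Mn n := by
        field_simp
      rw [e, div_le_iff₀ (hMr n)]
      exact (hCFL n).le
    have d := discrete_ineq (M := Mn n) (T := T) hk0 hkR hl (hτ n)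
      (mul_div_cancel₀ T (hMr n).ne')
      hθ.1 hθ.2 hLv0 hK hcfl hanti hlip hvb (hscheme n) (hbnd n) f3 f1 f2 rfl cφ cφx cφt dφx dφt
      bx bt hφ0 (fun y => hφT y T le_rfl)
    simp_rw [← hh, ← hg] at d
    rw [← hu] at d
    have f5 := (abs_le.mp (f4 h (fun y => φ y 0) K hhlip hh0 (by fun_prop) (fun y => bφ y 0))).1
    have j1 := I2 n h R 1 hhm hhb zero_le_one (fun r s _ => by simpa using hhlip r s) φt cφt bt st
    have j2 := I2 n g _ _ hgm hgb hCg hglip φx cφx bx sx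
    rw [herr]
    linarith
  have key2 : 0 ≤ (∫ p : ℝ × ℝ, h (w p.2 p.1) * φt p.2 p.1 ∂P) +
      (∫ p : ℝ × ℝ, g (w p.2 p.1) * φx p.2 p.1 ∂P) + (∫ y, h (ρb y) * φ y 0) := by
    have := ge_of_tendsto (tendsto_const_nhds.add herr0) (Eventually.of_forall key)
    simpa using this
  -- constants
  obtain ⟨c1, c2⟩ := const_id hT.le cφ cφx cφt dφx dφt bx bt hS (fun y => hφT y T le_rfl)
  rw [← hP] at c1 c2
  have iwt := I1 w hwm hwb h R hhm hhb φt cφt bt st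
  have iwx := I1 w hwm hwb g _ hgm hgb φx cφx bx sx
  have ict := I1 w hwm hwb (fun _ => k) |k| measurable_const (fun _ _ => le_rfl) φt cφt bt st
  have icx := I1 w hwm hwb (fun _ => k * v k) |k * v k| measurable_const (fun _ _ => le_rfl)
    φx cφx bx sx
  have main1 : (∫ t in (0 : ℝ)..T, ∫ y : ℝ,
            (|ρ y t - k| * deriv (fun s => φ y s) t +
              Real.sign (ρ y t - k) * (ρ y t * v (ρ y t) - k * v k) *
                deriv (fun z => φ z t) y)) = (∫ p : ℝ × ℝ, h (w p.2 p.1) * φt p.2 p.1 ∂P) +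
      (∫ p : ℝ × ℝ, g (w p.2 p.1) * φx p.2 p.1 ∂P) - k * ∫ y, φ y 0 := by
    have e1 : (∫ t in (0 : ℝ)..T, ∫ y : ℝ,
            (|ρ y t - k| * deriv (fun s => φ y s) t +
              Real.sign (ρ y t - k) * (ρ y t * v (ρ y t) - k * v k) *
                deriv (fun z => φ z t) y)) = ∫ t in (0 : ℝ)..T, ∫ y : ℝ,
          ((h (w y t) * φt y t + g (w y t) * φx y t) + (k * φt y t + k * v k * φx y t)) := by
      refine intervalIntegral.integral_congr fun t ht => ?_
      rw [Set.uIcc_of_le hT.le] at ht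
      refine integral_congr_ae ?_
      filter_upwards [hwρ t ht] with y hy
      rw [hy, (dφt y t).deriv, (dφx y t).deriv, sign_id hanti, hh, hg]
      ring
    rw [e1, iter_eq (F := fun y t => ((h (w y t) * φt y t + g (w y t) * φx y t) +
      (k * φt y t + k * v k * φx y t))) hT.le (hP ▸ ((iwt.add iwx).add (ict.add icx))), ← hP]
    have s1 : Integrable (fun p : ℝ × ℝ => h (w p.2 p.1) * φt p.2 p.1 +
      g (w p.2 p.1) * φx p.2 p.1) P := iwt.add iwx
    have s2 : Integrable (fun p : ℝ × ℝ => k * φt p.2 p.1 + k * v k * φx p.2 p.1) P :=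
      ict.add icx
    rw [integral_add s1 s2, integral_add iwt iwx, integral_add ict icx,
      integral_const_mul, integral_const_mul, c1, c2]
    ring
  have main2 : (∫ y : ℝ, |ρb y - k| * φ y 0) = (∫ y, h (ρb y) * φ y 0) + k * ∫ y, φ y 0 := by
    have i0 : Integrable (fun y => φ y 0) := int_cs (by fun_prop) (fun y hy => (hS y 0 hy).1)
    have i1 : Integrable (fun y => h (ρb y) * φ y 0) := by
      refine (hρbint.abs.mul_const K).mono'
        ((hhm.comp_aemeasurable hρbint.aemeasurable).aestronglyMeasurable.mul
          i0.aestronglyMeasurable) (ae_of_all _ fun y => ?_)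
      rw [Real.norm_eq_abs, abs_mul]
      refine mul_le_mul ?_ (bφ y 0) (abs_nonneg _) (abs_nonneg _)
      simpa [hh0] using hhlip (ρb y) 0
    rw [← integral_const_mul, ← integral_add i1 (i0.const_mul k)]
    congr 1; ext y
    rw [hh]; ring
  rw [main1, main2]
  linarith
end
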